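/- arXiv:2507.11828 — 2 statements merged into one kernel-verified Lean document; each statement's English description precedes it below -/
import Mathlib

section
/- Let q be an odd prime and k ≥ 1 a natural number. Let S be a finite set of integers not containing a perfect q-th power such that S belongs to 𝒯_{k,q} and S is minimal (no proper subset of S belongs to 𝒯_{k,q}). Then |S| > (q^{k+1} − 1)/(q − 1) if and only if |S| ≥ (q^{k+1} − 1)/(q − 1) + q^{k−1}·(q + 1)/2. -/
open Finset

/-- `S ∈ 𝒯_{k,q}`: there is a positive integer `Δ` such that for every natural number `N`
with `Ω(N) ≤ k` and `gcd(N, Δ) = 1`, some `s ∈ S` is a `q`-th power modulo `N`. -/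
def MemT (q k : ℕ) (S : Set ℤ) : Prop :=
  ∃ Δ : ℕ, 0 < Δ ∧ ∀ N : ℕ, 0 < N → N.primeFactorsList.length ≤ k → Nat.Coprime N Δ →
    ∃ s ∈ S, ∃ x : ℤ, (N : ℤ) ∣ x ^ q - s

/-- `s` is a perfect `q`-th power of an integer. -/
def IsPerfectPow (q : ℕ) (s : ℤ) : Prop := ∃ r : ℤ, r ^ q = s

/-- The finite set of primes dividing `∏_{s ∈ S} rad_q(|s|)`, i.e. the primes `p` such that
`q ∤ v_p(|s|)` for some `s ∈ S`. -/
def qPrimes (q : ℕ) (S : Finset ℤ) : Finset ℕ :=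
  S.sup fun s => s.natAbs.primeFactors.filter fun p => ¬ q ∣ s.natAbs.factorization p

/-- The vector `(v_{p_1}(|u|) mod q, …, v_{p_n}(|u|) mod q)` where `p_1 < … < p_n`
is the increasing enumeration of the finite set of primes `P`. -/
def vecOf (q : ℕ) (P : Finset ℕ) (u : ℤ) : Fin P.card → ZMod q :=
  fun i => ((u.natAbs.factorization (P.orderIsoOfFin rfl i).1 : ℕ) : ZMod q)

/-- The projective point `⟨v⟩` of `PG(F_q^n)` spanned by a vector `v`. -/
def projPoint {q n : ℕ} (v : Fin n → ZMod q) : Submodule (ZMod q) (Fin n → ZMod q) :=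
  Submodule.span (ZMod q) {v}

/-- The set of projective points associated with `S` in `PG(F_q^n)`,
`n` being the number of distinct primes dividing `∏_{s ∈ S} rad_q(|s|)`. -/
def assocPoints (q : ℕ) (S : Finset ℤ) :
    Set (Submodule (ZMod q) (Fin (qPrimes q S).card → ZMod q)) :=
  {P | ∃ s ∈ S, P = projPoint (vecOf q (qPrimes q S) s)}

/-- `B` is a `k`-blocking set of `PG(F_q^n)`: every subspace of codimension `k`
contains a nonzero vector spanning a point of `B`. -/
def IsBlockingSet (q n k : ℕ) (B : Set (Submodule (ZMod q) (Fin n → ZMod q))) : Prop :=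
  ∀ W : Submodule (ZMod q) (Fin n → ZMod q), Module.finrank (ZMod q) W = n - k →
    ∃ v ∈ W, v ≠ 0 ∧ projPoint v ∈ B

/-- `B` is (the point set of) a `k`-space of `PG(F_q^n)`. -/
def IsKSpace (q n k : ℕ) (B : Set (Submodule (ZMod q) (Fin n → ZMod q))) : Prop :=
  ∃ W : Submodule (ZMod q) (Fin n → ZMod q), Module.finrank (ZMod q) W = k + 1 ∧
    B = {P | ∃ v ∈ W, v ≠ 0 ∧ P = projPoint v}

/-- `S` and `T` are geometrically `q`-equivalent: some element of `PGL(n, q)` maps the point set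
associated with `S` onto the point set associated with `T`, where the points are computed with
respect to all the primes dividing `(∏_{s ∈ S} rad_q(|s|)) ⬝ (∏_{t ∈ T} rad_q(|t|))`. -/
def GeomEquiv (q : ℕ) (S T : Finset ℤ) : Prop :=
  ∃ Ψ : (Fin (qPrimes q (S ∪ T)).card → ZMod q) ≃ₗ[ZMod q]
        (Fin (qPrimes q (S ∪ T)).card → ZMod q),
    (Submodule.map Ψ.toLinearMap) ''
        {P | ∃ s ∈ S, P = projPoint (vecOf q (qPrimes q (S ∪ T)) s)} =
      {P | ∃ t ∈ T, P = projPoint (vecOf q (qPrimes q (S ∪ T)) t)}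

/-- The set of squares of `F_qˣ` together with `0`. -/
def Q0 (q : ℕ) : Set (ZMod q) := {x | (∃ a : ZMod q, a ≠ 0 ∧ a ^ 2 = x) ∨ x = 0}


namespace Blk
open Polynomial

section OneVar
variable {p : ℕ} [hp : Fact p.Prime]

lemma dvd_radical_mul_derivative (f : (ZMod p)[X]) (hf : f ≠ 0) (hs : f.Splits) :
    ∃ s : (ZMod p)[X], s ∣ f ∧ s ∣ X ^ p - X ∧ f ∣ s * derivative f := by
  classical
  set R := f.roots.toFinset
  have hcop : ∀ (m : ZMod p → ℕ),
      (R : Set (ZMod p)).Pairwise (Function.onFun IsCoprime fun a => (X - C a) ^ m a) := by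
    intro m a _ b _ hab
    exact (pairwise_coprime_X_sub_C (fun _ _ h => h) hab).pow
  have hprod : f = C f.leadingCoeff * ∏ a ∈ R, (X - C a) ^ rootMultiplicity a f := by
    conv_lhs => rw [hs.eq_prod_roots, prod_multiset_root_eq_finset_root]
  refine ⟨∏ a ∈ R, (X - C a), ?_, ?_, ?_⟩
  · have := Finset.prod_dvd_of_coprime (z := f) (hcop fun _ => 1) (by
      intro a ha
      rw [pow_one, dvd_iff_isRoot]
      exact isRoot_of_mem_roots (by simpa [R] using ha))
    simpa using this
  · have := Finset.prod_dvd_of_coprime (z := (X ^ p - X : (ZMod p)[X])) (hcop fun _ => 1) (by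
      intro a ha
      rw [pow_one, dvd_iff_isRoot]
      simp [ZMod.pow_card])
    simpa using this
  · have hu : IsUnit (C f.leadingCoeff) := by
      rw [isUnit_C]
      exact (leadingCoeff_ne_zero.mpr hf).isUnit
    conv_lhs => rw [hprod]
    rw [hu.mul_left_dvd]
    refine Finset.prod_dvd_of_coprime (hcop _) ?_
    intro a ha
    have hm : 0 < rootMultiplicity a f := by
      rw [rootMultiplicity_pos hf]
      exact isRoot_of_mem_roots (by simpa [R] using ha)
    have h1 : (X - C a) ^ (rootMultiplicity a f - 1) ∣ derivative f :=
      pow_sub_one_dvd_derivative_of_pow_dvd (pow_rootMultiplicity_dvd f a)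
    have h2 : (X - C a) ∣ ∏ a ∈ R, (X - C a) := Finset.dvd_prod_of_mem _ ha
    calc (X - C a) ^ rootMultiplicity a f
        = (X - C a) * (X - C a) ^ (rootMultiplicity a f - 1) := by
          rw [← pow_succ']; congr 1; omega
      _ ∣ _ := mul_dvd_mul h2 h1

lemma self_dvd_derivative {g : (ZMod p)[X]} (h : g ∣ derivative g) : derivative g = 0 := by
  by_contra h0
  have h1 := natDegree_le_of_dvd h h0
  have : g.natDegree ≠ 0 := by
    intro h2
    exact h0 (derivative_of_natDegree_zero h2)
  have := natDegree_derivative_lt this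
  omega

lemma core (hodd : Odd p) (j e : ℕ) (hj : 1 ≤ j) (f g h : (ZMod p)[X]) (hf : f ≠ 0)
    (hs : f.Splits) (hfg : f = X ^ (p ^ j) * g + h) (hg : g.natDegree ≤ e) (hh : h.natDegree ≤ e)
    (he : 2 * p * e < p ^ j * (p + 1)) (hc : IsCoprime g h) :
    (derivative g = 0 ∧ derivative h = 0) ∨ (j = 1 ∧ X * g + h = 0) := by
  have hp2 : 2 ≤ p := hp.out.two_le
  by_cases hg0 : g = 0
  · left
    subst hg0
    have hu : IsUnit h := isCoprime_zero_left.mp hc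
    exact ⟨by simp, derivative_of_natDegree_zero (natDegree_eq_zero_of_isUnit hu)⟩
  by_cases hD : derivative h * g - h * derivative g = 0
  · left
    have hD' : derivative h * g = h * derivative g := sub_eq_zero.mp hD
    constructor
    · apply self_dvd_derivative
      exact hc.dvd_of_dvd_mul_left (Dvd.intro_left _ hD')
    · apply self_dvd_derivative
      exact hc.symm.dvd_of_dvd_mul_right (Dvd.intro _ hD'.symm)
  right
  obtain ⟨s, hsf, hsX, hfs⟩ := dvd_radical_mul_derivative f hf hs
  have hpj : p ^ j ≠ 0 := by positivity
  have hder : derivative f = X ^ (p ^ j) * derivative g + derivative h := by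
    rw [hfg]
    simp [derivative_X_pow, show j ≠ 0 by omega]
  have hdvd : f ∣ s * (derivative h * g - h * derivative g) := by
    have : s * (derivative h * g - h * derivative g)
        = s * derivative f * g - f * (s * derivative g) := by
      rw [hder, hfg]; ring
    rw [this]
    exact dvd_sub (hfs.mul_right _) (dvd_mul_right _ _)
  have hs0 : s ≠ 0 := by
    rintro rfl
    exact hf (zero_dvd_iff.mp hsf)
  have h1 := natDegree_le_of_dvd hdvd (mul_ne_zero hs0 hD)
  rw [natDegree_mul hs0 hD] at h1
  have hej : e < p ^ j := by
    have : p ^ j * (p + 1) ≤ p ^ j * (2 * p) := Nat.mul_le_mul_left _ (by omega)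
    by_contra hcon
    push Not at hcon
    have : p ^ j * (2 * p) ≤ e * (2 * p) := Nat.mul_le_mul_right _ hcon
    nlinarith
  have hdf : f.natDegree = p ^ j + g.natDegree := by
    rw [hfg, natDegree_add_eq_left_of_natDegree_lt, natDegree_mul (by simp) hg0, natDegree_X_pow]
    rw [natDegree_mul (by simp) hg0, natDegree_X_pow]
    omega
  have hdD : (derivative h * g - h * derivative g).natDegree + 1 ≤ g.natDegree + h.natDegree := by
    have key : ∀ u v : (ZMod p)[X], derivative u * v = 0 ∨
        (derivative u * v).natDegree + 1 ≤ u.natDegree + v.natDegree := by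
      intro u v
      by_cases hu : u.natDegree = 0
      · left; rw [derivative_of_natDegree_zero hu, zero_mul]
      · right
        have := natDegree_derivative_lt hu
        have := natDegree_mul_le (p := derivative u) (q := v)
        omega
    rw [mul_comm h]
    rw [mul_comm h] at hD
    rcases key h g with h2 | h2 <;> rcases key g h with h3 | h3
    · rw [h2, h3] at hD; simp at hD
    · rw [h2, zero_sub, natDegree_neg]; omega
    · rw [h3, sub_zero]; omega
    · have := natDegree_sub_le (derivative h * g) (derivative g * h)
      omega
  have hX0 : (X ^ p - X : (ZMod p)[X]) ≠ 0 := FiniteField.X_pow_card_sub_X_ne_zero _ hp.out.one_lt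
  have hsp : s.natDegree ≤ p := by
    have := natDegree_le_of_dvd hsX hX0
    rwa [FiniteField.X_pow_card_sub_X_natDegree_eq _ hp.out.one_lt] at this
  have h5 : p ^ j + 1 ≤ s.natDegree + h.natDegree := by omega
  have hj1 : j = 1 := by
    by_contra hne
    obtain ⟨i, rfl⟩ : ∃ i, j = i + 2 := ⟨j - 2, by omega⟩
    have h6 : p ^ (i + 2) + 1 ≤ p + e := by omega
    have hpi : 1 ≤ p ^ i := Nat.one_le_pow _ _ (by omega)
    have e1 : p ^ (i + 2) = p ^ i * p * p := by ring
    rw [e1] at h6 he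
    have h7 : 2 * e < p ^ i * p * (p + 1) := by
      have : p * (2 * e) < p * (p ^ i * p * (p + 1)) := by nlinarith
      exact lt_of_mul_lt_mul_left this (by omega)
    generalize p ^ i = u at *
    zify at *
    nlinarith [mul_nonneg (sub_nonneg.mpr hpi) (show (0:ℤ) ≤ p * (p - 1) by nlinarith)]
  refine ⟨hj1, ?_⟩
  by_contra hne
  subst hj1
  have h8 : s ∣ X * g + h := by
    have : X * g + h = f - (X ^ p - X) * g := by rw [hfg, pow_one]; ring
    rw [this]
    exact dvd_sub hsf (hsX.mul_right _)
  have h9 := natDegree_le_of_dvd h8 hne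
  have h10 : (X * g + h).natDegree ≤ e + 1 := by
    refine (natDegree_add_le _ _).trans ?_
    have : (X * g).natDegree ≤ 1 + g.natDegree := by
      simpa using natDegree_mul_le (p := (X : (ZMod p)[X])) (q := g)
    omega
  rw [pow_one] at *
  have : 2 * e < p + 1 := by
    have : p * (2 * e) < p * (p + 1) := by nlinarith
    exact lt_of_mul_lt_mul_left this (by omega)
  obtain ⟨t, ht⟩ := hodd
  omega

theorem trichotomy (hodd : Odd p) : ∀ (j : ℕ) (e : ℕ) (f g h : (ZMod p)[X]), 1 ≤ j → f ≠ 0 →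
    f.Splits → f = X ^ (p ^ j) * g + h → g.natDegree ≤ e → h.natDegree ≤ e →
    2 * p * e < p ^ j * (p + 1) →
    g = 0 ∨ (∃ a, (X - C a) ^ (p ^ j) ∣ f) ∨ (X ^ p - X) ^ (p ^ (j - 1)) ∣ f := by
  classical
  intro j
  induction j with
  | zero => intro e f g h hj; omega
  | succ j ih =>
  intro e f g h _ hf hs hfg hg hh he
  have hp2 : 2 ≤ p := hp.out.two_le
  -- divide by the gcd
  by_cases hg0 : g = 0
  · exact Or.inl hg0
  set c := EuclideanDomain.gcd g h with hc
  have hc0 : c ≠ 0 := by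
    intro h0
    rw [EuclideanDomain.gcd_eq_zero_iff] at h0
    exact hg0 h0.1
  obtain ⟨g1, hg1⟩ := EuclideanDomain.gcd_dvd_left g h
  obtain ⟨h1, hh1⟩ := EuclideanDomain.gcd_dvd_right g h
  rw [← hc] at hg1 hh1
  have hcop : IsCoprime g1 h1 := by
    obtain ⟨x, y, hxy⟩ : ∃ x y, c = g * x + h * y :=
      ⟨_, _, EuclideanDomain.gcd_eq_gcd_ab g h⟩
    refine ⟨x, y, ?_⟩
    apply mul_left_cancel₀ hc0
    conv_rhs => rw [mul_one, hxy]
    rw [hg1, hh1]; ring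
  set f1 := X ^ (p ^ (j + 1)) * g1 + h1 with hf1
  have hff : f = c * f1 := by rw [hfg, hf1, hg1, hh1]; ring
  have hf10 : f1 ≠ 0 := by rintro h0; rw [h0, mul_zero] at hff; exact hf hff
  have hf1s : f1.Splits := hs.of_dvd hf (Dvd.intro_left _ hff.symm)
  have hg10 : g1 ≠ 0 := by rintro rfl; rw [mul_zero] at hg1; exact hg0 hg1
  have hdg : g1.natDegree ≤ e := (natDegree_le_of_dvd (Dvd.intro_left _ hg1.symm) hg0).trans hg
  have hdh : h1.natDegree ≤ e := by
    by_cases hh0 : h = 0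
    · have : h1 = 0 := by
        rw [hh0] at hh1
        exact (mul_eq_zero.mp hh1.symm).resolve_left hc0
      simp [this]
    · exact (natDegree_le_of_dvd (Dvd.intro_left _ hh1.symm) hh0).trans hh
  right
  rcases core hodd (j + 1) e (by omega) f1 g1 h1 hf10 hf1s rfl hdg hdh he hcop with ⟨hd1, hd2⟩ | ⟨hj1, hz⟩
  · have eg := expand_contract p hd1 hp.out.ne_zero
    have eh := expand_contract p hd2 hp.out.ne_zero
    set g2 := contract p g1
    set h2 := contract p h1
    have dg2 : g2.natDegree * p = g1.natDegree := by rw [← eg, natDegree_expand]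
    have dh2 : h2.natDegree * p = h1.natDegree := by rw [← eh, natDegree_expand]
    rw [ZMod.expand_card] at eg eh
    set f2 := X ^ (p ^ j) * g2 + h2 with hf2
    have hf12 : f1 = f2 ^ p := by
      rw [hf1, hf2, add_pow_char, mul_pow, eg, eh, ← pow_mul, ← pow_succ]
    have hf20 : f2 ≠ 0 := by
      rintro h0
      rw [h0, zero_pow hp.out.ne_zero] at hf12
      exact hf10 hf12
    have hf2s : f2.Splits := hf1s.of_dvd hf10 (hf12 ▸ dvd_pow_self _ hp.out.ne_zero)
    have hg20 : g2 ≠ 0 := by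
      rintro h0
      rw [h0, zero_pow hp.out.ne_zero] at eg
      exact hg10 eg.symm
    have hd2g : g2.natDegree ≤ e / p := by rw [Nat.le_div_iff_mul_le (by omega)]; omega
    have hd2h : h2.natDegree ≤ e / p := by rw [Nat.le_div_iff_mul_le (by omega)]; omega
    by_cases hj0 : j = 0
    · left
      subst hj0
      have he0 : e / p = 0 := by
        rw [Nat.div_eq_zero_iff]; right
        simp only [zero_add, pow_one] at he
        nlinarith
      rw [he0] at hd2g hd2h
      obtain ⟨α, hα⟩ := natDegree_eq_zero.mp (Nat.le_zero.mp hd2g)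
      obtain ⟨β, hβ⟩ := natDegree_eq_zero.mp (Nat.le_zero.mp hd2h)
      have hα0 : α ≠ 0 := by rintro rfl; simp at hα; exact hg20 hα.symm
      refine ⟨-β / α, ?_⟩
      rw [hff, hf12, zero_add, pow_one]
      refine Dvd.dvd.mul_left (pow_dvd_pow_of_dvd ?_ _) _
      rw [dvd_iff_isRoot, IsRoot.def, hf2, ← hα, ← hβ]
      simp
      field_simp
      ring
    · have hep : 2 * p * (e / p) < p ^ j * (p + 1) := by
        have h1 : e / p * p ≤ e := Nat.div_mul_le_self e p
        have : p * (2 * p * (e / p)) < p * (p ^ j * (p + 1)) := by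
          rw [pow_succ] at he
          nlinarith
        exact lt_of_mul_lt_mul_left this (by omega)
      rcases ih (e / p) f2 g2 h2 (by omega) hf20 hf2s rfl hd2g hd2h hep with h0 | ⟨a, ha⟩ | h0
      · exact absurd h0 hg20
      · left
        refine ⟨a, ?_⟩
        rw [hff, hf12, pow_succ, pow_mul]
        exact (pow_dvd_pow_of_dvd ha _).mul_left _
      · right
        rw [hff, hf12, show j + 1 - 1 = (j - 1) + 1 by omega, pow_succ, pow_mul]
        exact (pow_dvd_pow_of_dvd h0 _).mul_left _
  · right
    have hj0 : j = 0 := by omega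
    subst hj0
    have : f1 = (X ^ p - X) * g1 := by
      have h3 : h1 = - (X * g1) := by linear_combination hz
      rw [hf1, h3, zero_add, pow_one]; ring
    rw [hff, this]
    simp only [zero_add, Nat.sub_self, pow_zero, pow_one]
    exact (dvd_mul_right _ _).mul_left _

end OneVar
end Blk


namespace Blk
open Polynomial

section DimTwo

lemma coeff_prod_lin {ι K : Type*} [Field K] (s : Finset ι) (a b c : ι → K) :
    (∏ i ∈ s, (MvPolynomial.C (a i) * MvPolynomial.X 0 + MvPolynomial.C (b i) * MvPolynomial.X 1
      - MvPolynomial.C (c i) : MvPolynomial (Fin 2) K)).totalDegree ≤ s.card ∧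
    ∀ u v : ℕ, u + v = s.card →
      MvPolynomial.coeff (Finsupp.single 0 u + Finsupp.single 1 v)
        (∏ i ∈ s, (MvPolynomial.C (a i) * MvPolynomial.X 0 + MvPolynomial.C (b i) * MvPolynomial.X 1
          - MvPolynomial.C (c i) : MvPolynomial (Fin 2) K))
      = (∏ i ∈ s, (C (a i) + C (b i) * X : K[X])).coeff v := by
  classical
  induction s using Finset.induction_on with
  | empty =>
    refine ⟨by simp, ?_⟩
    intro u v huv
    have hu : u = 0 := by simp at huv; omega
    have hv : v = 0 := by simp at huv; omega
    subst hu hv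
    simp
  | insert i s his ih =>
    obtain ⟨ih1, ih2⟩ := ih
    rw [Finset.prod_insert his, Finset.prod_insert his, Finset.card_insert_of_notMem his]
    set P := ∏ i ∈ s, (MvPolynomial.C (a i) * MvPolynomial.X 0 + MvPolynomial.C (b i) * MvPolynomial.X 1
          - MvPolynomial.C (c i) : MvPolynomial (Fin 2) K) with hP
    set p := ∏ i ∈ s, (C (a i) + C (b i) * X : K[X]) with hp
    have hpd : p.natDegree ≤ s.card := by
      refine (natDegree_prod_le _ _).trans ?_
      refine (Finset.sum_le_card_nsmul s _ 1 ?_).trans (by simp)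
      intro j _
      have := natDegree_linear_le (a := b j) (b := a j)
      rwa [add_comm] at this
    constructor
    · refine (MvPolynomial.totalDegree_mul _ _).trans ?_
      have : (MvPolynomial.C (a i) * MvPolynomial.X 0 + MvPolynomial.C (b i) * MvPolynomial.X 1
          - MvPolynomial.C (c i) : MvPolynomial (Fin 2) K).totalDegree ≤ 1 := by
        refine (MvPolynomial.totalDegree_sub _ _).trans ?_
        refine max_le ((MvPolynomial.totalDegree_add _ _).trans (max_le ?_ ?_)) ?_
        · refine (MvPolynomial.totalDegree_mul _ _).trans ?_
          simp
        · refine (MvPolynomial.totalDegree_mul _ _).trans ?_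
          simp
        · simp
      omega
    · intro u v huv
      have h0 : MvPolynomial.coeff (Finsupp.single 0 u + Finsupp.single 1 v) P = 0 := by
        apply MvPolynomial.coeff_eq_zero_of_totalDegree_lt
        refine lt_of_le_of_lt ih1 ?_
        have h2 : (Finsupp.single 0 u + Finsupp.single 1 v : Fin 2 →₀ ℕ).degree = u + v := by
          simp [Finsupp.degree_single]
        have h3 : (Finsupp.single 0 u + Finsupp.single 1 v : Fin 2 →₀ ℕ).degree =
          ∑ i ∈ (Finsupp.single 0 u + Finsupp.single 1 v : Fin 2 →₀ ℕ).support, (Finsupp.single 0 u + Finsupp.single 1 v : Fin 2 →₀ ℕ) i := rfl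
        rw [← h3, h2]; omega
      rw [sub_mul, add_mul, mul_assoc, mul_assoc, MvPolynomial.coeff_sub, MvPolynomial.coeff_add,
        MvPolynomial.coeff_C_mul, MvPolynomial.coeff_C_mul, MvPolynomial.coeff_C_mul, h0, mul_zero, sub_zero,
        add_mul, mul_assoc, Polynomial.coeff_add, Polynomial.coeff_C_mul, Polynomial.coeff_C_mul]
      congr 2
      · rcases u with _ | u
        · rw [MvPolynomial.coeff_X_mul', if_neg (by simp)]
          rw [coeff_eq_zero_of_natDegree_lt (by omega)]
        · rw [add_comm u 1, Finsupp.single_add, add_assoc, MvPolynomial.coeff_X_mul]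
          exact ih2 _ _ (by omega)
      · rcases v with _ | v
        · rw [MvPolynomial.coeff_X_mul', if_neg (by simp)]
          rw [Polynomial.coeff_X_mul_zero]
        · rw [add_comm v 1, Finsupp.single_add, add_left_comm, MvPolynomial.coeff_X_mul, add_comm 1 v,
            Polynomial.coeff_X_mul]
          exact ih2 _ _ (by omega)

lemma le_card_of_pow_dvd {ι F : Type*} [Field F] [DecidableEq F] (s : Finset ι) (a b : ι → F)
    (h0 : ∀ i ∈ s, a i ≠ 0 ∨ b i ≠ 0) (r : F) (n : ℕ)
    (hd : (X - C r) ^ n ∣ ∏ i ∈ s, (C (a i) + C (b i) * X)) :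
    n ≤ (s.filter fun i => a i + b i * r = 0).card := by
  have hne : ∀ i ∈ s, (C (a i) + C (b i) * X : F[X]) ≠ 0 := by
    intro i hi h
    have h1 := congrArg (fun p => Polynomial.coeff p 0) h
    have h2 := congrArg (fun p => Polynomial.coeff p 1) h
    simp [Polynomial.coeff_C] at h1 h2
    rcases h0 i hi with h | h <;> contradiction
  have hP : (∏ i ∈ s, (C (a i) + C (b i) * X : F[X])) ≠ 0 := Finset.prod_ne_zero_iff.mpr hne
  rw [← le_rootMultiplicity_iff hP] at hd
  refine hd.trans ?_
  rw [← count_roots, roots_prod _ _ hP, Multiset.count_bind, Finset.card_filter]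
  refine Finset.sum_le_sum ?_
  intro i hi
  rw [count_roots]
  split_ifs with h
  · refine (rootMultiplicity_le_iff (hne i hi) _ _).mpr ?_
    intro hd
    have := natDegree_le_of_dvd hd (hne i hi)
    have h3 := natDegree_linear_le (a := b i) (b := a i)
    rw [add_comm] at h3
    rw [natDegree_pow, natDegree_X_sub_C] at this
    omega
  · rw [rootMultiplicity_eq_zero]
    intro h4
    apply h
    simpa [IsRoot] using h4

theorem dim_two {q k : ℕ} [hq : Fact q.Prime] (hodd : Odd q) (hk : 1 ≤ k) {K : Type*} [Field K]
    [Fintype K] [Algebra (ZMod q) K] (hK : Fintype.card K = q ^ k)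
    {ι : Type*} (s : Finset ι) (a b : ι → ZMod q) (c : ι → K)
    (h0 : ∀ i ∈ s, a i ≠ 0 ∨ b i ≠ 0)
    (hcov : ∀ S T : K, ∃ i ∈ s, a i • S + b i • T = c i)
    (hcard : 2 * q * s.card < 2 * q * q ^ k + q ^ k * (q + 1))
    (ha : (s.filter fun i => a i = 0).card < q ^ (k - 1)) :
    ∃ z w : ZMod q, (z ≠ 0 ∨ w ≠ 0) ∧ q ^ k ≤ (s.filter fun i => a i * z + b i * w = 0).card := by
  classical
  have hq2 : 2 ≤ q := hq.out.two_le
  set Q := q ^ k with hQ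
  set f : (ZMod q)[X] := ∏ i ∈ s, (C (a i) + C (b i) * X) with hf
  have hne : ∀ i ∈ s, (C (a i) + C (b i) * X : (ZMod q)[X]) ≠ 0 := by
    intro i hi h
    have h1 := congrArg (fun p => Polynomial.coeff p 0) h
    have h2 := congrArg (fun p => Polynomial.coeff p 1) h
    simp [Polynomial.coeff_C] at h1 h2
    rcases h0 i hi with h | h <;> contradiction
  have hf0 : f ≠ 0 := Finset.prod_ne_zero_iff.mpr hne
  have hdeg1 : ∀ i, (C (a i) + C (b i) * X : (ZMod q)[X]).natDegree ≤ 1 := by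
    intro i
    have := natDegree_linear_le (a := b i) (b := a i)
    rwa [add_comm] at this
  have hfs : f.Splits := by
    apply Splits.prod
    intro i hi
    exact Splits.of_natDegree_le_one (hdeg1 i)
  have hfd : f.natDegree ≤ s.card := by
    refine (natDegree_prod_le _ _).trans ?_
    refine (Finset.sum_le_card_nsmul s _ 1 ?_).trans (by simp)
    intro j _
    exact hdeg1 j
  -- vanishing coefficients
  have hvan : ∀ u v, u + v = s.card → u < Q → v < Q → f.coeff v = 0 := by
    intro u v huv hu hv
    by_contra hne0
    set P := ∏ i ∈ s, (MvPolynomial.C (algebraMap (ZMod q) K (a i)) * MvPolynomial.X 0 +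
      MvPolynomial.C (algebraMap (ZMod q) K (b i)) * MvPolynomial.X 1
          - MvPolynomial.C (c i) : MvPolynomial (Fin 2) K) with hP
    obtain ⟨hd, hc⟩ := coeff_prod_lin s (fun i => algebraMap (ZMod q) K (a i))
      (fun i => algebraMap (ZMod q) K (b i)) c
    have hc1 := hc u v huv
    have hm : (∏ i ∈ s, (C (algebraMap (ZMod q) K (a i)) + C (algebraMap (ZMod q) K (b i)) * X : K[X]))
        = f.map (algebraMap (ZMod q) K) := by
      rw [hf, Polynomial.map_prod]
      simp
    rw [hm, coeff_map] at hc1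
    have hcne : MvPolynomial.coeff (Finsupp.single 0 u + Finsupp.single 1 v) P ≠ 0 := by
      rw [hc1]
      simpa using hne0
    have hdeg : (Finsupp.single 0 u + Finsupp.single 1 v : Fin 2 →₀ ℕ).degree = u + v := by
      simp [Finsupp.degree_single]
    have htd : P.totalDegree = (Finsupp.single 0 u + Finsupp.single 1 v : Fin 2 →₀ ℕ).degree := by
      apply le_antisymm
      · rw [hdeg, huv]; exact hd
      · exact MvPolynomial.le_totalDegree (MvPolynomial.mem_support_iff.mpr hcne)
    obtain ⟨t, -, ht⟩ := MvPolynomial.combinatorial_nullstellensatz_exists_eval_nonzero P _ hcne htd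
      (fun _ => Finset.univ) (by
        intro i
        rw [Finset.card_univ, hK]
        fin_cases i
        · simpa using hu
        · simpa using hv)
    apply ht
    obtain ⟨i, hi, h⟩ := hcov (t 0) (t 1)
    rw [hP, MvPolynomial.eval_prod]
    apply Finset.prod_eq_zero hi
    simp only [Algebra.smul_def] at h
    simp [h]
  have hQpos : 0 < Q := by positivity
  have hτ : Q ≤ s.card := by
    by_contra hlt
    push Not at hlt
    apply hf0
    ext v
    rw [Polynomial.coeff_zero]
    by_cases hv : v ≤ s.card
    · exact hvan (s.card - v) v (by omega) (by omega) (by omega)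
    · exact coeff_eq_zero_of_natDegree_lt (by omega)
  obtain ⟨e, he⟩ := Nat.exists_eq_add_of_le hτ
  have hecond : 2 * q * e < Q * (q + 1) := by
    rw [he, mul_add] at hcard; omega
  have heQ : e < Q := by
    by_contra hcon
    push Not at hcon
    have : Q * (q + 1) ≤ Q * (2 * q) := Nat.mul_le_mul_left _ (by omega)
    have : Q * (2 * q) ≤ e * (2 * q) := Nat.mul_le_mul_right _ hcon
    nlinarith
  have hXm : (X ^ Q : (ZMod q)[X]).Monic := monic_X_pow Q
  set g := f /ₘ X ^ Q with hg
  set h := f %ₘ X ^ Q with hh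
  have hfgh : f = X ^ Q * g + h := by
    rw [add_comm]; exact (modByMonic_add_div f _).symm
  have hgd : g.natDegree ≤ e := by
    rw [hg, natDegree_divByMonic _ hXm, natDegree_X_pow]; omega
  have hhd : h.natDegree ≤ e := by
    rw [natDegree_le_iff_coeff_eq_zero]
    intro n hn
    by_cases hnQ : n < Q
    · have h1 := hvan (s.card - n) n (by omega) (by omega) hnQ
      rw [hfgh, Polynomial.coeff_add, Polynomial.coeff_X_pow_mul', if_neg (by omega), zero_add] at h1
      exact h1
    · apply coeff_eq_zero_of_degree_lt
      have := degree_modByMonic_lt f hXm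
      rw [degree_X_pow] at this
      refine this.trans_le ?_
      exact_mod_cast (by omega : Q ≤ n)
  rcases trichotomy hodd k e f g h hk hf0 hfs hfgh hgd hhd hecond with h1 | ⟨r, hr⟩ | h1
  · refine ⟨0, 1, Or.inr one_ne_zero, ?_⟩
    simp only [mul_zero, mul_one, zero_add]
    rw [h1, mul_zero, zero_add] at hfgh
    have h2 : (s.filter fun i => ¬ b i = 0).card ≤ e := by
      rw [← hfgh] at hhd
      refine le_trans ?_ hhd
      rw [hf, natDegree_prod _ _ hne, Finset.card_filter]
      refine Finset.sum_le_sum ?_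
      intro i hi
      split_ifs with hb
      · exact Nat.zero_le _
      · rw [add_comm, natDegree_linear hb]
    have := Finset.card_filter_add_card_filter_not (s := s) (fun i => b i = 0)
    omega
  · refine ⟨1, r, Or.inl one_ne_zero, ?_⟩
    have := le_card_of_pow_dvd s a b h0 r _ hr
    simpa using this
  · exfalso
    have h2 : (X - C 0) ^ (q ^ (k - 1)) ∣ f := by
      refine dvd_trans (pow_dvd_pow_of_dvd ?_ _) h1
      rw [C_0, sub_zero]
      exact dvd_sub (dvd_pow_self _ (by omega)) dvd_rfl
    have := le_card_of_pow_dvd s a b h0 0 _ h2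
    simp only [mul_zero, add_zero] at this
    omega

end DimTwo
end Blk


namespace Blk
open Submodule

section Affine
universe u
variable {q k : ℕ} [hq : Fact q.Prime] {K : Type} [Field K] [Fintype K] [Algebra (ZMod q) K]

lemma exists_lin_eq {E : Type*} [AddCommGroup E] [Module (ZMod q) E] {z : E} (hz : z ≠ 0) (y : K) :
    ∃ φ : E →ₗ[ZMod q] K, φ z = y := by
  obtain ⟨f, hf⟩ := Module.Projective.exists_dual_eq_one (ZMod q) hz
  refine ⟨f.smulRight y, ?_⟩
  simp [hf]

lemma full_of_small {ι : Type*} {E : Type*} [AddCommGroup E] [Module (ZMod q) E]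
    [Module.Finite (ZMod q) E] (s : Finset ι) (x : ι → E) (y : ι → K)
    (h0 : ∀ i ∈ s, x i ≠ 0)
    (hcov : ∀ φ : E →ₗ[ZMod q] K, ∃ i ∈ s, φ (x i) = y i) (z : E) (hz : z ≠ 0)
    (t : Finset ι) (ht : ∀ i ∈ s, x i ∉ span (ZMod q) {z} → i ∈ t) (htc : t.card < Fintype.card K) :
    ∀ y0 : K, ∃ i ∈ s, ∃ c : ZMod q, c ≠ 0 ∧ x i = c • z ∧ y i = c • y0 := by
  classical
  intro y0
  by_contra hcon
  push Not at hcon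
  have : Finite E := Module.finite_of_finite (ZMod q)
  have : Finite (E →ₗ[ZMod q] K) := DFunLike.finite _
  have := Fintype.ofFinite (E →ₗ[ZMod q] K)
  set Φ : Finset (E →ₗ[ZMod q] K) := Finset.univ.filter fun φ => φ z = y0 with hΦ
  set A : ι → Finset (E →ₗ[ZMod q] K) := fun i => Φ.filter fun φ => φ (x i) = y i with hA
  set t' := t.filter fun i => x i ∉ span (ZMod q) {z} with ht'
  have hsub : Φ ⊆ t'.biUnion A := by
    intro φ hφ
    obtain ⟨i, hi, hiφ⟩ := hcov φ
    rw [Finset.mem_biUnion]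
    have hφz : φ z = y0 := by simpa [hΦ] using hφ
    have hns : x i ∉ span (ZMod q) {z} := by
      intro hmem
      obtain ⟨c, hc⟩ := mem_span_singleton.mp hmem
      have hc0 : c ≠ 0 := by
        rintro rfl
        exact h0 i hi (by rw [← hc, zero_smul])
      apply hcon i hi c hc0 hc.symm
      rw [← hiφ, ← hc, map_smul, hφz]
    exact ⟨i, by simp [ht', ht i hi hns, hns], by simp [hA, hφ, hiφ]⟩
  have hAc : ∀ i ∈ t', Fintype.card K * (A i).card ≤ Φ.card := by
    intro i hi
    have hns : x i ∉ span (ZMod q) {z} := (Finset.mem_filter.mp hi).2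
    obtain ⟨f, hf1, hf2⟩ := exists_le_ker_of_notMem hns
    rw [span_singleton_le_iff_mem, LinearMap.mem_ker] at hf2
    rw [← Finset.card_univ, ← Finset.card_product]
    refine Finset.card_le_card_of_injOn (fun p => p.2 + f.smulRight p.1) ?_ ?_
    · rintro ⟨c, φ⟩ hp
      have : φ z = y0 := by
        have := (Finset.mem_product.mp hp).2
        simp [hA, hΦ] at this
        exact this.1
      simp [hΦ, this, hf2]
    · rintro ⟨c, φ⟩ hp ⟨c', φ'⟩ hp' heq
      have h1 := (Finset.mem_product.mp hp).2
      have h2 := (Finset.mem_product.mp hp').2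
      simp only [hA, Finset.mem_filter] at h1 h2
      simp only at heq
      have h3 := congrArg (fun ψ : E →ₗ[ZMod q] K => ψ (x i)) heq
      simp [h1.2, h2.2] at h3
      have h4 : c = c' := smul_right_injective _ hf1 h3
      subst h4
      simpa using heq
  have hne : 0 < Φ.card := by
    rw [Finset.card_pos]
    obtain ⟨φ, hφ⟩ := exists_lin_eq (q := q) hz y0
    exact ⟨φ, by simp [hΦ, hφ]⟩
  have h1 : Φ.card ≤ ∑ i ∈ t', (A i).card := (Finset.card_le_card hsub).trans Finset.card_biUnion_le
  have h2 : Fintype.card K * Φ.card ≤ t'.card * Φ.card := by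
    calc Fintype.card K * Φ.card ≤ Fintype.card K * ∑ i ∈ t', (A i).card := Nat.mul_le_mul_left _ h1
      _ = ∑ i ∈ t', Fintype.card K * (A i).card := Finset.mul_sum _ _ _
      _ ≤ ∑ i ∈ t', Φ.card := Finset.sum_le_sum hAc
      _ = t'.card * Φ.card := by simp
  have h3 : t'.card ≤ t.card := Finset.card_filter_le _ _
  have := Nat.le_of_mul_le_mul_right h2 hne
  omega

lemma card_of_full {ι : Type*} {E : Type*} [AddCommGroup E] [Module (ZMod q) E]
    (s : Finset ι) (x : ι → E) (y : ι → K) (z : E) (hz : z ≠ 0)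
    (hfull : ∀ y0 : K, ∃ i ∈ s, ∃ c : ZMod q, c ≠ 0 ∧ x i = c • z ∧ y i = c • y0)
    (t : Finset ι) (ht : ∀ i ∈ s, x i ∈ span (ZMod q) {z} → i ∈ t) : Fintype.card K ≤ t.card := by
  choose g hg c hc hx hy using hfull
  rw [← Finset.card_univ]
  refine Finset.card_le_card_of_injOn g ?_ ?_
  · intro a _
    exact ht _ (hg a) (by rw [hx]; exact smul_mem _ _ (mem_span_singleton_self z))
  · intro a _ b _ hab
    have h1 : c a • z = c b • z := by rw [← hx, ← hx, hab]
    have h2 : c a = c b := smul_left_injective _ hz h1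
    have h3 : c a • a = c b • b := by rw [← hy, ← hy, hab]
    rw [h2] at h3
    exact smul_right_injective _ (hc b) h3

lemma span_ker_of_two {E : Type*} [AddCommGroup E] [Module (ZMod q) E] [Module.Finite (ZMod q) E]
    (hE : Module.finrank (ZMod q) E = 2) (f : E →ₗ[ZMod q] ZMod q) (hf : f ≠ 0) :
    ∃ z : E, z ≠ 0 ∧ f z = 0 ∧ ∀ x, f x = 0 → ∃ c : ZMod q, c • z = x := by
  have h1 := Module.Dual.finrank_ker_add_one_of_ne_zero (f := f) hf
  have h2 : Module.finrank (ZMod q) (LinearMap.ker f) = 1 := by omega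
  obtain ⟨⟨z, hz⟩, hz0, hz1⟩ := finrank_eq_one_iff'.mp h2
  refine ⟨z, fun h => hz0 (by ext; exact h), hz, ?_⟩
  intro x hx
  obtain ⟨c, hc⟩ := hz1 ⟨x, hx⟩
  exact ⟨c, congrArg Subtype.val hc⟩

theorem affine_two (hodd : Odd q) (hk : 1 ≤ k) (hK : Fintype.card K = q ^ k)
    {ι : Type*} {E : Type*} [AddCommGroup E] [Module (ZMod q) E]
    [Module.Finite (ZMod q) E] (hE : Module.finrank (ZMod q) E = 2)
    (s : Finset ι) (x : ι → E) (y : ι → K)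
    (h0 : ∀ i ∈ s, x i ≠ 0)
    (hcov : ∀ φ : E →ₗ[ZMod q] K, ∃ i ∈ s, φ (x i) = y i)
    (hcard : 2 * q * s.card < 2 * q * q ^ k + q ^ k * (q + 1))
    (f : E →ₗ[ZMod q] ZMod q) (hf : f ≠ 0) (hfs : (s.filter fun i => f (x i) = 0).card < q ^ (k - 1)) :
    ∃ z : E, z ≠ 0 ∧ ∀ y0 : K, ∃ i ∈ s, ∃ c : ZMod q, c ≠ 0 ∧ x i = c • z ∧ y i = c • y0 := by
  classical
  have hq2 : 2 ≤ q := hq.out.two_le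
  obtain ⟨P, hP0, hfP, hP⟩ := span_ker_of_two hE f hf
  obtain ⟨g, hg⟩ := Module.Projective.exists_dual_eq_one (ZMod q) hP0
  obtain ⟨a, b, hab, hcnt⟩ := dim_two hodd hk hK s (fun i => f (x i)) (fun i => g (x i)) y (by
      intro i hi
      by_contra hcon
      push Not at hcon
      obtain ⟨c, hc⟩ := hP _ hcon.1
      have : c = 0 := by
        have := hcon.2
        rw [← hc] at this
        simpa [hg] using this
      exact h0 i hi (by rw [← hc, this, zero_smul]))
    (by
      intro S T
      obtain ⟨i, hi, h⟩ := hcov (f.smulRight S + g.smulRight T)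
      exact ⟨i, hi, by simpa using h⟩) hcard hfs
  have hh : a • f + b • g ≠ 0 := by
    intro h
    have hb : b = 0 := by
      have := congrArg (fun ψ : E →ₗ[ZMod q] ZMod q => ψ P) h
      simpa [hfP, hg] using this
    subst hb
    simp [hf] at h
    subst h
    simp at hab
  obtain ⟨z, hz0, hz1, hz⟩ := span_ker_of_two hE _ hh
  refine ⟨z, hz0, ?_⟩
  refine full_of_small s x y h0 hcov z hz0 (s.filter fun i => ¬ (f (x i) * a + g (x i) * b = 0)) ?_ ?_
  · intro i hi hns
    rw [Finset.mem_filter]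
    refine ⟨hi, fun h => hns ?_⟩
    obtain ⟨c, hc⟩ := hz (x i) (by simp; linear_combination h)
    exact mem_span_singleton.mpr ⟨c, hc⟩
  · rw [hK]
    have := Finset.card_filter_add_card_filter_not (s := s) (fun i => f (x i) * a + g (x i) * b = 0)
    have h2 : s.card < 2 * q ^ k := by
      have : 2 * q * s.card < 2 * q * (2 * q ^ k) := by nlinarith [Nat.pow_pos (n := k) (show 0 < q by omega)]
      exact lt_of_mul_lt_mul_left this (by omega)
    omega

end Affine
end Blk


namespace Blk
open Submodule

section AffineMain
universe u
variable {q k : ℕ} [hq : Fact q.Prime] {K : Type} [Field K] [Fintype K] [Algebra (ZMod q) K]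

/-- The inductive conclusion. -/
def AffStmt (q k n : ℕ) [Fact q.Prime] (K : Type) [Field K] [Algebra (ZMod q) K]
    (ι : Type) : Prop :=
  ∀ (E : Type u) [AddCommGroup E] [Module (ZMod q) E]
    [Module.Finite (ZMod q) E], Module.finrank (ZMod q) E = n → 
    ∀ (s : Finset ι) (x : ι → E) (y : ι → K),
    (∀ i ∈ s, x i ≠ 0) →
    (∀ φ : E →ₗ[ZMod q] K, ∃ i ∈ s, φ (x i) = y i) →
    (2 * q * s.card < 2 * q * q ^ k + q ^ k * (q + 1)) →
    ∀ (f : E →ₗ[ZMod q] ZMod q), f ≠ 0 → (s.filter fun i => f (x i) = 0).card < q ^ (k - 1) →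
    ∃ z : E, z ≠ 0 ∧ ∀ y0 : K, ∃ i ∈ s, ∃ c : ZMod q, c ≠ 0 ∧ x i = c • z ∧ y i = c • y0

lemma exists_plane (hK : Fintype.card K = q ^ k)
    {ι : Type} {n : ℕ} (ih : AffStmt.{u} q k n K ι)
    {E : Type u} [AddCommGroup E] [Module (ZMod q) E]
    [Module.Finite (ZMod q) E] (hE : Module.finrank (ZMod q) E = n + 1)
    (s : Finset ι) (x : ι → E) (y : ι → K)
    (h0 : ∀ i ∈ s, x i ≠ 0)
    (hcov : ∀ φ : E →ₗ[ZMod q] K, ∃ i ∈ s, φ (x i) = y i)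
    (hcard : 2 * q * s.card < 2 * q * q ^ k + q ^ k * (q + 1))
    (f : E →ₗ[ZMod q] ZMod q) (hf : f ≠ 0) (hfs : (s.filter fun i => f (x i) = 0).card < q ^ (k - 1))
    (P : E) (hP : P ≠ 0) (hfP : f P = 0) :
    ∃ w : E, f w ≠ 0 ∧ ∀ t : Finset ι, (∀ i ∈ s, x i ∈ span (ZMod q) {P, w} → i ∈ t) →
      q ^ k ≤ t.card := by
  classical
  have hq2 : 2 ≤ q := hq.out.two_le
  have hkk : q ^ (k - 1) ≤ q ^ k := Nat.pow_le_pow_right (by omega) (by omega)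
  have hnf : ¬ ∀ y0 : K, ∃ i ∈ s, ∃ c : ZMod q, c ≠ 0 ∧ x i = c • P ∧ y i = c • y0 := by
    intro hfull
    have := card_of_full s x y P hP hfull (s.filter fun i => f (x i) = 0) (by
      intro i hi hmem
      obtain ⟨c, hc⟩ := mem_span_singleton.mp hmem
      rw [Finset.mem_filter]
      exact ⟨hi, by rw [← hc, map_smul, hfP, smul_zero]⟩)
    omega
  push Not at hnf
  obtain ⟨y0, hy0⟩ := hnf
  obtain ⟨ψ, hψ⟩ := exists_lin_eq (q := q) hP y0
  set U := span (ZMod q) {P} with hU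
  have hUf : U ≤ LinearMap.ker f := by
    rw [hU, span_singleton_le_iff_mem]; exact hfP
  have hfr : Module.finrank (ZMod q) (E ⧸ U) = n := by
    have h1 := Submodule.finrank_quotient_add_finrank U
    have h2 : Module.finrank (ZMod q) U = 1 := finrank_span_singleton hP
    omega
  set s' := s.filter fun i => x i ∉ U with hs'
  have hs's : s'.card ≤ s.card := Finset.card_filter_le _ _
  obtain ⟨z, hz0, hz⟩ := ih (E ⧸ U) hfr s' (fun i => U.mkQ (x i)) (fun i => y i - ψ (x i))
    (by
      intro i hi
      have := (Finset.mem_filter.mp hi).2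
      simpa using this)
    (by
      intro φ
      obtain ⟨i, hi, h⟩ := hcov (φ.comp U.mkQ + ψ)
      have hns : x i ∉ U := by
        intro hmem
        obtain ⟨c, hc⟩ := mem_span_singleton.mp hmem
        have hc0 : c ≠ 0 := by
          rintro rfl
          exact h0 i hi (by rw [← hc, zero_smul])
        apply hy0 i hi c hc0 hc.symm
        have h3 : U.mkQ (x i) = 0 := by simpa using hmem
        rw [← h, LinearMap.add_apply, LinearMap.comp_apply, h3, map_zero, zero_add, ← hc, map_smul, hψ]
      refine ⟨i, by simp [hs', hi, hns], ?_⟩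
      rw [← h]
      simp)
    (by nlinarith) (U.liftQ f hUf) (by
      intro h
      apply hf
      ext v
      have := congrArg (fun g : (E ⧸ U) →ₗ[ZMod q] ZMod q => g (U.mkQ v)) h
      simpa using this) (by
      refine lt_of_le_of_lt (Finset.card_le_card ?_) hfs
      intro i hi
      simp [hs'] at hi ⊢
      exact ⟨hi.1.1, hi.2⟩)
  obtain ⟨w, rfl⟩ := U.mkQ_surjective z
  have hmem : ∀ v : E, U.mkQ v ∈ span (ZMod q) {U.mkQ w} → v ∈ span (ZMod q) {P, w} := by
    intro v hv
    obtain ⟨c, hc⟩ := mem_span_singleton.mp hv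
    rw [← map_smul, ← sub_eq_zero, ← map_sub] at hc
    have : c • w - v ∈ U := (Submodule.Quotient.mk_eq_zero U).mp hc
    obtain ⟨d, hd⟩ := mem_span_singleton.mp this
    rw [mem_span_pair]
    exact ⟨-d, c, by rw [neg_smul, hd]; abel⟩
  have hcount : ∀ t : Finset ι, (∀ i ∈ s, x i ∈ span (ZMod q) {P, w} → i ∈ t) →
      q ^ k ≤ t.card := by
    intro t ht
    rw [← hK]
    refine card_of_full s' _ _ _ hz0 hz t ?_
    intro i hi hm
    exact ht i (Finset.mem_filter.mp hi).1 (hmem _ hm)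
  refine ⟨w, ?_, hcount⟩
  intro hfw
  have := hcount (s.filter fun i => f (x i) = 0) (by
    intro i hi hm
    obtain ⟨c, d, hcd⟩ := mem_span_pair.mp hm
    rw [Finset.mem_filter]
    exact ⟨hi, by rw [← hcd]; simp [hfP, hfw]⟩)
  omega

theorem affine_main (hodd : Odd q) (hk : 1 ≤ k) (hK : Fintype.card K = q ^ k) (ι : Type) (n : ℕ) :
    AffStmt.{u} q k n K ι := by
  classical
  have hq2 : 2 ≤ q := hq.out.two_le
  have hq3 : 3 ≤ q := by
    obtain ⟨t, ht⟩ := hodd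
    omega
  have hQpos : 0 < q ^ k := by positivity
  have hchar : (2 : ZMod q) ≠ 0 := by
    intro h
    have : ((2 : ℕ) : ZMod q) = 0 := by exact_mod_cast h
    rw [ZMod.natCast_eq_zero_iff] at this
    have := Nat.le_of_dvd (by norm_num) this
    omega
  induction n with
  | zero =>
    intro E _ _ _ hE s x y h0 hcov hcard f hf
    exfalso
    apply hf
    have := Module.finrank_zero_iff.mp hE
    ext v
    rw [Subsingleton.elim v 0, map_zero, map_zero]
  | succ n ih =>
    intro E _ _ _ hE s x y h0 hcov hcard f hf hfs
    have hs2 : s.card < 2 * q ^ k := by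
      have : 2 * q * s.card < 2 * q * (2 * q ^ k) := by nlinarith
      exact lt_of_mul_lt_mul_left this (by omega)
    rcases n with _ | _ | n
    · obtain ⟨z, hz0, hz⟩ := finrank_eq_one_iff'.mp hE
      refine ⟨z, hz0, ?_⟩
      refine full_of_small s x y h0 hcov z hz0 ∅ ?_ (by rw [hK]; simpa using hQpos)
      intro i hi hn
      obtain ⟨c, hc⟩ := hz (x i)
      exact absurd (mem_span_singleton.mpr ⟨c, hc⟩) hn
    · exact affine_two hodd hk hK hE s x y h0 hcov hcard f hf hfs
    · have h1 := Module.Dual.finrank_ker_add_one_of_ne_zero (f := f) hf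
      have h2 : 2 ≤ Module.finrank (ZMod q) (LinearMap.ker f) := by omega
      obtain ⟨b, hb⟩ := exists_linearIndependent_of_le_finrank h2
      have hb' := (hb.map' (LinearMap.ker f).subtype (by simp))
      have hind : ∀ a c : ZMod q, a • (b 0 : E) + c • (b 1 : E) = 0 → a = 0 ∧ c = 0 := by
        intro a c h
        have := Fintype.linearIndependent_iff.mp hb' ![a, c] (by simpa [Fin.sum_univ_two] using h)
        exact ⟨this 0, this 1⟩
      let co : Fin 4 → ZMod q := ![1, 0, 1, 1]
      let de : Fin 4 → ZMod q := ![0, 1, 1, -1]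
      have hdet : ∀ i j, i ≠ j → co i * de j - co j * de i ≠ 0 := by
        intro i j hij
        have h2' : (-1 - 1 : ZMod q) ≠ 0 := by
          intro h; apply hchar; linear_combination -h
        have h2'' : (1 + 1 : ZMod q) ≠ 0 := by
          intro h; apply hchar; linear_combination h
        fin_cases i <;> fin_cases j <;> simp [co, de] at hij ⊢ <;> first | exact h2' | exact h2''
      let P : Fin 4 → E := fun j => co j • (b 0 : E) + de j • (b 1 : E)
      have hfP : ∀ j, f (P j) = 0 := by
        intro j
        have e0 : f (b 0 : E) = 0 := (b 0).2
        have e1 : f (b 1 : E) = 0 := (b 1).2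
        simp [P, e0, e1]
      have hPP : ∀ i j, i ≠ j → ∀ a c : ZMod q, a • P i = c • P j → a = 0 := by
        intro i j hij a c h
        have h3 : (a * co i - c * co j) • (b 0 : E) + (a * de i - c * de j) • (b 1 : E) = 0 := by
          rw [← sub_eq_zero] at h
          rw [← h]
          simp only [P]
          module
        obtain ⟨h4, h5⟩ := hind _ _ h3
        have : a * (co i * de j - co j * de i) = 0 := by
          linear_combination de j * h4 - co j * h5
        exact (mul_eq_zero.mp this).resolve_right (hdet i j hij)
      have hP0 : ∀ j, P j ≠ 0 := by
        intro j hj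
        obtain ⟨i, hi⟩ : ∃ i, i ≠ j := exists_ne j
        have := hPP j i hi.symm 1 0 (by rw [hj]; simp)
        exact one_ne_zero this
      have hL := fun j => exists_plane hK ih hE s x y h0 hcov hcard f hf hfs (P j) (hP0 j) (hfP j)
      choose w hw hcnt using hL
      -- intersections
      have hker : ∀ j v, v ∈ span (ZMod q) {P j, w j} → f v = 0 → ∃ a : ZMod q, v = a • P j := by
        intro j v hv hfv
        obtain ⟨a, c, hac⟩ := mem_span_pair.mp hv
        have : c = 0 := by
          rw [← hac] at hfv
          simp [hfP] at hfv
          exact hfv.resolve_right (hw j)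
        subst this
        exact ⟨a, by rw [← hac]; simp⟩
      have hint0 : ∀ i j, i ≠ j → ∀ v, v ∈ span (ZMod q) {P i, w i} → v ∈ span (ZMod q) {P j, w j} →
          f v = 0 → v = 0 := by
        intro i j hij v hi hj hfv
        obtain ⟨a, ha⟩ := hker i v hi hfv
        obtain ⟨c, hc⟩ := hker j v hj hfv
        have := hPP i j hij a c (by rw [← ha, ← hc])
        rw [ha, this, zero_smul]
      set A : Fin 4 → Finset ι := fun j => s.filter fun i => x i ∈ span (ZMod q) {P j, w j} with hA
      have hAc : ∀ j, q ^ k ≤ (A j).card := by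
        intro j
        refine hcnt j (A j) ?_
        intro i hi hm
        simp [hA, hi, hm]
      obtain ⟨i0, hi0, hi0c⟩ : ∃ i ∈ s, 2 < (Finset.univ.filter fun j => i ∈ A j).card := by
        by_contra hcon
        push Not at hcon
        have e1 : ∑ j, (A j).card = ∑ i ∈ s, (Finset.univ.filter fun j => i ∈ A j).card := by
          have := Finset.sum_card_bipartiteAbove_eq_sum_card_bipartiteBelow (s := s) (t := Finset.univ)
            (fun i j => i ∈ A j)
          simp only [Finset.bipartiteAbove, Finset.bipartiteBelow] at this
          rw [this]
          refine Finset.sum_congr rfl ?_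
          intro j _
          congr 1
          ext i
          simp [hA]
        have e2 : ∑ i ∈ s, (Finset.univ.filter fun j => i ∈ A j).card ≤ s.card * 2 := by
          refine (Finset.sum_le_card_nsmul s _ 2 hcon).trans (by simp)
        have e3 : 4 * q ^ k ≤ ∑ j, (A j).card := by
          refine le_trans ?_ (Finset.card_nsmul_le_sum Finset.univ _ (q ^ k) (fun j _ => hAc j))
          simp
        omega
      obtain ⟨j1, hj1, j2, hj2, j3, hj3, h12, h13, h23⟩ := Finset.two_lt_card.mp hi0c
      have hm1 : ∀ j, j ∈ Finset.univ.filter (fun j => i0 ∈ A j) → x i0 ∈ span (ZMod q) {P j, w j} := by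
        intro j hj
        simp [hA] at hj
        exact hj.2
      have hfz : f (x i0) ≠ 0 := by
        intro h
        exact h0 i0 hi0 (hint0 j1 j2 h12 _ (hm1 _ hj1) (hm1 _ hj2) h)
      refine ⟨x i0, h0 i0 hi0, ?_⟩
      set M := s.filter fun i => x i ∈ span (ZMod q) {x i0} with hM
      have hpair : ∀ i j, i ≠ j → i ∈ Finset.univ.filter (fun j => i0 ∈ A j) →
          j ∈ Finset.univ.filter (fun j => i0 ∈ A j) → Disjoint (A i \ M) (A j \ M) := by
        intro i j hij hi hj
        rw [Finset.disjoint_left]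
        intro e he he'
        rw [Finset.mem_sdiff] at he he'
        apply he.2
        have e1 := (Finset.mem_filter.mp he.1)
        have e2 := (Finset.mem_filter.mp he'.1)
        rw [hM, Finset.mem_filter]
        refine ⟨e1.1, ?_⟩
        rw [mem_span_singleton]
        refine ⟨f (x e) / f (x i0), ?_⟩
        have := hint0 i j hij (x e - (f (x e) / f (x i0)) • x i0)
          (sub_mem e1.2 (smul_mem _ _ (hm1 _ hi))) (sub_mem e2.2 (smul_mem _ _ (hm1 _ hj)))
          (by simp [hfz])
        exact (sub_eq_zero.mp this).symm
      have hsd : ∀ j, q ^ k ≤ (A j \ M).card + M.card := by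
        intro j
        have := Finset.le_card_sdiff M (A j)
        have := hAc j
        omega
      have hunion : (A j1 \ M).card + (A j2 \ M).card + (A j3 \ M).card + M.card ≤ s.card := by
        rw [← Finset.card_union_of_disjoint (hpair j1 j2 h12 hj1 hj2),
          ← Finset.card_union_of_disjoint, ← Finset.card_union_of_disjoint]
        · apply Finset.card_le_card
          intro i hi
          simp [hA, hM] at hi
          tauto
        · simp only [Finset.disjoint_union_left]
          exact ⟨⟨Finset.sdiff_disjoint, Finset.sdiff_disjoint⟩, Finset.sdiff_disjoint⟩
        · simp only [Finset.disjoint_union_left]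
          exact ⟨hpair _ _ h13 hj1 hj3, hpair _ _ h23 hj2 hj3⟩
      refine full_of_small s x y h0 hcov _ (h0 i0 hi0) (s \ M) ?_ ?_
      · intro i hi hn
        simp [hM, hi, hn]
      · rw [hK]
        have e1 := Finset.card_sdiff_add_card_eq_card (show M ⊆ s from Finset.filter_subset _ _)
        have := hsd j1
        have := hsd j2
        have := hsd j3
        have e2 : 3 * q ^ k ≤ s.card + 2 * M.card := by omega
        by_contra hcon
        push Not at hcon
        -- 2 (s - m) ≤ 3 (s - Q)
        have e3 : 5 * q ^ k ≤ 3 * s.card := by omega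
        have e4 : q * (5 * q ^ k) ≤ q * (3 * s.card) := Nat.mul_le_mul_left _ e3
        nlinarith

end AffineMain
end Blk


namespace Blk
open Submodule

section Blocking
universe u
variable {q : ℕ} [hq : Fact q.Prime]

lemma proj_card_le {V : Type*} [AddCommGroup V] [Module (ZMod q) V] [Module.Finite (ZMod q) V]
    {ι : Type*} (s : Finset ι) (b : ι → V) (U : Submodule (ZMod q) V) (n : ℕ)
    (hU : Module.finrank (ZMod q) U = n)
    (hc : ∀ w ∈ U, w ≠ 0 → ∃ i ∈ s, ∃ c : ZMod q, c ≠ 0 ∧ b i = c • w)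
    (t : Finset ι) (ht : ∀ i ∈ s, b i ∈ U → i ∈ t) :
    ∑ i ∈ Finset.range n, q ^ i ≤ t.card := by
  classical
  have h1 := Projectivization.card_of_finrank (ZMod q) U hU
  rw [Nat.card_zmod] at h1
  rw [← h1]
  have : Finite U := Module.finite_of_finite (ZMod q)
  have hc' : ∀ p : Projectivization (ZMod q) U, ∃ i ∈ s, ∃ c : ZMod q, c ≠ 0 ∧ b i = c • (p.rep : V) := by
    intro p
    refine hc p.rep p.rep.2 ?_
    intro h
    exact p.rep_nonzero (by ext; exact h)
  choose g hg c hc0 hgc using hc'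
  have hfin : Finite (Projectivization (ZMod q) U) := inferInstance
  have := Fintype.ofFinite (Projectivization (ZMod q) U)
  rw [Nat.card_eq_fintype_card, ← Finset.card_univ]
  refine Finset.card_le_card_of_injOn g ?_ ?_
  · intro p _
    refine ht _ (hg p) ?_
    rw [hgc]
    exact smul_mem _ _ p.rep.2
  · intro p _ p' _ h
    have h2 : c p • (p.rep : V) = c p' • (p'.rep : V) := by rw [← hgc, ← hgc, h]
    rw [← p.mk_rep, ← p'.mk_rep, Projectivization.mk_eq_mk_iff']
    refine ⟨(c p)⁻¹ * c p', ?_⟩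
    ext
    simp only [Submodule.coe_smul]
    rw [mul_smul, ← h2, smul_smul, inv_mul_cancel₀ (hc0 p), one_smul]

lemma exists_good_functional {V : Type*} [AddCommGroup V] [Module (ZMod q) V]
    [Module.Finite (ZMod q) V] {ι : Type*} (s : Finset ι) (b : ι → V) (hs : s.Nonempty)
    (h0 : ∀ i ∈ s, b i ≠ 0) :
    ∃ f : V →ₗ[ZMod q] ZMod q, f ≠ 0 ∧ q * (s.filter fun i => f (b i) = 0).card < s.card := by
  classical
  have hq2 : 2 ≤ q := hq.out.two_le
  have : Finite V := Module.finite_of_finite (ZMod q)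
  have : Finite (V →ₗ[ZMod q] ZMod q) := DFunLike.finite _
  have := Fintype.ofFinite (V →ₗ[ZMod q] ZMod q)
  by_contra hcon
  push Not at hcon
  set D : Finset (V →ₗ[ZMod q] ZMod q) := Finset.univ.erase 0 with hD
  set A : ι → Finset (V →ₗ[ZMod q] ZMod q) := fun i => Finset.univ.filter fun f => f (b i) = 0 with hA
  have hAc : ∀ i ∈ s, q * (A i).card ≤ D.card + 1 := by
    intro i hi
    obtain ⟨g, hg⟩ := Module.Projective.exists_dual_eq_one (ZMod q) (h0 i hi)
    rw [hD, Finset.card_erase_add_one (Finset.mem_univ _)]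
    have : q * (A i).card = ((Finset.univ : Finset (ZMod q)) ×ˢ A i).card := by
      rw [Finset.card_product, Finset.card_univ, ZMod.card]
    rw [this]
    refine Finset.card_le_card_of_injOn (fun p => p.2 + p.1 • g) (by simp) ?_
    rintro ⟨c, φ⟩ hp ⟨c', φ'⟩ hp' heq
    have h1 := (Finset.mem_product.mp hp).2
    have h2 := (Finset.mem_product.mp hp').2
    simp only [hA, Finset.mem_filter] at h1 h2
    simp only at heq
    have h3 := congrArg (fun ψ : V →ₗ[ZMod q] ZMod q => ψ (b i)) heq
    simp [h1.2, h2.2, hg] at h3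
    subst h3
    simpa using heq
  have e1 : ∑ f ∈ D, (s.filter fun i => f (b i) = 0).card = ∑ i ∈ s, (D.filter fun f => f (b i) = 0).card := by
    have := Finset.sum_card_bipartiteAbove_eq_sum_card_bipartiteBelow (s := D) (t := s)
            (fun f i => f (b i) = 0)
    simpa only [Finset.bipartiteAbove, Finset.bipartiteBelow] using this
  have e2 : ∀ i ∈ s, q * (D.filter fun f => f (b i) = 0).card + q ≤ D.card + 1 := by
    intro i hi
    refine le_trans ?_ (hAc i hi)
    have : (D.filter fun f => f (b i) = 0) = (A i).erase 0 := by
      ext f; simp [hD, hA]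
    rw [this]
    have : ((A i).erase 0).card + 1 = (A i).card := Finset.card_erase_add_one (by simp [hA])
    rw [← this]
    ring_nf
    exact le_rfl
  have e3 : D.card * s.card ≤ ∑ f ∈ D, q * (s.filter fun i => f (b i) = 0).card := by
    have := Finset.card_nsmul_le_sum D (fun f => q * (s.filter fun i => f (b i) = 0).card) s.card (by
      intro f hf
      exact hcon f (Finset.ne_of_mem_erase hf))
    simpa using this
  rw [← Finset.mul_sum, e1, Finset.mul_sum] at e3
  have e4 : ∑ i ∈ s, (q * (D.filter fun f => f (b i) = 0).card + q) ≤ s.card * (D.card + 1) := by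
    have := Finset.sum_le_card_nsmul s _ _ e2
    simpa using this
  rw [Finset.sum_add_distrib] at e4
  simp only [Finset.sum_const, smul_eq_mul] at e4
  have : 0 < s.card := hs.card_pos
  nlinarith

theorem blocking (hodd : Odd q) {V : Type u} [AddCommGroup V] [Module (ZMod q) V]
    [Module.Finite (ZMod q) V] {ι : Type} (b : ι → V) : ∀ (k : ℕ) (s : Finset ι),
    (∀ i ∈ s, b i ≠ 0) →
    (∀ g : Fin k → (V →ₗ[ZMod q] ZMod q), ∃ i ∈ s, ∀ j, g j (b i) = 0) →
    2 * q * s.card < 2 * q * (∑ i ∈ Finset.range (k + 1), q ^ i) + q ^ k * (q + 1) →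
    ∃ W : Submodule (ZMod q) V, Module.finrank (ZMod q) W = k + 1 ∧
      ∀ w ∈ W, w ≠ 0 → ∃ i ∈ s, ∃ c : ZMod q, c ≠ 0 ∧ b i = c • w := by
  classical
  have hq2 : 2 ≤ q := hq.out.two_le
  intro k
  induction k with
  | zero =>
    intro s h0 hcov _
    obtain ⟨i, hi, -⟩ := hcov (fun j => 0)
    refine ⟨span (ZMod q) {b i}, finrank_span_singleton (h0 i hi), ?_⟩
    intro w hw hw0
    obtain ⟨c, hc⟩ := mem_span_singleton.mp hw
    have hc0 : c ≠ 0 := by rintro rfl; exact hw0 (by rw [← hc, zero_smul])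
    exact ⟨i, hi, c⁻¹, inv_ne_zero hc0, by rw [← hc, smul_smul, inv_mul_cancel₀ hc0, one_smul]⟩
  | succ k ih =>
    intro s h0 hcov hcard
    obtain ⟨i₀, hi₀, -⟩ := hcov (fun j => 0)
    obtain ⟨f, hf0, hf⟩ := exists_good_functional (q := q) s b ⟨i₀, hi₀⟩ h0
    set sH := s.filter fun i => f (b i) = 0 with hsH
    have hθ1 : ∑ i ∈ Finset.range (k + 1 + 1), q ^ i = q * (∑ i ∈ Finset.range (k + 1), q ^ i) + 1 := by
      rw [Finset.sum_range_succ' _ (k + 1), Finset.mul_sum]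
      simp [pow_succ']
    have hθ2 : ∑ i ∈ Finset.range (k + 1 + 1), q ^ i = (∑ i ∈ Finset.range (k + 1), q ^ i) + q ^ (k + 1) :=
      Finset.sum_range_succ _ _
    set θ := ∑ i ∈ Finset.range (k + 1), q ^ i with hθ
    have hHcard : 2 * q * sH.card < 2 * q * θ + q ^ k * (q + 1) := by
      have e1 : q * (2 * q * sH.card) < q * (2 * q * θ + q ^ k * (q + 1)) := by
        have : 2 * q * (q * sH.card + 1) ≤ 2 * q * s.card := Nat.mul_le_mul_left _ hf
        rw [hθ1, pow_succ] at hcard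
        nlinarith
      exact lt_of_mul_lt_mul_left e1 (by omega)
    obtain ⟨U, hU, hUc⟩ := ih sH (fun i hi => h0 i (Finset.mem_filter.mp hi).1) (by
      intro g
      obtain ⟨i, hi, h⟩ := hcov (Fin.cons f g)
      refine ⟨i, ?_, ?_⟩
      · rw [hsH, Finset.mem_filter]
        exact ⟨hi, by simpa using h 0⟩
      · intro j
        simpa using h j.succ) hHcard
    have hUf : U ≤ LinearMap.ker f := by
      intro w hw
      by_cases hw0 : w = 0
      · rw [hw0]; exact zero_mem _
      obtain ⟨i, hi, c, hc, h⟩ := hUc w hw hw0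
      have h1 := (Finset.mem_filter.mp hi).2
      rw [h, map_smul, smul_eq_mul] at h1
      exact (mul_eq_zero.mp h1).resolve_left hc
    set K := GaloisField q (k + 1)
    have : Fintype K := Fintype.ofFinite K
    have hK : Fintype.card K = q ^ (k + 1) := by
      rw [← Nat.card_eq_fintype_card]; exact GaloisField.card q (k + 1) (by omega)
    have hKf : Module.finrank (ZMod q) K = k + 1 := GaloisField.finrank q (by omega)
    let e : U ≃ₗ[ZMod q] K := LinearEquiv.ofFinrankEq _ _ (by rw [hU, hKf])
    obtain ⟨π, hπ⟩ := LinearMap.exists_extend e.toLinearMap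
    have hπU : ∀ v ∈ U, π v = 0 → v = 0 := by
      intro v hv h
      have h1 := congrArg (fun g : U →ₗ[ZMod q] K => g ⟨v, hv⟩) hπ
      simp only [LinearMap.comp_apply, subtype_apply, h] at h1
      have h2 : (⟨v, hv⟩ : U) = 0 := by
        apply e.injective
        rw [map_zero]; exact h1.symm
      exact congrArg Subtype.val h2
    set X := s.filter fun i => b i ∉ U with hX
    have hXU : θ + X.card ≤ s.card := by
      have h1 := proj_card_le sH b U (k + 1) hU hUc (s.filter fun i => b i ∈ U) (by
        intro i hi hm
        exact Finset.mem_filter.mpr ⟨(Finset.mem_filter.mp hi).1, hm⟩)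
      have h2 : (s.filter fun i => b i ∈ U).card + X.card = s.card := by
        rw [hX]
        convert Finset.card_filter_add_card_filter_not (s := s) (fun i => b i ∈ U)
      omega
    have hXH : θ + (X.filter fun i => f (b i) = 0).card ≤ sH.card := by
      have h1 := proj_card_le sH b U (k + 1) hU hUc (sH.filter fun i => b i ∈ U) (by
        intro i hi hm
        exact Finset.mem_filter.mpr ⟨hi, hm⟩)
      have h2 : (sH.filter fun i => b i ∈ U).card + (sH.filter fun i => b i ∉ U).card = sH.card := by
        convert Finset.card_filter_add_card_filter_not (s := sH) (fun i => b i ∈ U)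
      have h3 : (X.filter fun i => f (b i) = 0) = sH.filter fun i => b i ∉ U := by
        ext i; simp [hX, hsH]; tauto
      rw [h3]
      omega
    obtain ⟨z, hz0, hz⟩ := affine_main (k := k + 1) (K := K) hodd (by omega) hK ι _ (V ⧸ U) rfl X
      (fun i => U.mkQ (b i)) (fun i => π (b i))
      (by
        intro i hi
        have := (Finset.mem_filter.mp hi).2
        simpa using this)
      (by
        intro φ
        let B := Module.finBasisOfFinrankEq (ZMod q) K hKf
        obtain ⟨i, hi, h⟩ := hcov (fun j => (B.coord j).comp (π - φ.comp U.mkQ))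
        have h1 : π (b i) - φ (U.mkQ (b i)) = 0 := by
          rw [← B.forall_coord_eq_zero_iff]
          intro j
          have := h j
          simpa using this
        have h2 : φ (U.mkQ (b i)) = π (b i) := (sub_eq_zero.mp h1).symm
        refine ⟨i, ?_, h2⟩
        rw [hX, Finset.mem_filter]
        refine ⟨hi, fun hm => h0 i hi (hπU _ hm ?_)⟩
        have h3 : U.mkQ (b i) = 0 := by simpa using hm
        rw [← h2, h3, map_zero])
      (by
        rw [hθ2] at hcard
        nlinarith) (U.liftQ f hUf) (by
        intro h
        apply hf0
        ext v
        have := congrArg (fun g : (V ⧸ U) →ₗ[ZMod q] ZMod q => g (U.mkQ v)) h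
        simpa using this) (by
        have h1 : (X.filter fun i => (U.liftQ f hUf) (U.mkQ (b i)) = 0) = X.filter fun i => f (b i) = 0 := by
          ext i
          rw [Finset.mem_filter, Finset.mem_filter]
          simp [hX]
        rw [h1, Nat.add_sub_cancel]
        have : 2 * q * (X.filter fun i => f (b i) = 0).card < 2 * q * q ^ k := by
          have : q ^ k * (q + 1) ≤ q ^ k * (2 * q) := Nat.mul_le_mul_left _ (by omega)
          nlinarith
        exact lt_of_mul_lt_mul_left this (by omega))
    obtain ⟨z, rfl⟩ := U.mkQ_surjective z
    have hzU : z ∉ U := by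
      intro h
      exact hz0 (by simpa using h)
    refine ⟨U ⊔ span (ZMod q) {z}, ?_, ?_⟩
    · have hz' : z ≠ 0 := by rintro rfl; exact hzU (zero_mem _)
      have h1 := Submodule.finrank_sup_add_finrank_inf_eq U (span (ZMod q) {z})
      have h2 : U ⊓ span (ZMod q) {z} = ⊥ := by
        rw [eq_bot_iff]
        rintro v ⟨hv1, hv2⟩
        obtain ⟨c, hc⟩ := mem_span_singleton.mp hv2
        by_cases hc0 : c = 0
        · rw [← hc, hc0]; simp
        · exfalso
          apply hzU
          have : z = c⁻¹ • v := by rw [← hc, smul_smul, inv_mul_cancel₀ hc0, one_smul]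
          rw [this]
          exact smul_mem _ _ hv1
      rw [h2, finrank_bot, finrank_span_singleton hz', hU] at h1
      simpa using h1
    · intro w hw hw0
      obtain ⟨u, hu, v, hv, rfl⟩ := mem_sup.mp hw
      obtain ⟨l, rfl⟩ := mem_span_singleton.mp hv
      by_cases hl : l = 0
      · subst hl
        rw [zero_smul, add_zero] at hw0 ⊢
        obtain ⟨i, hi, h⟩ := hUc u hu hw0
        exact ⟨i, (Finset.mem_filter.mp hi).1, h⟩
      · obtain ⟨i, hi, c, hc, h1, h2⟩ := hz (l⁻¹ • π (u + l • z))
        refine ⟨i, (Finset.mem_filter.mp hi).1, c * l⁻¹, mul_ne_zero hc (inv_ne_zero hl), ?_⟩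
        rw [← sub_eq_zero]
        apply hπU
        · rw [← Submodule.Quotient.mk_eq_zero, ← mkQ_apply, map_sub, h1, map_smul, map_add, map_smul]
          have : U.mkQ u = 0 := by simpa using hu
          rw [this, zero_add, smul_smul, mul_assoc, inv_mul_cancel₀ hl, mul_one, sub_self]
        · rw [map_sub, h2, map_smul, smul_smul, sub_self]

end Blocking
end Blk


namespace Blk
open Filter Topology NumberField Ideal

section Zeta
variable (K : Type*) [Field K] [NumberField K]

/-- number of ideals of norm `n` -/
noncomputable def idealCount (n : ℕ) : ℕ := Nat.card {I : Ideal (𝓞 K) // absNorm I = n}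

/-- real Dedekind zeta function -/
noncomputable def zetaR (s : ℝ) : ℝ := ∑' n : ℕ, (idealCount K n : ℝ) * (n : ℝ) ^ (-s)

lemma term_eq_real {s : ℝ} (hs : 1 < s) (n : ℕ) :
    LSeries.term (fun n ↦ (Nat.card {I : Ideal (𝓞 K) // absNorm I = n} : ℂ)) (s : ℂ) n
      = (((idealCount K n : ℝ) * (n : ℝ) ^ (-s) : ℝ) : ℂ) := by
  rw [LSeries.term_of_ne_zero' (by
    intro h
    have : s = 0 := by exact_mod_cast h
    linarith)]
  rw [Real.rpow_neg (by positivity), ← div_eq_mul_inv, Complex.ofReal_div,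
    Complex.ofReal_cpow (by positivity)]
  simp [idealCount]

lemma zetaR_eq {s : ℝ} (hs : 1 < s) : dedekindZeta K (s : ℂ) = (zetaR K s : ℂ) := by
  rw [dedekindZeta, LSeries, zetaR, Complex.ofReal_tsum]
  exact tsum_congr (term_eq_real K hs)

lemma tendsto_zetaR : Tendsto (fun s : ℝ => (s - 1) * zetaR K s) (𝓝[>] 1)
    (𝓝 (dedekindZeta_residue K)) := by
  have h := tendsto_sub_one_mul_dedekindZeta_nhdsGT K
  have h2 := (Complex.continuous_re.tendsto _).comp h
  simp only [Complex.ofReal_re] at h2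
  refine h2.congr' ?_
  filter_upwards [self_mem_nhdsWithin] with s hs
  simp only [Function.comp]
  rw [zetaR_eq K hs]
  norm_cast

lemma summable_zetaR {s : ℝ} (hs : 1 < s) :
    Summable (fun n : ℕ => (idealCount K n : ℝ) * (n : ℝ) ^ (-s)) := by
  have h := tendsto_zetaR K
  have hev : ∀ᶠ t in 𝓝[>] (1 : ℝ), 0 < (t - 1) * zetaR K t :=
    h.eventually (lt_mem_nhds (dedekindZeta_residue_pos K))
  have hev2 : ∀ᶠ t in 𝓝[>] (1 : ℝ), t < s := by
    apply nhdsWithin_le_nhds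
    exact gt_mem_nhds hs
  obtain ⟨t, ⟨ht1, ht2⟩, ht3⟩ := ((hev.and hev2).and self_mem_nhdsWithin).exists
  have ht3 : 1 < t := ht3
  have hne : zetaR K t ≠ 0 := by
    intro h0
    rw [h0, mul_zero] at ht1
    exact lt_irrefl _ ht1
  have hsum : Summable (fun n : ℕ => (idealCount K n : ℝ) * (n : ℝ) ^ (-t)) := by
    by_contra hcon
    exact hne (tsum_eq_zero_of_not_summable hcon)
  refine Summable.of_nonneg_of_le (fun n => by positivity) ?_ hsum
  intro n
  rcases Nat.eq_zero_or_pos n with rfl | hn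
  · simp [Real.zero_rpow (show -s ≠ 0 by linarith), Real.zero_rpow (show -t ≠ 0 by linarith)]
  · refine mul_le_mul_of_nonneg_left ?_ (by positivity)
    exact Real.rpow_le_rpow_of_exponent_le (by exact_mod_cast hn) (by linarith)

lemma sum_le_zetaR {s : ℝ} (hs : 1 < s) (T : Finset (Ideal (𝓞 K))) (hT : ∀ I ∈ T, I ≠ ⊥) :
    ∑ I ∈ T, (absNorm I : ℝ) ^ (-s) ≤ zetaR K s := by
  classical
  have h1 : ∑ I ∈ T, (absNorm I : ℝ) ^ (-s) =
      ∑ n ∈ T.image absNorm, ((T.filter fun I => absNorm I = n).card : ℝ) * (n : ℝ) ^ (-s) := by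
    rw [← Finset.sum_fiberwise_of_maps_to (g := fun I => absNorm I) (t := T.image absNorm)
      (fun I hI => Finset.mem_image_of_mem _ hI)]
    refine Finset.sum_congr rfl ?_
    intro n _
    rw [← nsmul_eq_mul, ← Finset.sum_const]
    refine Finset.sum_congr rfl ?_
    intro I hI
    rw [(Finset.mem_filter.mp hI).2]
  rw [h1]
  refine le_trans ?_ ((summable_zetaR K hs).sum_le_tsum (T.image absNorm) (fun n _ => by positivity))
  refine Finset.sum_le_sum ?_
  intro n hn
  refine mul_le_mul_of_nonneg_right ?_ (by positivity)
  norm_cast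
  have hn0 : n ≠ 0 := by
    rintro rfl
    obtain ⟨I, hI, h⟩ := Finset.mem_image.mp hn
    exact hT I hI (absNorm_eq_zero_iff.mp h)
  rw [idealCount]
  have hfin : Finite {I : Ideal (𝓞 K) // absNorm I = n} := by
    exact Ideal.finite_setOfPred_absNorm_eq n
  have := Fintype.ofFinite {I : Ideal (𝓞 K) // absNorm I = n}
  rw [Nat.card_eq_fintype_card, ← Finset.card_univ]
  rw [← Finset.card_attach]
  refine Finset.card_le_card_of_injOn (fun I => ⟨I.1, (Finset.mem_filter.mp I.2).2⟩) (by simp) ?_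
  intro I _ J _ h
  simp at h
  exact h

lemma zetaR_le {s : ℝ} (hs : 1 < s) (B : ℝ)
    (hB : ∀ T : Finset (Ideal (𝓞 K)), (∀ I ∈ T, I ≠ ⊥) → ∑ I ∈ T, (absNorm I : ℝ) ^ (-s) ≤ B) :
    zetaR K s ≤ B := by
  classical
  refine Real.tsum_le_of_sum_le (fun n => by positivity) ?_
  intro u
  have hfin : ∀ n : ℕ, {I : Ideal (𝓞 K) | absNorm I = n}.Finite := fun n =>
    Ideal.finite_setOfPred_absNorm_eq n
  set T : Finset (Ideal (𝓞 K)) := (u.erase 0).biUnion fun n => (hfin n).toFinset with hT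
  have h1 : ∑ n ∈ u, (idealCount K n : ℝ) * (n : ℝ) ^ (-s) = ∑ I ∈ T, (absNorm I : ℝ) ^ (-s) := by
    rw [hT, Finset.sum_biUnion]
    · rw [← Finset.sum_erase u (a := 0) (by
        simp [Real.zero_rpow (show -s ≠ 0 by linarith)])]
      refine Finset.sum_congr rfl ?_
      intro n _
      have h2 : idealCount K n = (hfin n).toFinset.card := by
        rw [idealCount, ← Set.ncard_eq_toFinset_card _ (hfin n)]
        exact Nat.card_coe_set_eq _
      rw [h2, ← nsmul_eq_mul, ← Finset.sum_const]
      refine Finset.sum_congr rfl ?_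
      intro I hI
      have : absNorm I = n := by simpa using hI
      rw [this]
    · intro m _ n _ hmn
      rw [Function.onFun, Finset.disjoint_left]
      intro I hI hJ
      simp at hI hJ
      exact hmn (hI.symm.trans hJ)
  rw [h1]
  apply hB
  intro I hI hb
  simp only [hT, Finset.mem_biUnion] at hI
  obtain ⟨n, hn, hI⟩ := hI
  have : absNorm I = n := by simpa using hI
  rw [hb, Ideal.absNorm_bot] at this
  exact Finset.ne_of_mem_erase hn this.symm

end Zeta
end Blk


namespace Blk
open Filter Topology NumberField Ideal

section Euler
variable (K : Type*) [Field K] [NumberField K]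

/-- weight of an ideal -/
noncomputable def wt (s : ℝ) (I : Ideal (𝓞 K)) : ℝ := (absNorm I : ℝ) ^ (-s)

variable {K}

lemma wt_nonneg (s : ℝ) (I : Ideal (𝓞 K)) : 0 ≤ wt K s I := by unfold wt; positivity

lemma wt_mul (s : ℝ) (I J : Ideal (𝓞 K)) : wt K s (I * J) = wt K s I * wt K s J := by
  unfold wt
  rw [map_mul, Nat.cast_mul, Real.mul_rpow (by positivity) (by positivity)]

lemma wt_one (s : ℝ) : wt K s 1 = 1 := by
  unfold wt
  rw [map_one, Nat.cast_one, Real.one_rpow]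

lemma wt_pow (s : ℝ) (I : Ideal (𝓞 K)) (n : ℕ) : wt K s (I ^ n) = wt K s I ^ n := by
  induction n with
  | zero => rw [pow_zero, pow_zero, wt_one]
  | succ n ih => rw [pow_succ, pow_succ, wt_mul, ih]

lemma wt_prod (s : ℝ) (T : Finset (Ideal (𝓞 K))) : wt K s (∏ I ∈ T, I) = ∏ I ∈ T, wt K s I := by
  classical
  induction T using Finset.induction_on with
  | empty => rw [Finset.prod_empty, Finset.prod_empty, wt_one]
  | insert I T h ih => rw [Finset.prod_insert h, Finset.prod_insert h, wt_mul, ih]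

lemma two_le_norm {P : Ideal (𝓞 K)} (hP : Prime P) : 2 ≤ absNorm P := by
  have h0 : absNorm P ≠ 0 := fun h => hP.ne_zero (absNorm_eq_zero_iff.mp h)
  have h1 : absNorm P ≠ 1 := by
    intro h
    have := absNorm_eq_one_iff.mp h
    exact hP.not_isUnit (by rw [this, ← Ideal.one_eq_top]; exact isUnit_one)
  omega

lemma wt_le_half {s : ℝ} (hs : 1 < s) {P : Ideal (𝓞 K)} (hP : Prime P) : wt K s P ≤ 1 / 2 := by
  have h2 : (2 : ℝ) ≤ absNorm P := by exact_mod_cast two_le_norm hP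
  unfold wt
  calc (absNorm P : ℝ) ^ (-s) ≤ (absNorm P : ℝ) ^ (-1 : ℝ) :=
        Real.rpow_le_rpow_of_exponent_le (by linarith) (by linarith)
    _ = 1 / (absNorm P : ℝ) := by rw [Real.rpow_neg_one, one_div]
    _ ≤ 1 / 2 := by gcongr

lemma euler_upper {s : ℝ} (hs : 1 < s) (F : Finset (Ideal (𝓞 K))) :
    (∀ P ∈ F, Prime P) → ∀ T : Finset (Ideal (𝓞 K)), (∀ I ∈ T, I ≠ 0) →
    (∀ I ∈ T, ∀ P, Prime P → P ∣ I → P ∈ F) →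
    ∑ I ∈ T, wt K s I ≤ ∏ P ∈ F, (1 - wt K s P)⁻¹ := by
  classical
  induction F using Finset.induction_on with
  | empty =>
    intro _ T hT hTF
    have : T ⊆ {1} := by
      intro I hI
      rw [Finset.mem_singleton]
      by_contra hne
      obtain ⟨P, hP, hd⟩ := WfDvdMonoid.exists_irreducible_factor (a := I) (by
        rw [isUnit_iff_eq_one]; exact hne) (hT I hI)
      simpa using hTF I hI P hP.prime hd
    refine (Finset.sum_le_sum_of_subset_of_nonneg this (fun I _ _ => wt_nonneg s I)).trans ?_
    rw [Finset.sum_singleton, wt_one, Finset.prod_empty]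
  | insert P F hPF ih =>
    intro hpr T hT hTF
    have hP : Prime P := hpr P (Finset.mem_insert_self _ _)
    have hex : ∀ I : Ideal (𝓞 K), ∃ (e : ℕ) (J : Ideal (𝓞 K)), I ≠ 0 → ¬ P ∣ J ∧ I = P ^ e * J := by
      intro I
      by_cases hI : I = 0
      · exact ⟨0, 0, fun h => absurd hI h⟩
      · have hfin : FiniteMultiplicity P I := FiniteMultiplicity.of_prime_left hP hI
        obtain ⟨J, hJ, hnd⟩ := hfin.exists_eq_pow_mul_and_not_dvd
        exact ⟨_, J, fun _ => ⟨hnd, hJ⟩⟩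
    choose e J heJ using hex
    set T' := T.image J with hT'
    set m := T.sup e with hm
    have hT'0 : ∀ I ∈ T', I ≠ 0 := by
      intro I hI h0
      obtain ⟨I', hI', rfl⟩ := Finset.mem_image.mp hI
      have := (heJ I' (hT I' hI')).2
      rw [h0, mul_zero] at this
      exact hT I' hI' this
    have hih := ih (fun P' hP' => hpr P' (Finset.mem_insert_of_mem hP')) T' hT'0 (by
      intro I hI P' hP' hd
      obtain ⟨I', hI', rfl⟩ := Finset.mem_image.mp hI
      obtain ⟨h1, h2⟩ := heJ I' (hT I' hI')
      have h3 : P' ∈ insert P F := hTF I' hI' P' hP' (by rw [h2]; exact hd.mul_left _)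
      rcases Finset.mem_insert.mp h3 with rfl | h
      · exact absurd hd h1
      · exact h)
    have h1 : ∑ I ∈ T, wt K s I ≤ ∑ x ∈ Finset.range (m + 1) ×ˢ T', wt K s P ^ x.1 * wt K s x.2 := by
      have : ∑ I ∈ T, wt K s I = ∑ x ∈ T.image (fun I => (e I, J I)), wt K s P ^ x.1 * wt K s x.2 := by
        rw [Finset.sum_image]
        · refine Finset.sum_congr rfl ?_
          intro I hI
          conv_lhs => rw [(heJ I (hT I hI)).2]
          rw [wt_mul, wt_pow]
        · intro I hI I' hI' h
          simp only [Prod.mk.injEq] at h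
          rw [(heJ I (hT I hI)).2, (heJ I' (hT I' hI')).2, h.1, h.2]
      rw [this]
      apply Finset.sum_le_sum_of_subset_of_nonneg
      · intro x hx
        obtain ⟨I, hI, rfl⟩ := Finset.mem_image.mp hx
        simp only [Finset.mem_product, Finset.mem_range]
        exact ⟨Nat.lt_succ_of_le (Finset.le_sup hI), Finset.mem_image_of_mem _ hI⟩
      · intro x _ _
        exact mul_nonneg (pow_nonneg (wt_nonneg _ _) _) (wt_nonneg _ _)
    rw [Finset.sum_product, ← Finset.sum_mul_sum] at h1
    refine h1.trans ?_
    rw [Finset.prod_insert hPF]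
    have hhalf := wt_le_half hs hP
    have hgeo : ∑ i ∈ Finset.range (m + 1), wt K s P ^ i ≤ (1 - wt K s P)⁻¹ := by
      rw [← tsum_geometric_of_lt_one (wt_nonneg _ _) (by linarith)]
      exact (summable_geometric_of_lt_one (wt_nonneg _ _) (by linarith)).sum_le_tsum _
        (fun i _ => pow_nonneg (wt_nonneg _ _) _)
    refine mul_le_mul hgeo hih (Finset.sum_nonneg fun I _ => wt_nonneg _ _) ?_
    rw [inv_nonneg]
    linarith

lemma euler_lower {s : ℝ} (hs : 1 < s) (F : Finset (Ideal (𝓞 K))) (hF : ∀ P ∈ F, Prime P) :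
    ∏ P ∈ F, (1 + wt K s P) ≤ zetaR K s := by
  classical
  rw [Finset.prod_one_add]
  have hmem : ∀ t ∈ F.powerset, ∀ P ∈ F, P ∣ ∏ I ∈ t, I → P ∈ t := by
    intro t ht P hP hd
    rw [Finset.mem_powerset] at ht
    obtain ⟨Q, hQ, hPQ⟩ := (hF P hP).exists_mem_finset_dvd hd
    have := ((hF P hP).dvd_prime_iff_associated (hF Q (ht hQ))).mp hPQ
    rw [associated_iff_eq] at this
    rwa [this]
  have h1 : ∑ t ∈ F.powerset, ∏ P ∈ t, wt K s P
      = ∑ I ∈ F.powerset.image (fun t => ∏ P ∈ t, P), wt K s I := by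
    rw [Finset.sum_image]
    · refine Finset.sum_congr rfl ?_
      intro t _
      rw [wt_prod]
    · intro t ht t' ht' h
      simp only at h
      have ht2 := Finset.mem_powerset.mp ht
      have ht2' := Finset.mem_powerset.mp ht'
      ext P
      constructor
      · intro hP
        exact hmem t' ht' P (ht2 hP) (h ▸ Finset.dvd_prod_of_mem _ hP)
      · intro hP
        exact hmem t ht P (ht2' hP) (h ▸ Finset.dvd_prod_of_mem _ hP)
  rw [h1]
  apply sum_le_zetaR K hs
  intro I hI
  obtain ⟨t, ht, rfl⟩ := Finset.mem_image.mp hI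
  rw [← Ideal.zero_eq_bot, Finset.prod_ne_zero_iff]
  intro P hP
  exact (hF P (Finset.mem_powerset.mp ht hP)).ne_zero

lemma inv_one_sub_le {x : ℝ} (h0 : 0 ≤ x) (h1 : x ≤ 1 / 2) : (1 - x)⁻¹ ≤ Real.exp (x + x ^ 2) := by
  have h := Real.quadratic_le_exp_of_nonneg (x := x + x ^ 2) (by positivity)
  rw [inv_le_iff_one_le_mul₀ (by linarith)]
  have h2 : 1 ≤ (1 + (x + x ^ 2) + (x + x ^ 2) ^ 2 / 2) * (1 - x) := by
    have : (1 + (x + x ^ 2) + (x + x ^ 2) ^ 2 / 2) * (1 - x) - 1 = x ^ 2 / 2 * (1 - x - x ^ 2 - x ^ 3) := by ring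
    have h3 : 0 ≤ 1 - x - x ^ 2 - x ^ 3 := by nlinarith [pow_le_pow_left₀ h0 h1 2, pow_le_pow_left₀ h0 h1 3]
    have : 0 ≤ x ^ 2 / 2 * (1 - x - x ^ 2 - x ^ 3) := by positivity
    linarith
  nlinarith

lemma exp_le_one_add {x : ℝ} (h0 : 0 ≤ x) : Real.exp (x - x ^ 2) ≤ 1 + x := by
  have h := Real.add_one_le_exp (-(x - x ^ 2))
  rw [Real.exp_neg] at h
  have hp := Real.exp_pos (x - x ^ 2)
  have h2 : (-(x - x ^ 2) + 1) * Real.exp (x - x ^ 2) ≤ 1 := by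
    rw [← one_div] at h
    exact (le_div_iff₀ hp).mp h
  have h3 : 1 ≤ (1 + x) * (-(x - x ^ 2) + 1) := by nlinarith [pow_nonneg h0 3]
  nlinarith [mul_le_mul_of_nonneg_left h2 (show 0 ≤ 1 + x by linarith)]

lemma sum_sq_le {s : ℝ} (hs : 1 < s) (F : Finset (Ideal (𝓞 K))) (hF : ∀ P ∈ F, Prime P) :
    ∑ P ∈ F, wt K s P ^ 2 ≤ zetaR K 2 := by
  refine le_trans ?_ (sum_le_zetaR K (s := 2) (by norm_num) F (fun P hP => (hF P hP).ne_zero))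
  refine Finset.sum_le_sum ?_
  intro P hP
  have h2 : (2 : ℝ) ≤ absNorm P := by exact_mod_cast two_le_norm (hF P hP)
  unfold wt
  rw [← Real.rpow_natCast, ← Real.rpow_mul (by positivity)]
  exact Real.rpow_le_rpow_of_exponent_le (by linarith) (by push_cast; linarith)

lemma prime_norm {P : Ideal (𝓞 K)} (hP : Prime P) :
    ∃ l f : ℕ, l.Prime ∧ 1 ≤ f ∧ absNorm P = l ^ f ∧ (l : 𝓞 K) ∈ P := by
  have hPp : P.IsPrime := isPrime_of_prime hP
  have hmax : P.IsMaximal := hPp.isMaximal hP.ne_zero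
  letI := Ideal.Quotient.field P
  have hcard : absNorm P = Nat.card (𝓞 K ⧸ P) := by
    rw [absNorm_apply, Submodule.cardQuot_apply]
  have : Finite (𝓞 K ⧸ P) := by
    apply Nat.finite_of_card_ne_zero
    rw [← hcard]
    have := two_le_norm hP
    omega
  have := Fintype.ofFinite (𝓞 K ⧸ P)
  obtain ⟨l, hl⟩ := CharP.exists (𝓞 K ⧸ P)
  obtain ⟨n, hlp, hn⟩ := FiniteField.card (𝓞 K ⧸ P) l
  refine ⟨l, n, hlp, n.2, ?_, ?_⟩
  · rw [hcard, Nat.card_eq_fintype_card, hn]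
  · rw [← Ideal.Quotient.eq_zero_iff_mem, map_natCast]
    exact CharP.cast_eq_zero _ l

lemma card_above_le (l : ℕ) (hl : l.Prime) (F : Finset (Ideal (𝓞 K))) (hF : ∀ P ∈ F, Prime P)
    (hFl : ∀ P ∈ F, (l : 𝓞 K) ∈ P) : F.card ≤ Module.finrank ℚ K := by
  have h1 : ∏ P ∈ F, P ∣ span {(l : 𝓞 K)} := by
    apply Finset.prod_dvd_of_isRelPrime
    · intro P hP Q hQ hPQ
      refine (hF P hP).irreducible.isRelPrime_iff_not_dvd.mpr ?_
      intro hd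
      have := ((hF P hP).dvd_prime_iff_associated (hF Q hQ)).mp hd
      rw [associated_iff_eq] at this
      exact hPQ this
    · intro P hP
      rw [dvd_span_singleton]
      exact hFl P hP
  have h2 : absNorm (span {(l : 𝓞 K)}) = l ^ Module.finrank ℚ K := by
    rw [absNorm_span_singleton]
    have := Algebra.norm_algebraMap (S := 𝓞 K) (l : ℤ)
    simp only [map_natCast] at this
    rw [this, Int.natAbs_pow, Int.natAbs_natCast, RingOfIntegers.rank]
  have h3 := map_dvd absNorm h1
  rw [h2, map_prod] at h3
  have h4 := Nat.le_of_dvd (pow_pos hl.pos _) h3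
  have h5 : l ^ F.card ≤ ∏ P ∈ F, absNorm P := by
    rw [← Finset.prod_const]
    refine Finset.prod_le_prod' ?_
    intro P hP
    have h6 : absNorm P ∣ l ^ Module.finrank ℚ K := by
      rw [← h2]
      exact map_dvd absNorm (dvd_span_singleton.mpr (hFl P hP))
    obtain ⟨i, _, hi⟩ := (Nat.dvd_prime_pow hl).mp h6
    have := two_le_norm (hF P hP)
    rw [hi] at this ⊢
    have : i ≠ 0 := by rintro rfl; simp at this
    exact Nat.le_self_pow this l
  exact (Nat.pow_le_pow_iff_right hl.one_lt).mp (h5.trans h4)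

lemma sum_others_le {s : ℝ} (hs : 1 < s) (N : ℕ) (hN : 0 < N) (F : Finset (Ideal (𝓞 K)))
    (hF : ∀ P ∈ F, Prime P)
    (hFo : ∀ P ∈ F, ∀ l : ℕ, l.Prime → absNorm P = l → l ∣ N) :
    ∑ P ∈ F, wt K s P ≤ Module.finrank ℚ K * (N : ℝ) ^ 2 * ∑' n : ℕ, 1 / (n : ℝ) ^ 2 := by
  classical
  have hex : ∀ P : Ideal (𝓞 K), ∃ l f : ℕ, Prime P →
      (l.Prime ∧ 1 ≤ f ∧ absNorm P = l ^ f ∧ (l : 𝓞 K) ∈ P) := by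
    intro P
    by_cases hP : Prime P
    · obtain ⟨l, f, h⟩ := prime_norm hP
      exact ⟨l, f, fun _ => h⟩
    · exact ⟨0, 0, fun h => absurd h hP⟩
  choose l f hlf using hex
  have hbd : ∀ P ∈ F, wt K s P ≤ (N : ℝ) ^ 2 * (1 / (l P : ℝ) ^ 2) := by
    intro P hP
    obtain ⟨hl, hf, hn, -⟩ := hlf P (hF P hP)
    have hl2 : (2 : ℝ) ≤ l P := by exact_mod_cast hl.two_le
    have hN1 : (1 : ℝ) ≤ N := by exact_mod_cast hN
    have h2 : (2 : ℝ) ≤ absNorm P := by exact_mod_cast two_le_norm (hF P hP)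
    have hw : wt K s P ≤ 1 / (absNorm P : ℝ) := by
      unfold wt
      rw [one_div, ← Real.rpow_neg_one]
      exact Real.rpow_le_rpow_of_exponent_le (by linarith) (by linarith)
    by_cases hf1 : f P = 1
    · have hd : l P ∣ N := hFo P hP (l P) hl (by rw [hn, hf1, pow_one])
      have hle : (l P : ℝ) ≤ N := by exact_mod_cast Nat.le_of_dvd hN hd
      have h3 : wt K s P ≤ 1 := (wt_le_half hs (hF P hP)).trans (by norm_num)
      refine h3.trans ?_
      rw [mul_one_div, one_le_div (by positivity)]
      gcongr
    · refine hw.trans ?_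
      rw [hn]
      push_cast
      have h4 : (l P : ℝ) ^ 2 ≤ (l P : ℝ) ^ f P := pow_le_pow_right₀ (by linarith) (by omega)
      calc 1 / (l P : ℝ) ^ f P ≤ 1 / (l P : ℝ) ^ 2 := by gcongr
        _ ≤ (N : ℝ) ^ 2 * (1 / (l P : ℝ) ^ 2) := by
          refine le_mul_of_one_le_left (by positivity) ?_
          exact one_le_pow₀ hN1
  have hsum2 : Summable (fun n : ℕ => 1 / (n : ℝ) ^ 2) := Real.summable_one_div_nat_pow.mpr (by norm_num)
  calc ∑ P ∈ F, wt K s P ≤ ∑ P ∈ F, (N : ℝ) ^ 2 * (1 / (l P : ℝ) ^ 2) := Finset.sum_le_sum hbd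
    _ = ∑ p ∈ F.image l, ∑ P ∈ F.filter (fun P => l P = p), (N : ℝ) ^ 2 * (1 / (l P : ℝ) ^ 2) :=
        (Finset.sum_fiberwise_of_maps_to (fun P hP => Finset.mem_image_of_mem _ hP) _).symm
    _ ≤ ∑ p ∈ F.image l, Module.finrank ℚ K * (N : ℝ) ^ 2 * (1 / (p : ℝ) ^ 2) := by
        refine Finset.sum_le_sum ?_
        intro p hp
        have e1 : ∑ P ∈ F.filter (fun P => l P = p), (N : ℝ) ^ 2 * (1 / (l P : ℝ) ^ 2)
            = (F.filter (fun P => l P = p)).card * ((N : ℝ) ^ 2 * (1 / (p : ℝ) ^ 2)) := by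
          rw [← nsmul_eq_mul, ← Finset.sum_const]
          refine Finset.sum_congr rfl ?_
          intro P hP
          rw [(Finset.mem_filter.mp hP).2]
        rw [e1, mul_assoc]
        refine mul_le_mul_of_nonneg_right ?_ (by positivity)
        norm_cast
        obtain ⟨P0, hP0, rfl⟩ := Finset.mem_image.mp hp
        refine card_above_le (l P0) (hlf P0 (hF P0 hP0)).1 _ ?_ ?_
        · intro P hP
          exact hF P (Finset.mem_filter.mp hP).1
        · intro P hP
          rw [← (Finset.mem_filter.mp hP).2]
          exact (hlf P (hF P (Finset.mem_filter.mp hP).1)).2.2.2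
    _ = Module.finrank ℚ K * (N : ℝ) ^ 2 * ∑ p ∈ F.image l, (1 / (p : ℝ) ^ 2) := by
        rw [Finset.mul_sum]
    _ ≤ _ := by
        refine mul_le_mul_of_nonneg_left ?_ (by positivity)
        exact hsum2.sum_le_tsum _ (fun n _ => by positivity)

end Euler
end Blk


namespace Blk
open Filter Topology NumberField Ideal

section Analytic
variable {K K' : Type*} [Field K] [NumberField K] [Field K'] [NumberField K']

lemma prod_inv_le {s : ℝ} (hs : 1 < s) (F : Finset (Ideal (𝓞 K))) (hF : ∀ P ∈ F, Prime P) :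
    ∏ P ∈ F, (1 - wt K s P)⁻¹ ≤ Real.exp (∑ P ∈ F, wt K s P + zetaR K 2) := by
  calc ∏ P ∈ F, (1 - wt K s P)⁻¹ ≤ ∏ P ∈ F, Real.exp (wt K s P + wt K s P ^ 2) := by
        refine Finset.prod_le_prod ?_ ?_
        · intro P hP
          have := wt_le_half hs (hF P hP)
          rw [inv_nonneg]; linarith
        · intro P hP
          exact inv_one_sub_le (wt_nonneg _ _) (wt_le_half hs (hF P hP))
    _ = Real.exp (∑ P ∈ F, wt K s P + ∑ P ∈ F, wt K s P ^ 2) := by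
        rw [← Real.exp_sum, Finset.sum_add_distrib]
    _ ≤ _ := Real.exp_le_exp.mpr (by have := sum_sq_le hs F hF; linarith)

lemma exp_le_zetaR {s : ℝ} (hs : 1 < s) (F : Finset (Ideal (𝓞 K))) (hF : ∀ P ∈ F, Prime P) :
    Real.exp (∑ P ∈ F, wt K s P - zetaR K 2) ≤ zetaR K s := by
  refine le_trans ?_ (euler_lower hs F hF)
  calc Real.exp (∑ P ∈ F, wt K s P - zetaR K 2)
      ≤ Real.exp (∑ P ∈ F, wt K s P - ∑ P ∈ F, wt K s P ^ 2) :=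
        Real.exp_le_exp.mpr (by have := sum_sq_le hs F hF; linarith)
    _ = ∏ P ∈ F, Real.exp (wt K s P - wt K s P ^ 2) := by
        rw [← Real.exp_sum, Finset.sum_sub_distrib]
    _ ≤ _ := by
        refine Finset.prod_le_prod (fun _ _ => (Real.exp_pos _).le) ?_
        intro P hP
        exact exp_le_one_add (wt_nonneg _ _)

theorem zeta_sq_le (r : Ideal (𝓞 K') → Ideal (𝓞 K)) (N : ℕ) (hN : 0 < N)
    (h : ∀ P : Ideal (𝓞 K), Prime P → ∀ l : ℕ, l.Prime → ¬ l ∣ N → absNorm P = l →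
      ∃ P1 P2 : Ideal (𝓞 K'), P1 ≠ P2 ∧ Prime P1 ∧ Prime P2 ∧ absNorm P1 = l ∧ absNorm P2 = l ∧
        r P1 = P ∧ r P2 = P) :
    ∃ C : ℝ, ∀ s : ℝ, 1 < s → zetaR K s ^ 2 ≤ C * zetaR K' s := by
  classical
  set D : ℝ := Module.finrank ℚ K * (N : ℝ) ^ 2 * ∑' n : ℕ, 1 / (n : ℝ) ^ 2 with hD
  have hex : ∀ P : Ideal (𝓞 K), ∃ P1 P2 : Ideal (𝓞 K'), 
      (Prime P ∧ ∃ l : ℕ, l.Prime ∧ ¬ l ∣ N ∧ absNorm P = l) →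
      P1 ≠ P2 ∧ Prime P1 ∧ Prime P2 ∧ absNorm P1 = absNorm P ∧ absNorm P2 = absNorm P ∧
        r P1 = P ∧ r P2 = P := by
    intro P
    by_cases hP : Prime P ∧ ∃ l : ℕ, l.Prime ∧ ¬ l ∣ N ∧ absNorm P = l
    · obtain ⟨hp, l, hl, hlN, hn⟩ := hP
      obtain ⟨P1, P2, h'⟩ := h P hp l hl hlN hn
      exact ⟨P1, P2, fun _ => by rw [hn]; exact h'⟩
    · exact ⟨0, 0, fun h => absurd h hP⟩
  choose P1 P2 hP12 using hex
  refine ⟨Real.exp (2 * (D + zetaR K 2) + zetaR K' 2), ?_⟩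
  intro s hs
  have hz0 : 0 ≤ zetaR K s := by
    have := sum_le_zetaR K hs ∅ (by simp)
    simpa using this
  have hz0' : 0 ≤ zetaR K' s := by
    have := sum_le_zetaR K' hs ∅ (by simp)
    simpa using this
  have key : zetaR K s ≤ Real.sqrt (Real.exp (2 * (D + zetaR K 2) + zetaR K' 2) * zetaR K' s) := by
    apply zetaR_le K hs
    intro T hT
    set F : Finset (Ideal (𝓞 K)) := T.biUnion fun I =>
      (UniqueFactorizationMonoid.normalizedFactors I).toFinset with hFdef
    have hF : ∀ P ∈ F, Prime P := by
      intro P hP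
      simp only [hFdef, Finset.mem_biUnion, Multiset.mem_toFinset] at hP
      obtain ⟨I, _, hP⟩ := hP
      exact UniqueFactorizationMonoid.prime_of_normalized_factor P hP
    have hup := euler_upper hs F hF T hT (by
      intro I hI P hP hd
      simp only [hFdef, Finset.mem_biUnion, Multiset.mem_toFinset]
      refine ⟨I, hI, ?_⟩
      rw [UniqueFactorizationMonoid.mem_normalizedFactors_iff (hT I hI)]
      exact ⟨hP, hd⟩)
    set good : Ideal (𝓞 K) → Prop := fun P => ∃ l : ℕ, l.Prime ∧ ¬ l ∣ N ∧ absNorm P = l with hgood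
    set G := F.filter good with hG
    have hGp : ∀ P ∈ G, Prime P ∧ good P := fun P hP =>
      ⟨hF P (Finset.mem_filter.mp hP).1, (Finset.mem_filter.mp hP).2⟩
    have hothers : ∑ P ∈ F.filter (fun P => ¬ good P), wt K s P ≤ D := by
      refine sum_others_le hs N hN _ (fun P hP => hF P (Finset.mem_filter.mp hP).1) ?_
      intro P hP l hl hn
      by_contra hlN
      exact (Finset.mem_filter.mp hP).2 ⟨l, hl, hlN, hn⟩
    have hsplit : ∑ P ∈ F, wt K s P = ∑ P ∈ G, wt K s P + ∑ P ∈ F.filter (fun P => ¬ good P), wt K s P :=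
      (Finset.sum_filter_add_sum_filter_not F good _).symm
    have hup2 : ∑ I ∈ T, wt K s I ≤ Real.exp (∑ P ∈ G, wt K s P + D + zetaR K 2) := by
      refine hup.trans ((prod_inv_le hs F hF).trans ?_)
      exact Real.exp_le_exp.mpr (by linarith)
    have hw : ∀ P ∈ G, wt K' s (P1 P) = wt K s P ∧ wt K' s (P2 P) = wt K s P := by
      intro P hP
      have := hP12 P (hGp P hP)
      unfold wt
      rw [this.2.2.2.1, this.2.2.2.2.1]
      exact ⟨rfl, rfl⟩
    have hdisj : Disjoint (G.image P1) (G.image P2) := by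
      rw [Finset.disjoint_left]
      intro Q h1 h2
      obtain ⟨P, hP, rfl⟩ := Finset.mem_image.mp h1
      obtain ⟨P', hP', he⟩ := Finset.mem_image.mp h2
      have a1 := hP12 P (hGp P hP)
      have a2 := hP12 P' (hGp P' hP')
      have : P' = P := by rw [← a2.2.2.2.2.2.2, he, a1.2.2.2.2.2.1]
      subst this
      exact a1.1 he.symm
    have hsum' : ∑ Q ∈ G.image P1 ∪ G.image P2, wt K' s Q = 2 * ∑ P ∈ G, wt K s P := by
      rw [Finset.sum_union hdisj, Finset.sum_image, Finset.sum_image, two_mul]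
      · congr 1
        · exact Finset.sum_congr rfl fun P hP => (hw P hP).1
        · exact Finset.sum_congr rfl fun P hP => (hw P hP).2
      · intro P hP P' hP' he
        have a1 := hP12 P (hGp P hP)
        have a2 := hP12 P' (hGp P' hP')
        rw [← a1.2.2.2.2.2.2, ← a2.2.2.2.2.2.2]
        exact congrArg r he
      · intro P hP P' hP' he
        have a1 := hP12 P (hGp P hP)
        have a2 := hP12 P' (hGp P' hP')
        rw [← a1.2.2.2.2.2.1, ← a2.2.2.2.2.2.1]
        exact congrArg r he
    have hlow := exp_le_zetaR hs (G.image P1 ∪ G.image P2) (by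
      intro Q hQ
      rcases Finset.mem_union.mp hQ with hQ | hQ
      · obtain ⟨P, hP, rfl⟩ := Finset.mem_image.mp hQ
        exact (hP12 P (hGp P hP)).2.1
      · obtain ⟨P, hP, rfl⟩ := Finset.mem_image.mp hQ
        exact (hP12 P (hGp P hP)).2.2.1)
    rw [hsum'] at hlow
    apply Real.le_sqrt_of_sq_le
    have h0 : 0 ≤ ∑ I ∈ T, wt K s I := Finset.sum_nonneg fun I _ => wt_nonneg _ _
    calc (∑ I ∈ T, wt K s I) ^ 2 ≤ (Real.exp (∑ P ∈ G, wt K s P + D + zetaR K 2)) ^ 2 := by gcongr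
      _ = Real.exp (2 * (D + zetaR K 2) + zetaR K' 2) * Real.exp (2 * ∑ P ∈ G, wt K s P - zetaR K' 2) := by
        rw [← Real.exp_add, sq, ← Real.exp_add]
        congr 1; ring
      _ ≤ _ := by gcongr
  calc zetaR K s ^ 2 ≤ _ := pow_le_pow_left₀ hz0 key 2
    _ = _ := Real.sq_sqrt (by positivity)

theorem analytic (r : Ideal (𝓞 K') → Ideal (𝓞 K)) (N : ℕ) (hN : 0 < N)
    (h : ∀ P : Ideal (𝓞 K), Prime P → ∀ l : ℕ, l.Prime → ¬ l ∣ N → absNorm P = l →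
      ∃ P1 P2 : Ideal (𝓞 K'), P1 ≠ P2 ∧ Prime P1 ∧ Prime P2 ∧ absNorm P1 = l ∧ absNorm P2 = l ∧
        r P1 = P ∧ r P2 = P) : False := by
  obtain ⟨C, hC⟩ := zeta_sq_le r N hN h
  have h1 := (tendsto_zetaR K).pow 2
  have hs0 : Tendsto (fun s : ℝ => s - 1) (𝓝[>] 1) (𝓝 0) := by
    have : Tendsto (fun s : ℝ => s - 1) (𝓝 1) (𝓝 (1 - 1)) := by
      apply Continuous.tendsto; fun_prop
    rw [sub_self] at this
    exact this.mono_left nhdsWithin_le_nhds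
  have h2 := ((tendsto_zetaR K').const_mul C).mul hs0
  rw [mul_zero] at h2
  have hle : dedekindZeta_residue K ^ 2 ≤ 0 := by
    refine le_of_tendsto_of_tendsto h1 h2 ?_
    filter_upwards [self_mem_nhdsWithin] with s hs
    have hs : 1 < s := hs
    have := mul_le_mul_of_nonneg_left (hC s hs) (sq_nonneg (s - 1))
    nlinarith
  have := pow_pos (dedekindZeta_residue_pos K) 2
  linarith

end Analytic
end Blk


namespace Blk
open Filter Topology NumberField Ideal Polynomial

lemma extend_hom {A B F : Type*} [CommRing A] [CommRing B] [Algebra A B] [Field F]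
    (α : B) (m : A[X]) (hα : ∀ p : A[X], aeval α p = 0 → m ∣ p) (N : ℕ)
    (hN : ∀ y : B, ∃ p : A[X], aeval α p = (N : B) * y) (φ : A →+* F) (hNF : (N : F) ≠ 0)
    (x : F) (hx : eval₂ φ x m = 0) :
    ∃ φ' : B →+* F, φ'.comp (algebraMap A B) = φ ∧ φ' α = x := by
  have hwd : ∀ p p' : A[X], aeval α p = aeval α p' → eval₂ φ x p = eval₂ φ x p' := by
    intro p p' h
    obtain ⟨r, hr⟩ := hα (p - p') (by rw [map_sub, h, sub_self])
    have : eval₂ φ x (p - p') = 0 := by rw [hr, eval₂_mul, hx, zero_mul]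
    rw [eval₂_sub] at this
    exact sub_eq_zero.mp this
  choose P hP using hN
  have hval : ∀ (y : B) (p : A[X]), aeval α p = (N : B) * y → eval₂ φ x (P y) = eval₂ φ x p := by
    intro y p h
    exact hwd _ _ (by rw [hP, h])
  have hNN : ∀ y : B, ∀ p : A[X], aeval α p = y →
      (N : F)⁻¹ * eval₂ φ x (P y) = eval₂ φ x p := by
    intro y p h
    rw [hval y (C (N : A) * p) (by rw [map_mul, h]; simp)]
    rw [eval₂_mul, eval₂_C, map_natCast, inv_mul_cancel_left₀ hNF]
  refine ⟨
    { toFun := fun y => (N : F)⁻¹ * eval₂ φ x (P y)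
      map_one' := by rw [hNN 1 1 (by simp), eval₂_one]
      map_zero' := by rw [hNN 0 0 (by simp), eval₂_zero]
      map_add' := by
        intro y z
        rw [hval (y + z) (P y + P z) (by rw [map_add, hP, hP]; ring), eval₂_add, mul_add]
      map_mul' := by
        intro y z
        have : (N : F) * eval₂ φ x (P (y * z)) = eval₂ φ x (P y) * eval₂ φ x (P z) := by
          rw [← eval₂_mul]
          have h2 := hwd (C (N : A) * P (y * z)) (P y * P z) (by
            rw [map_mul, map_mul, hP, hP, hP]; simp; ring)
          rw [← h2, eval₂_mul, eval₂_C, map_natCast]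
        field_simp
        rw [this] }, ?_, ?_⟩
  · ext y
    simp only [RingHom.comp_apply, RingHom.coe_mk, MonoidHom.coe_mk, OneHom.coe_mk]
    rw [hNN _ (C y) (by simp), eval₂_C]
  · simp only [RingHom.coe_mk, MonoidHom.coe_mk, OneHom.coe_mk]
    rw [hNN _ X (by simp), eval₂_X]

section
variable {K : Type*} [Field K] [NumberField K]

lemma ker_prime {l : ℕ} (hl : l.Prime) (φ : 𝓞 K →+* ZMod l) :
    Prime (RingHom.ker φ) ∧ absNorm (RingHom.ker φ) = l := by
  have : Fact l.Prime := ⟨hl⟩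
  have hn : absNorm (RingHom.ker φ) = l := by
    rw [absNorm_apply, Submodule.cardQuot_apply]
    have hs := ZMod.ringHom_surjective φ
    rw [Nat.card_congr (RingHom.quotientKerEquivOfSurjective hs).toEquiv, Nat.card_zmod]
  refine ⟨?_, hn⟩
  apply Ideal.prime_of_isPrime
  · intro h
    rw [h, absNorm_bot] at hn
    exact hl.ne_zero hn.symm
  · exact RingHom.ker_isPrime φ

lemma exists_hom {P : Ideal (𝓞 K)} {l : ℕ} (hl : l.Prime) (h : absNorm P = l) :
    ∃ φ : 𝓞 K →+* ZMod l, RingHom.ker φ = P := by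
  rw [absNorm_apply, Submodule.cardQuot_apply] at h
  have : Finite (𝓞 K ⧸ P) := by
    apply Nat.finite_of_card_ne_zero
    rw [h]; exact hl.ne_zero
  have := Fintype.ofFinite (𝓞 K ⧸ P)
  rw [Nat.card_eq_fintype_card] at h
  let e := (ZMod.ringEquivOfPrime (𝓞 K ⧸ P) hl h).symm
  refine ⟨(e : (𝓞 K ⧸ P) →+* ZMod l).comp (Ideal.Quotient.mk P), ?_⟩
  ext y
  rw [RingHom.mem_ker, RingHom.comp_apply]
  simp [Ideal.Quotient.eq_zero_iff_mem]
end

/-- common denominators for powers of a generator -/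
lemma exists_denominator {K K' : Type*} [Field K] [NumberField K] [Field K'] [NumberField K']
    [Algebra K K'] (α : 𝓞 K') (hgen : ∀ y : K', ∃ p : K[X], aeval (α : K') p = y) :
    ∃ N : ℕ, 0 < N ∧ ∀ y : 𝓞 K', ∃ p : (𝓞 K)[X], aeval α p = (N : 𝓞 K') * y := by
  classical
  have h1 : ∀ y : 𝓞 K', ∃ N : ℕ, 0 < N ∧ ∃ p : (𝓞 K)[X], aeval α p = (N : 𝓞 K') * y := by
    intro y
    obtain ⟨p, hp⟩ := hgen y
    obtain ⟨b, hbM, hb⟩ := IsLocalization.integerNormalization_spec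
      (Algebra.algebraMapSubmonoid (𝓞 K) (nonZeroDivisors ℤ)) p
    set p0 := IsLocalization.integerNormalization
      (Algebra.algebraMapSubmonoid (𝓞 K) (nonZeroDivisors ℤ)) p with hp0
    obtain ⟨c, hc, rfl⟩ := hbM
    have hc0 : c ≠ 0 := nonZeroDivisors.ne_zero hc
    have h2 : aeval α p0 = (c : 𝓞 K') * y := by
      apply RingOfIntegers.ext
      have e1 : ((aeval α p0 : 𝓞 K') : K') = aeval (α : K') (p0.map (algebraMap (𝓞 K) K)) := by
        rw [aeval_map_algebraMap]
        exact (aeval_algebraMap_apply K' α p0).symm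
      rw [e1, hb]
      simp only [algebraMap_int_eq, eq_intCast, map_mul]
      rw [show algebraMap (𝓞 K') K' y = (y : K') from rfl, ← hp]
      rw [← algebraMap_smul K (c : 𝓞 K) p, map_smul, ← algebraMap_smul K' (algebraMap (𝓞 K) K c)]
      simp
    refine ⟨c.natAbs ^ 2, by positivity, C (c : 𝓞 K) * p0, ?_⟩
    rw [map_mul, h2, ← mul_assoc]
    congr 1
    have : ((c.natAbs ^ 2 : ℕ) : 𝓞 K') = (((c.natAbs ^ 2 : ℕ) : ℤ) : 𝓞 K') := by norm_cast
    rw [this]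
    push_cast
    rw [aeval_C, map_intCast, ← Int.cast_mul, ← Int.cast_pow]
    congr 1
    rw [sq_abs, sq]
  obtain ⟨T, hT⟩ := (Module.Finite.fg_top : (⊤ : Submodule ℤ (𝓞 K')).FG)
  choose N hN P hP using h1
  refine ⟨∏ y ∈ T, N y, Finset.prod_pos fun y _ => hN y, ?_⟩
  intro y
  have hy : y ∈ Submodule.span ℤ (T : Set (𝓞 K')) := by rw [hT]; trivial
  induction hy using Submodule.span_induction with
  | mem y hy =>
    refine ⟨C ((∏ z ∈ T.erase y, N z : ℕ) : 𝓞 K) * P y, ?_⟩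
    rw [map_mul, hP, ← Finset.mul_prod_erase T N hy]
    simp
    ring
  | zero => exact ⟨0, by simp⟩
  | add y z _ _ h1 h2 =>
    obtain ⟨p1, h1⟩ := h1
    obtain ⟨p2, h2⟩ := h2
    exact ⟨p1 + p2, by rw [map_add, h1, h2]; ring⟩
  | smul c y _ h1 =>
    obtain ⟨p1, h1⟩ := h1
    exact ⟨c • p1, by rw [map_zsmul, h1]; simp; ring⟩


theorem nonpower_aux {q : ℕ} (hq : q.Prime) {K K' : Type*} [Field K] [NumberField K] [Field K']
    [NumberField K'] [Algebra K K'] {ζ : K} (hζ : IsPrimitiveRoot ζ q) (a : ℤ) (ha : a ≠ 0)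
    (hirr : Irreducible (X ^ q - C (a : K))) (β : K') (hβ : β ^ q = a)
    (hgen : ∀ y : K', ∃ p : K[X], aeval β p = y) (D : ℕ) (hD : 0 < D) :
    ∃ l : ℕ, l.Prime ∧ ¬ l ∣ D ∧ (∃ _ : 𝓞 K →+* ZMod l, True) ∧ ¬ ∃ x : ZMod l, x ^ q = a := by
  by_contra hcon
  push Not at hcon
  have : NeZero q := ⟨hq.ne_zero⟩
  have hβi : IsIntegral ℤ β := by
    refine IsIntegral.of_pow hq.pos ?_
    rw [hβ]
    exact isIntegral_algebraMap (R := ℤ) (x := a)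
  set α : 𝓞 K' := ⟨β, hβi⟩ with hα
  have hαβ : (α : K') = β := rfl
  obtain ⟨N, hN, hNy⟩ := exists_denominator (K := K) α (by rw [hαβ]; exact hgen)
  have hmonic : (X ^ q - C (a : 𝓞 K)).Monic := monic_X_pow_sub_C _ hq.ne_zero
  have hdvd : ∀ p : (𝓞 K)[X], aeval α p = 0 → (X ^ q - C (a : 𝓞 K)) ∣ p := by
    intro p hp
    rw [← map_dvd_map (algebraMap (𝓞 K) K) RingOfIntegers.coe_injective hmonic]
    have e1 : aeval β (p.map (algebraMap (𝓞 K) K)) = 0 := by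
      rw [aeval_map_algebraMap, ← hαβ]
      have := aeval_algebraMap_apply K' α p
      rw [hp, map_zero] at this
      exact this
    have e2 : (X ^ q - C (a : 𝓞 K)).map (algebraMap (𝓞 K) K) = X ^ q - C (a : K) := by
      simp
    rw [e2]
    have e3 : minpoly K β = X ^ q - C (a : K) := by
      refine (minpoly.eq_of_irreducible_of_monic hirr ?_ (monic_X_pow_sub_C _ hq.ne_zero)).symm
      simp [hβ]
    rw [← e3]
    exact minpoly.dvd _ _ e1
  refine analytic (K := K) (K' := K') (fun I => I.comap (algebraMap (𝓞 K) (𝓞 K')))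
    (D * N * q * a.natAbs) (by have := hq.pos; have := Int.natAbs_pos.mpr ha; positivity) ?_
  intro P hP l hl hlN hn
  have : Fact l.Prime := ⟨hl⟩
  have hlD : ¬ l ∣ D := fun h => hlN (by rw [mul_assoc, mul_assoc]; exact h.mul_right _)
  have hlN' : ¬ l ∣ N := fun h => hlN (by rw [mul_assoc]; exact (h.mul_left D).mul_right _)
  have hlq : ¬ l ∣ q := fun h => hlN ((h.mul_left _).mul_right _)
  have hla : ¬ l ∣ a.natAbs := fun h => hlN (h.mul_left _)
  obtain ⟨φ, hφ⟩ := exists_hom hl hn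
  obtain ⟨x, hx⟩ := hcon l hl hlD ⟨φ, trivial⟩
  set z := φ hζ.toInteger with hz
  have hzq : z ^ q = 1 := by
    rw [hz, ← map_pow, hζ.toInteger_isPrimitiveRoot.pow_eq_one, map_one]
  have hz1 : z ≠ 1 := by
    intro h1
    have h2 := hζ.toInteger_isPrimitiveRoot.geom_sum_eq_zero hq.one_lt
    have h3 := congrArg φ h2
    rw [map_sum, map_zero] at h3
    simp only [map_pow, ← hz, h1, one_pow, Finset.sum_const, Finset.card_range, nsmul_eq_mul,
      mul_one] at h3
    exact hlq ((ZMod.natCast_eq_zero_iff _ _).mp h3)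
  have ha0 : (a : ZMod l) ≠ 0 := by
    intro h
    rw [ZMod.intCast_zmod_eq_zero_iff_dvd] at h
    exact hla (Int.natCast_dvd.mp h)
  have hx0 : x ≠ 0 := by
    rintro rfl
    rw [zero_pow hq.ne_zero] at hx
    exact ha0 hx.symm
  have hNF : (N : ZMod l) ≠ 0 := by
    intro h
    exact hlN' ((ZMod.natCast_eq_zero_iff _ _).mp h)
  obtain ⟨φ1, h11, h12⟩ := extend_hom α _ hdvd N hNy φ hNF x (by
    rw [eval₂_sub, eval₂_X_pow, eval₂_C, map_intCast, hx, sub_self])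
  obtain ⟨φ2, h21, h22⟩ := extend_hom α _ hdvd N hNy φ hNF (x * z) (by
    rw [eval₂_sub, eval₂_X_pow, eval₂_C, map_intCast, mul_pow, hzq, hx, mul_one, sub_self])
  refine ⟨RingHom.ker φ1, RingHom.ker φ2, ?_, (ker_prime hl φ1).1, (ker_prime hl φ2).1,
    (ker_prime hl φ1).2, (ker_prime hl φ2).2, ?_, ?_⟩
  · intro he
    have m1 : α - (x.val : 𝓞 K') ∈ RingHom.ker φ1 := by
      rw [RingHom.mem_ker, map_sub, h12, map_natCast, ZMod.natCast_zmod_val, sub_self]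
    rw [he, RingHom.mem_ker, map_sub, h22, map_natCast, ZMod.natCast_zmod_val] at m1
    apply hz1
    have : x * z = x * 1 := by rw [mul_one]; exact sub_eq_zero.mp m1
    exact mul_left_cancel₀ hx0 this
  · rw [← hφ, ← h11]; rfl
  · rw [← hφ, ← h21]; rfl

theorem nonpower {q : ℕ} (hq : q.Prime) {K : Type*} [Field K] [NumberField K]
    {ζ : K} (hζ : IsPrimitiveRoot ζ q) (a : ℤ) (ha : a ≠ 0)
    (hna : ∀ y : K, y ^ q ≠ a) (D : ℕ) (hD : 0 < D) :
    ∃ l : ℕ, l.Prime ∧ ¬ l ∣ D ∧ (∃ _ : 𝓞 K →+* ZMod l, True) ∧ ¬ ∃ x : ZMod l, x ^ q = a := by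
  have hirr : Irreducible (X ^ q - C (a : K)) := X_pow_sub_C_irreducible_of_prime hq hna
  have : Fact (Irreducible (X ^ q - C (a : K))) := ⟨hirr⟩
  have : CharZero (AdjoinRoot (X ^ q - C (a : K))) :=
    charZero_of_injective_algebraMap (algebraMap K _).injective
  have hfin : Module.Finite K (AdjoinRoot (X ^ q - C (a : K))) :=
    (monic_X_pow_sub_C _ hq.ne_zero).finite_adjoinRoot
  have : NumberField (AdjoinRoot (X ^ q - C (a : K))) :=
    { to_finiteDimensional := Module.Finite.trans K _ }
  refine nonpower_aux hq hζ a ha hirr (AdjoinRoot.root (X ^ q - C (a : K))) ?_ ?_ D hD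
  · have := AdjoinRoot.eval₂_root (X ^ q - C (a : K))
    rw [eval₂_sub, eval₂_X_pow, eval₂_C] at this
    rw [sub_eq_zero.mp this]
    exact map_intCast (AdjoinRoot.of (X ^ q - C (a : K))) a
  · intro y
    obtain ⟨p, rfl⟩ := AdjoinRoot.mk_surjective y
    exact ⟨p, by rw [AdjoinRoot.aeval_eq]⟩

end Blk


namespace Blk
open Polynomial NumberField

lemma kummer_step {q : ℕ} (hq : q.Prime) {K : Type*} [Field K] 
    {ζ : K} (hζ : IsPrimitiveRoot ζ q) (b : K) (m : K[X]) (hm : m = X ^ q - C b)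
    (hirr : Irreducible m) (y : AdjoinRoot m) (a : K) (hy : y ^ q = AdjoinRoot.of m a) :
    ∃ (j : ℕ) (c : K), a = b ^ j * c ^ q := by
  have hF : Fact (Irreducible m) := ⟨hirr⟩
  have : NeZero q := ⟨hq.ne_zero⟩
  have hmonic : m.Monic := hm ▸ monic_X_pow_sub_C _ hq.ne_zero
  have hdeg : m.degree = q := hm ▸ degree_X_pow_sub_C hq.pos b
  set β := AdjoinRoot.root m with hβ
  have hβq : β ^ q = AdjoinRoot.of m b := by
    have := AdjoinRoot.eval₂_root m
    conv at this => lhs; arg 3; rw [hm]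
    rw [eval₂_sub, eval₂_X_pow, eval₂_C] at this
    exact sub_eq_zero.mp this
  obtain ⟨p', hp'⟩ := AdjoinRoot.mk_surjective y
  set p := p' %ₘ m with hp
  have hpdeg : p.degree < m.degree := degree_modByMonic_lt _ hmonic
  have hpy : AdjoinRoot.mk m p = y := by
    rw [← hp', AdjoinRoot.mk_eq_mk, hp]
    exact ⟨-(p' /ₘ m), by
      have := modByMonic_add_div p' m
      linear_combination this⟩
  have hzero : ∀ r : K[X], r.degree < m.degree → AdjoinRoot.mk m r = 0 → r = 0 := by
    intro r hr h
    rw [AdjoinRoot.mk_eq_zero] at h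
    exact eq_zero_of_dvd_of_degree_lt h hr
  -- the substitution
  have hmcomp : m.comp (C ζ * X) = m := by
    rw [hm]
    simp only [sub_comp, pow_comp, X_comp, C_comp, mul_pow, ← C_pow, hζ.pow_eq_one, map_one, one_mul]
  have hsub : ∀ r r' : K[X], AdjoinRoot.mk m r = AdjoinRoot.mk m r' →
      AdjoinRoot.mk m (r.comp (C ζ * X)) = AdjoinRoot.mk m (r'.comp (C ζ * X)) := by
    intro r r' h
    rw [AdjoinRoot.mk_eq_mk] at h ⊢
    obtain ⟨t, ht⟩ := h
    refine ⟨t.comp (C ζ * X), ?_⟩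
    rw [← sub_comp, ht, mul_comp, hmcomp]
  have h1 : AdjoinRoot.mk m ((p ^ q).comp (C ζ * X)) = AdjoinRoot.mk m ((C a).comp (C ζ * X)) := by
    apply hsub
    rw [map_pow, hpy, hy, AdjoinRoot.mk_C]
  rw [C_comp, pow_comp, map_pow, AdjoinRoot.mk_C, ← hy] at h1
  set y' := AdjoinRoot.mk m (p.comp (C ζ * X)) with hy'
  by_cases hy0 : y = 0
  · refine ⟨0, 0, ?_⟩
    rw [hy0, zero_pow hq.ne_zero] at hy
    have : AdjoinRoot.of m a = AdjoinRoot.of m 0 := by rw [← hy, map_zero]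
    rw [(AdjoinRoot.of m).injective this, zero_pow hq.ne_zero, mul_zero]
  have hζ' : IsPrimitiveRoot (AdjoinRoot.of m ζ) q := hζ.map_of_injective (AdjoinRoot.of m).injective
  obtain ⟨j, hj, hje⟩ := hζ'.eq_pow_of_pow_eq_one (ξ := y' / y) (by
    rw [div_pow, h1, div_self (pow_ne_zero _ hy0)])
  have h2 : p.comp (C ζ * X) - C (ζ ^ j) * p = 0 := by
    apply hzero
    · refine lt_of_le_of_lt (degree_sub_le _ _) (max_lt ?_ ?_)
      · have : (p.comp (C ζ * X)).degree ≤ p.degree := by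
          rw [degree_le_iff_coeff_zero]
          intro n hn
          rw [comp_C_mul_X_coeff, coeff_eq_zero_of_degree_lt hn, zero_mul]
        exact this.trans_lt hpdeg
      · exact ((degree_mul_le _ _).trans (by
          refine (add_le_add_left degree_C_le _).trans ?_
          rw [zero_add])).trans_lt hpdeg
    · rw [map_sub, map_mul, hpy, ← hy', AdjoinRoot.mk_C, map_pow, hje, div_mul_cancel₀ _ hy0, sub_self]
  have hcoef : ∀ i < q, i ≠ j → p.coeff i = 0 := by
    intro i hi hij
    have := congrArg (fun r => r.coeff i) h2
    simp only [coeff_sub, comp_C_mul_X_coeff, coeff_C_mul, coeff_zero] at this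
    have h3 : p.coeff i * (ζ ^ i - ζ ^ j) = 0 := by linear_combination this
    rcases mul_eq_zero.mp h3 with h | h
    · exact h
    · exact absurd (hζ.pow_inj hi hj (sub_eq_zero.mp h)) hij
  have hpm : p = C (p.coeff j) * X ^ j := by
    ext i
    rw [coeff_C_mul_X_pow]
    split_ifs with h
    · rw [h]
    · by_cases hi : i < q
      · exact hcoef i hi h
      · apply coeff_eq_zero_of_degree_lt
        refine hpdeg.trans_le ?_
        rw [hdeg]
        exact_mod_cast not_lt.mp hi
  refine ⟨j, p.coeff j, ?_⟩
  apply (AdjoinRoot.of m).injective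
  rw [← hy, ← hpy]
  conv_lhs => rw [hpm]
  rw [map_mul, map_pow, AdjoinRoot.mk_C, AdjoinRoot.mk_X, map_mul, map_pow, map_pow, ← hβq, ← hβ]
  ring

lemma exists_cyclo (q : ℕ) (hq : q.Prime) : ∃ (K : Type) (_ : Field K) (_ : NumberField K),
    IsCyclotomicExtension {q} ℚ K := by
  have : NeZero q := ⟨hq.ne_zero⟩
  have : NeZero ((q : ℕ) : ℚ) := ⟨by exact_mod_cast hq.ne_zero⟩
  refine ⟨CyclotomicField q ℚ, inferInstance, inferInstance, ?_⟩
  have h := CyclotomicField.isCyclotomicExtension q ℚ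
  convert h
  · rfl
  · exact Subsingleton.elim _ _

lemma cyclo_base {q : ℕ} (hq : q.Prime) {K : Type} [Field K] [NumberField K]
    [IsCyclotomicExtension {q} ℚ K] (a : ℚ) (y : K)
    (hy : y ^ q = algebraMap ℚ _ a) : ∃ u : ℚ, u ^ q = a := by
  have : NeZero q := ⟨hq.ne_zero⟩
  have : NeZero ((q : ℕ) : ℚ) := ⟨by exact_mod_cast hq.ne_zero⟩
  by_contra hcon
  push Not at hcon
  have hirr : Irreducible (X ^ q - C a) := X_pow_sub_C_irreducible_of_prime hq hcon
  have e3 : X ^ q - C a = minpoly ℚ y := by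
    refine (minpoly.eq_of_irreducible_of_monic hirr ?_ (monic_X_pow_sub_C _ hq.ne_zero))
    simp [hy]
  have hd := minpoly.degree_dvd (K := ℚ) (x := y) (Algebra.IsIntegral.isIntegral y)
  rw [← e3, natDegree_X_pow_sub_C,
    IsCyclotomicExtension.finrank (n := q) K (cyclotomic.irreducible_rat hq.pos),
    Nat.totient_prime hq] at hd
  have := Nat.le_of_dvd (by have := hq.two_le; omega) hd
  have := hq.two_le
  omega

/-- fields with prescribed q-th powers -/
lemma exists_field {q : ℕ} (hq : q.Prime) (H : Subgroup ℚˣ) (hH : ∀ u : ℚˣ, u ^ q ∈ H)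
    (bs : List ℚˣ) : (∀ b ∈ bs, b ∈ H) →
    ∃ (K : Type) (_ : Field K) (_ : NumberField K) (ζ : K), IsPrimitiveRoot ζ q ∧
      (∀ b ∈ bs, ∃ y : K, y ^ q = algebraMap ℚ K b) ∧
      ∀ a : ℚˣ, (∃ y : K, y ^ q = algebraMap ℚ K a) → a ∈ H := by
  induction bs with
  | nil =>
    intro _
    have : NeZero q := ⟨hq.ne_zero⟩
    have : NeZero ((q : ℕ) : ℚ) := ⟨by exact_mod_cast hq.ne_zero⟩
    obtain ⟨K, _, _, _⟩ := exists_cyclo q hq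
    refine ⟨K, inferInstance, inferInstance, _,
      IsCyclotomicExtension.zeta_spec q ℚ K, by simp, ?_⟩
    rintro a ⟨y, hy⟩
    obtain ⟨u, hu⟩ := cyclo_base hq a y hy
    have hu0 : u ≠ 0 := by
      rintro rfl
      rw [zero_pow hq.ne_zero] at hu
      exact a.ne_zero hu.symm
    have : a = (Units.mk0 u hu0) ^ q := by ext; simp [hu]
    rw [this]
    exact hH _
  | cons b bs ih =>
    intro hb
    obtain ⟨K, _, _, ζ, hζ, h1, h2⟩ := ih (fun b' hb' => hb b' (List.mem_cons_of_mem _ hb'))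
    by_cases hbp : ∃ y : K, y ^ q = algebraMap ℚ K b
    · refine ⟨K, _, ‹_›, ζ, hζ, ?_, h2⟩
      intro b' hb'
      rcases List.mem_cons.mp hb' with rfl | h
      · exact hbp
      · exact h1 b' h
    push Not at hbp
    obtain ⟨m, hm⟩ : ∃ m : K[X], m = X ^ q - C (algebraMap ℚ K b) := ⟨_, rfl⟩
    have hirr : Irreducible m := hm ▸ X_pow_sub_C_irreducible_of_prime hq hbp
    have : Fact (Irreducible m) := ⟨hirr⟩
    have : CharZero (AdjoinRoot m) :=
      charZero_of_injective_algebraMap (algebraMap K _).injective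
    have hfin : Module.Finite K (AdjoinRoot m) :=
      Monic.finite_adjoinRoot (hm ▸ monic_X_pow_sub_C _ hq.ne_zero)
    have hnf : NumberField (AdjoinRoot m) :=
      { to_finiteDimensional := Module.Finite.trans K _ }
    have halg : ∀ x : ℚ, algebraMap ℚ (AdjoinRoot m) x
        = AdjoinRoot.of m (algebraMap ℚ K x) := by
      intro x
      exact RingHom.congr_fun (Subsingleton.elim (algebraMap ℚ (AdjoinRoot m))
        ((AdjoinRoot.of m).comp (algebraMap ℚ K))) x
    refine ⟨AdjoinRoot m, inferInstance, hnf, AdjoinRoot.of m ζ,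
      hζ.map_of_injective (AdjoinRoot.of m).injective, ?_, ?_⟩
    · intro b' hb'
      rcases List.mem_cons.mp hb' with rfl | h
      · refine ⟨AdjoinRoot.root m, ?_⟩
        have := AdjoinRoot.eval₂_root m
        conv at this => lhs; arg 3; rw [hm]
        rw [eval₂_sub, eval₂_X_pow, eval₂_C] at this
        rw [sub_eq_zero.mp this, halg]
      · obtain ⟨y, hy⟩ := h1 b' h
        exact ⟨AdjoinRoot.of m y, by rw [← map_pow, hy, halg]⟩
    · rintro a ⟨y, hy⟩
      rw [halg] at hy
      obtain ⟨j, c, hjc⟩ := kummer_step hq hζ _ m hm hirr y _ hy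
      have hbH : b ∈ H := hb b List.mem_cons_self
      have h3 : a * (b ^ j)⁻¹ ∈ H := by
        apply h2
        refine ⟨c, ?_⟩
        have hb00 : algebraMap ℚ K b ≠ 0 := by simp
        rw [Units.val_mul, map_mul, hjc, Units.val_inv_eq_inv_val, Units.val_pow_eq_pow_val, map_inv₀, map_pow]
        field_simp
      have : a = a * (b ^ j)⁻¹ * b ^ j := by group
      rw [this]
      exact H.mul_mem h3 (H.pow_mem hbH j)

end Blk


namespace Blk
open NumberField

/-- the character of `ℚˣ` attached to a vector of coefficients -/
noncomputable def chi (q : ℕ) (P : Finset ℕ) (hP : ∀ p ∈ P, p.Prime) (c : ℕ → ZMod q) :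
    ℚˣ →* Multiplicative (ZMod q) where
  toFun u := Multiplicative.ofAdd (∑ p ∈ P, c p * ((padicValRat p (u : ℚ) : ℤ) : ZMod q))
  map_one' := by simp
  map_mul' u v := by
    rw [← ofAdd_add, ← Finset.sum_add_distrib]
    congr 1
    refine Finset.sum_congr rfl ?_
    intro p hp
    have : Fact p.Prime := ⟨hP p hp⟩
    rw [Units.val_mul, padicValRat.mul u.ne_zero v.ne_zero]
    push_cast
    ring

lemma chi_prime (q : ℕ) (P : Finset ℕ) (hP : ∀ p ∈ P, p.Prime) (c : ℕ → ZMod q)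
    (p : ℕ) (hp : p ∈ P) (u : ℚˣ) (hu : (u : ℚ) = p) :
    chi q P hP c u = Multiplicative.ofAdd (c p) := by
  simp only [chi, MonoidHom.coe_mk, OneHom.coe_mk]
  congr 1
  rw [Finset.sum_eq_single p]
  · have : Fact p.Prime := ⟨hP p hp⟩
    rw [hu, padicValRat.of_nat, padicValNat_self]
    simp
  · intro p' hp' hne
    have : Fact p.Prime := ⟨hP p hp⟩
    have : Fact p'.Prime := ⟨hP p' hp'⟩
    rw [hu, padicValRat.of_nat, padicValNat_primes hne]
    simp
  · exact fun h => absurd hp h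

lemma pow_root {F : Type*} [Field F] {q : ℕ} (hq : q.Prime) (u w : F) (hu : u ≠ 0) (e : ℕ)
    (he : ¬ q ∣ e) (h : u ^ e = w ^ q) : ∃ x : F, x ^ q = u := by
  have hw : w ≠ 0 := by
    rintro rfl
    rw [zero_pow hq.ne_zero] at h
    exact pow_ne_zero e hu h
  have hc : Nat.Coprime q e := (Nat.Prime.coprime_iff_not_dvd hq).mpr he
  have hb := Nat.gcd_eq_gcd_ab q e
  rw [hc] at hb
  refine ⟨u ^ (Nat.gcdA q e) * w ^ (Nat.gcdB q e), ?_⟩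
  have h1 : (w ^ (Nat.gcdB q e)) ^ q = (u ^ (e : ℤ)) ^ (Nat.gcdB q e) := by
    rw [zpow_natCast, h, ← zpow_natCast, ← zpow_natCast, ← zpow_mul, ← zpow_mul, mul_comm]
  rw [mul_pow, h1, ← zpow_natCast, ← zpow_mul, ← zpow_mul, ← zpow_add₀ hu, mul_comm (Nat.gcdA q e),
    ← hb]
  simp

theorem nt1 {q : ℕ} (hq : q.Prime) (hodd : Odd q) (P : Finset ℕ) (hP : ∀ p ∈ P, p.Prime)
    (c : ℕ → ZMod q) (D : ℕ) (hD : 0 < D) :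
    ∃ l : ℕ, l.Prime ∧ ¬ l ∣ D ∧ ∀ s : ℤ, s ≠ 0 → s.natAbs.primeFactors ⊆ P →
      (∃ x : ZMod l, x ^ q = s) → ∑ p ∈ P, c p * (s.natAbs.factorization p : ZMod q) = 0 := by
  have hqF : Fact q.Prime := ⟨hq⟩
  by_cases hall : ∀ p ∈ P, c p = 0
  · obtain ⟨l, hl, hlp⟩ := Nat.exists_infinite_primes (D + 1)
    refine ⟨l, hlp, fun h => ?_, ?_⟩
    · have := Nat.le_of_dvd hD h
      omega
    · intro s _ _ _
      exact Finset.sum_eq_zero fun p hp => by rw [hall p hp, zero_mul]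
  push Not at hall
  obtain ⟨p0, hp0, hc0⟩ := hall
  set d : ℕ → ℕ := fun p => (-(c p / c p0)).val with hd
  have hdc : ∀ p, ((d p : ℕ) : ZMod q) * c p0 = - c p := by
    intro p
    rw [hd]
    simp only
    rw [ZMod.natCast_zmod_val, neg_mul, div_mul_cancel₀ _ hc0]
  have hex : ∀ p : ℕ, ∃ u : ℚˣ, p.Prime → (u : ℚ) = p := by
    intro p
    by_cases hp : p.Prime
    · exact ⟨Units.mk0 (p : ℚ) (by exact_mod_cast hp.ne_zero), fun _ => rfl⟩
    · exact ⟨1, fun h => absurd h hp⟩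
  choose U hU using hex
  set b : ℕ → ℚˣ := fun p => U p * U p0 ^ d p with hb
  set H := (chi q P hP c).ker with hH
  obtain ⟨K, _, _, ζ, hζ, h1, h2⟩ := exists_field hq H (by
    intro u
    rw [hH, MonoidHom.mem_ker, map_pow, ← ofAdd_toAdd (chi q P hP c u), ← ofAdd_nsmul]
    simp) (P.toList.map b) (by
    intro x hx
    obtain ⟨p, hp, rfl⟩ := List.mem_map.mp hx
    rw [Finset.mem_toList] at hp
    rw [hH, MonoidHom.mem_ker, hb, map_mul, map_pow, chi_prime q P hP c p hp _ (hU p (hP p hp)),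
      chi_prime q P hP c p0 hp0 _ (hU p0 (hP p0 hp0)), ← ofAdd_nsmul, ← ofAdd_add, nsmul_eq_mul,
      hdc, add_neg_cancel, ofAdd_zero])
  have hp0p := hP p0 hp0
  have hPprod : 0 < ∏ p ∈ P, p := Finset.prod_pos fun p hp => (hP p hp).pos
  obtain ⟨l, hl, hlD, ⟨φ, -⟩, hnp⟩ := nonpower hq hζ (p0 : ℤ) (by exact_mod_cast hp0p.ne_zero) (by
    intro y hy
    have : U p0 ∈ H := h2 (U p0) ⟨y, by rw [hy, hU p0 hp0p]; simp⟩
    rw [hH, MonoidHom.mem_ker, chi_prime q P hP c p0 hp0 _ (hU p0 hp0p)] at this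
    exact hc0 (ofAdd_eq_one.mp this)) (D * ∏ p ∈ P, p) (by positivity)
  have hlF : Fact l.Prime := ⟨hl⟩
  refine ⟨l, hl, fun h => hlD (h.mul_right _), ?_⟩
  have hlP : ∀ p ∈ P, (p : ZMod l) ≠ 0 := by
    intro p hp h
    rw [ZMod.natCast_eq_zero_iff] at h
    exact hlD ((h.trans (Finset.dvd_prod_of_mem _ hp)).mul_left _)
  -- b p is a q-th power modulo l
  have hbl : ∀ p ∈ P, ∃ z : ZMod l, z ^ q = (p : ZMod l) * (p0 : ZMod l) ^ d p := by
    intro p hp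
    obtain ⟨y, hy⟩ := h1 (b p) (List.mem_map.mpr ⟨p, Finset.mem_toList.mpr hp, rfl⟩)
    have hy2 : y ^ q = ((p * p0 ^ d p : ℕ) : K) := by
      rw [hy, hb]
      simp only [Units.val_mul, Units.val_pow_eq_pow_val]
      rw [hU p (hP p hp), hU p0 hp0p]
      simp
    have hyi : IsIntegral ℤ y := by
      refine IsIntegral.of_pow hq.pos ?_
      rw [hy2]
      have := isIntegral_algebraMap (R := ℤ) (A := K) (x := ((p * p0 ^ d p : ℕ) : ℤ))
      rw [map_natCast] at this
      exact this
    obtain ⟨Y, hY⟩ : ∃ Y : 𝓞 K, (Y : K) = y := ⟨⟨y, hyi⟩, rfl⟩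
    refine ⟨φ Y, ?_⟩
    rw [← map_pow]
    have : Y ^ q = ((p * p0 ^ d p : ℕ) : 𝓞 K) := by
      apply RingOfIntegers.ext
      have e1 : algebraMap (𝓞 K) K (Y ^ q) = y ^ q := by rw [map_pow]; exact congrArg (· ^ q) hY
      have e2 : algebraMap (𝓞 K) K ((p * p0 ^ d p : ℕ) : 𝓞 K) = ((p * p0 ^ d p : ℕ) : K) :=
        map_natCast _ _
      exact e1.trans (hy2.trans e2.symm)
    rw [this, map_natCast]
    push_cast
    rfl
  intro s hs0 hsP hsx
  obtain ⟨x, hx⟩ := hsx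
  choose! z hz using hbl
  set v := s.natAbs.factorization with hv
  have hsn : s.natAbs ≠ 0 := Int.natAbs_ne_zero.mpr hs0
  have hprod : ∏ p ∈ P, p ^ v p = s.natAbs := by
    conv_rhs => rw [← Nat.prod_factorization_pow_eq_self hsn]
    symm
    exact Finsupp.prod_of_support_subset _ hsP _ (fun i _ => pow_zero i)
  have hprodl : ∏ p ∈ P, (p : ZMod l) ^ v p = (s.natAbs : ZMod l) := by
    rw [← hprod]; push_cast; rfl
  have hsl : (s.natAbs : ZMod l) ≠ 0 := by
    rw [← hprodl, Finset.prod_ne_zero_iff]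
    exact fun p hp => pow_ne_zero _ (hlP p hp)
  obtain ⟨x', hx'⟩ : ∃ x' : ZMod l, x' ^ q = (s.natAbs : ZMod l) := by
    rcases Int.natAbs_eq s with h | h
    · refine ⟨x, ?_⟩
      rw [hx]
      conv_lhs => rw [h]
      simp
    · refine ⟨-x, ?_⟩
      rw [hodd.neg_pow, hx]
      conv_lhs => rw [h]
      simp
  have hx'0 : x' ≠ 0 := by
    rintro rfl
    rw [zero_pow hq.ne_zero] at hx'
    exact hsl hx'.symm
  set e := ∑ p ∈ P, d p * v p with he
  have hzz : (p0 : ZMod l) ^ e = ((∏ p ∈ P, z p ^ v p) / x') ^ q := by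
    rw [div_pow, hx', eq_div_iff hsl, ← hprodl, ← Finset.prod_pow, he, ← Finset.prod_pow_eq_pow_sum,
      ← Finset.prod_mul_distrib]
    refine Finset.prod_congr rfl ?_
    intro p hp
    rw [← pow_mul (z p), mul_comm (v p) q, pow_mul (z p), hz p hp, mul_pow, ← pow_mul]
    ring
  have hqe : q ∣ e := by
    by_contra hqe
    obtain ⟨w, hw⟩ := pow_root hq _ _ (hlP p0 hp0) e hqe hzz
    exact hnp ⟨w, by rw [hw]; simp⟩
  have he0 : ((e : ℕ) : ZMod q) = 0 := (ZMod.natCast_eq_zero_iff _ _).mpr hqe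
  have : ∑ p ∈ P, c p * (v p : ZMod q) = - (((e : ℕ) : ZMod q) * c p0) := by
    rw [he]
    push_cast
    rw [Finset.sum_mul, ← Finset.sum_neg_distrib]
    refine Finset.sum_congr rfl ?_
    intro p _
    have := hdc p
    linear_combination (v p : ZMod q) * this
  rw [this, he0, zero_mul, neg_zero]

end Blk


namespace Blk

lemma pow_root_group {G : Type*} [CommGroup G] {q n : ℕ} (hc : Nat.Coprime q n) (u w : G)
    (h : u ^ n = w ^ q) : ∃ x : G, x ^ q = u := by
  have hb := Nat.gcd_eq_gcd_ab q n
  rw [hc] at hb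
  refine ⟨u ^ (Nat.gcdA q n) * w ^ (Nat.gcdB q n), ?_⟩
  have h1 : (w ^ (Nat.gcdB q n)) ^ q = (u ^ (n : ℤ)) ^ (Nat.gcdB q n) := by
    rw [zpow_natCast, h, ← zpow_natCast, ← zpow_natCast, ← zpow_mul, ← zpow_mul, mul_comm]
  rw [mul_pow, h1, ← zpow_natCast, ← zpow_mul, ← zpow_mul, ← zpow_add, mul_comm (Nat.gcdA q n),
    ← hb]
  simp

lemma prime_pow_lift {q l : ℕ} (hq : q.Prime) (hl : l.Prime) (hlq : l ≠ q) (s : ℤ)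
    (hls : ¬ (l : ℤ) ∣ s) (x : ℤ) (hx : (l : ℤ) ∣ x ^ q - s) (e : ℕ) :
    ∃ y : ℤ, ((l ^ e : ℕ) : ℤ) ∣ y ^ q - s := by
  rcases Nat.eq_zero_or_pos e with rfl | he
  · exact ⟨0, by simp⟩
  obtain ⟨k, rfl⟩ : ∃ k, e = k + 1 := ⟨e - 1, by omega⟩
  have h1 := dvd_sub_pow_of_dvd_sub hx k
  have h2 : ((x : ZMod (l ^ (k + 1))) ^ q) ^ l ^ k = (s : ZMod (l ^ (k + 1))) ^ l ^ k := by
    have h3 := (ZMod.intCast_zmod_eq_zero_iff_dvd ((x ^ q) ^ l ^ k - s ^ l ^ k) (l ^ (k + 1))).mpr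
      (by push_cast; exact h1)
    push_cast at h3
    exact sub_eq_zero.mp h3
  have hsu : IsUnit (s : ZMod (l ^ (k + 1))) := by
    rw [ZMod.coe_int_isUnit_iff_isCoprime]
    push_cast
    apply IsCoprime.pow_left
    exact (Nat.prime_iff_prime_int.mp hl).coprime_iff_not_dvd.mpr hls
  have hxu : IsUnit (x : ZMod (l ^ (k + 1))) := by
    have : IsUnit (((x : ZMod (l ^ (k + 1))) ^ q) ^ l ^ k) := by rw [h2]; exact hsu.pow _
    rw [isUnit_pow_iff (pow_ne_zero _ hl.ne_zero), isUnit_pow_iff hq.ne_zero] at this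
    exact this
  obtain ⟨u, hu⟩ := hsu
  obtain ⟨w, hw⟩ := hxu
  obtain ⟨y, hy⟩ := pow_root_group (q := q) (n := l ^ k) (u := u) (w := w ^ l ^ k)
    ((Nat.coprime_primes hq hl).mpr (Ne.symm hlq) |>.pow_right k) (by
      ext
      push_cast
      rw [hu, hw, ← h2]
      ring)
  have : NeZero (l ^ (k + 1)) := ⟨pow_ne_zero _ hl.ne_zero⟩
  refine ⟨((y : ZMod (l ^ (k + 1))).val : ℤ), ?_⟩
  rw [← ZMod.intCast_zmod_eq_zero_iff_dvd]
  push_cast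
  rw [ZMod.natCast_zmod_val, ← hu, ← hy]
  simp

lemma crt {q : ℕ} (s : ℤ) (N : ℕ) : 0 < N →
    (∀ l : ℕ, l.Prime → l ∣ N → ∀ e : ℕ, ∃ y : ℤ, ((l ^ e : ℕ) : ℤ) ∣ y ^ q - s) →
    ∃ y : ℤ, (N : ℤ) ∣ y ^ q - s := by
  induction N using Nat.recOnPosPrimePosCoprime with
  | prime_pow p n hp hn =>
    intro _ h
    exact h p hp (dvd_pow_self p hn.ne') n
  | zero => intro h; exact absurd h (lt_irrefl 0)
  | one => intro _ _; exact ⟨0, by simp⟩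
  | coprime a b ha hb hab iha ihb =>
    intro _ h
    obtain ⟨x, hx⟩ := iha (by omega) (fun l hl hd => h l hl (hd.mul_right _))
    obtain ⟨y, hy⟩ := ihb (by omega) (fun l hl hd => h l hl (hd.mul_left _))
    obtain ⟨u, v, huv⟩ := Nat.isCoprime_iff_coprime.mpr hab
    refine ⟨y * (u * a) + x * (v * b), ?_⟩
    push_cast
    apply (Nat.isCoprime_iff_coprime.mpr hab).mul_dvd
    · have h1 : (a : ℤ) ∣ (y * (u * a) + x * (v * b)) - x := ⟨(y - x) * u, by linear_combination x * huv⟩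
      have h2 := h1.trans (sub_dvd_pow_sub_pow _ _ q)
      have := dvd_add h2 hx
      simpa using this
    · have h1 : (b : ℤ) ∣ (y * (u * a) + x * (v * b)) - y := ⟨(x - y) * v, by linear_combination y * huv⟩
      have h2 := h1.trans (sub_dvd_pow_sub_pow _ _ q)
      have := dvd_add h2 hy
      simpa using this

lemma natAbs_prod (P : Finset ℕ) (s : ℤ) (hs : s ≠ 0) (hsP : s.natAbs.primeFactors ⊆ P) :
    ∏ p ∈ P, p ^ s.natAbs.factorization p = s.natAbs := by
  have hsn : s.natAbs ≠ 0 := Int.natAbs_ne_zero.mpr hs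
  conv_rhs => rw [← Nat.prod_factorization_pow_eq_self hsn]
  symm
  exact Finsupp.prod_of_support_subset _ hsP _ (fun i _ => pow_zero i)

lemma local_functional {q : ℕ} (hodd : Odd q) (P : Finset ℕ) (hP : ∀ p ∈ P, p.Prime)
    (l : ℕ) (hl : l.Prime) :
    ∃ c : ℕ → ZMod q, ∀ s : ℤ, s ≠ 0 → s.natAbs.primeFactors ⊆ P → ¬ (l : ℤ) ∣ s →
      ∑ p ∈ P, c p * (s.natAbs.factorization p : ZMod q) = 0 → ∃ x : ℤ, (l : ℤ) ∣ x ^ q - s := by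
  have : Fact l.Prime := ⟨hl⟩
  obtain ⟨g, hg⟩ := IsCyclic.exists_monoid_generator (α := (ZMod l)ˣ)
  have hex : ∀ p : ℕ, ∃ a : ℕ, (p : ZMod l) ≠ 0 → (g : ZMod l) ^ a = p := by
    intro p
    by_cases hp : (p : ZMod l) = 0
    · exact ⟨0, fun h => absurd hp h⟩
    · obtain ⟨a, ha⟩ := Submonoid.mem_powers_iff _ _ |>.mp (hg (Units.mk0 _ hp))
      refine ⟨a, fun _ => ?_⟩
      have := congrArg (fun u : (ZMod l)ˣ => (u : ZMod l)) ha
      simpa using this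
  choose a ha using hex
  refine ⟨fun p => (a p : ZMod q), ?_⟩
  intro s hs hsP hls hsum
  have hprod := natAbs_prod P s hs hsP
  set v := s.natAbs.factorization with hv
  have hsl : ∏ p ∈ P, (p : ZMod l) ^ v p = (s.natAbs : ZMod l) := by
    rw [← hprod]; push_cast; rfl
  have hsl2 : (s.natAbs : ZMod l) = (g : ZMod l) ^ (∑ p ∈ P, a p * v p) := by
    rw [← hsl, ← Finset.prod_pow_eq_pow_sum]
    refine Finset.prod_congr rfl ?_
    intro p hp
    by_cases h0 : (p : ZMod l) = 0
    · rw [ZMod.natCast_eq_zero_iff] at h0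
      have : p = l := ((Nat.prime_dvd_prime_iff_eq hl (hP p hp)).mp h0).symm
      have : v p = 0 := by
        rw [hv, this]
        apply Nat.factorization_eq_zero_of_not_dvd
        intro hd
        exact hls (Int.natCast_dvd.mpr hd)
      rw [this]
      simp
    · rw [← ha p h0, pow_mul]
  have hq : q ∣ ∑ p ∈ P, a p * v p := by
    rw [← ZMod.natCast_eq_zero_iff]
    push_cast
    exact hsum
  obtain ⟨t, ht⟩ := hq
  have key : ∃ x : ZMod l, x ^ q = (s : ZMod l) := by
    have h1 : ((g : ZMod l) ^ t) ^ q = (s.natAbs : ZMod l) := by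
      rw [hsl2, ht, ← pow_mul, mul_comm]
    rcases Int.natAbs_eq s with h | h
    · refine ⟨(g : ZMod l) ^ t, ?_⟩
      rw [h1]
      conv_rhs => rw [h]
      simp
    · refine ⟨-(g : ZMod l) ^ t, ?_⟩
      rw [hodd.neg_pow, h1]
      conv_rhs => rw [h]
      simp
  obtain ⟨x, hx⟩ := key
  refine ⟨(x.val : ℤ), ?_⟩
  rw [← ZMod.intCast_zmod_eq_zero_iff_dvd]
  push_cast
  rw [ZMod.natCast_zmod_val, hx, sub_self]

/-- vector of valuations -/
def vec (q : ℕ) (P : Finset ℕ) (s : ℤ) : P → ZMod q := fun p => (s.natAbs.factorization p : ZMod q)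

lemma vec_ne_zero {q : ℕ} (hq : q.Prime) (hodd : Odd q) (P : Finset ℕ) (s : ℤ)
    (hs : s ≠ 0) (hsP : s.natAbs.primeFactors ⊆ P) (hnp : ¬ ∃ r : ℤ, r ^ q = s) : vec q P s ≠ 0 := by
  intro h0
  apply hnp
  have hprod := natAbs_prod P s hs hsP
  have hd : ∀ p ∈ P, q ∣ s.natAbs.factorization p := by
    intro p hp
    have := congrFun h0 ⟨p, hp⟩
    exact (ZMod.natCast_eq_zero_iff _ _).mp this
  have hr : (∏ p ∈ P, p ^ (s.natAbs.factorization p / q)) ^ q = s.natAbs := by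
    conv_rhs => rw [← hprod]
    rw [← Finset.prod_pow]
    refine Finset.prod_congr rfl ?_
    intro p hp
    rw [← pow_mul, Nat.div_mul_cancel (hd p hp)]
  set r := ∏ p ∈ P, p ^ (s.natAbs.factorization p / q) with hrdef
  have hr2 : (r : ℤ) ^ q = (s.natAbs : ℤ) := by exact_mod_cast hr
  rcases Int.natAbs_eq s with h | h
  · exact ⟨r, by rw [hr2, ← h]⟩
  · exact ⟨-r, by rw [hodd.neg_pow, hr2, ← h]⟩

end Blk


namespace Blk

/-- linear functional attached to coefficients -/
noncomputable def lin (q : ℕ) (P : Finset ℕ) (c : ℕ → ZMod q) : (P → ZMod q) →ₗ[ZMod q] ZMod q :=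
  ∑ p : P, c p • LinearMap.proj p

lemma lin_vec (q : ℕ) (P : Finset ℕ) (c : ℕ → ZMod q) (s : ℤ) :
    lin q P c (vec q P s) = ∑ p ∈ P, c p * (s.natAbs.factorization p : ZMod q) := by
  simp only [lin, LinearMap.sum_apply, LinearMap.smul_apply, LinearMap.proj_apply, smul_eq_mul, vec]
  exact Finset.sum_coe_sort P (fun p => c p * (s.natAbs.factorization p : ZMod q))

lemma exists_lin (q : ℕ) (P : Finset ℕ) (g : (P → ZMod q) →ₗ[ZMod q] ZMod q) :
    ∃ c : ℕ → ZMod q, g = lin q P c := by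
  classical
  refine ⟨fun p => if h : p ∈ P then g (Pi.single ⟨p, h⟩ 1) else 0, ?_⟩
  refine LinearMap.pi_ext' ?_
  intro i
  refine LinearMap.ext_ring ?_
  simp only [lin, LinearMap.comp_apply, LinearMap.sum_apply, LinearMap.smul_apply,
    LinearMap.proj_apply, smul_eq_mul, LinearMap.single_apply]
  rw [Finset.sum_eq_single i]
  · simp
  · intro b _ hb
    simp [Pi.single_eq_of_ne hb]
  · simp

lemma nt2 {q k : ℕ} (hq : q.Prime) (hodd : Odd q) (P : Finset ℕ) (hP : ∀ p ∈ P, p.Prime)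
    (S : Finset ℤ) (hS : ∀ s ∈ S, s ≠ 0 ∧ s.natAbs.primeFactors ⊆ P)
    (hb : ∀ g : Fin k → ((P → ZMod q) →ₗ[ZMod q] ZMod q), ∃ s ∈ S, ∀ j, g j (vec q P s) = 0) :
    MemT q k (S : Set ℤ) := by
  classical
  have hc : ∀ l : ℕ, ∃ c : ℕ → ZMod q, l.Prime → ∀ s : ℤ, s ≠ 0 → s.natAbs.primeFactors ⊆ P →
      ¬ (l : ℤ) ∣ s → ∑ p ∈ P, c p * (s.natAbs.factorization p : ZMod q) = 0 →
      ∃ x : ℤ, (l : ℤ) ∣ x ^ q - s := by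
    intro l
    by_cases hl : l.Prime
    · obtain ⟨c, hc⟩ := local_functional hodd P hP l hl
      exact ⟨c, fun _ => hc⟩
    · exact ⟨0, fun h => absurd h hl⟩
  choose c hc using hc
  refine ⟨q * ∏ s ∈ S, s.natAbs, ?_, ?_⟩
  · exact Nat.mul_pos hq.pos (Finset.prod_pos fun s hs => Int.natAbs_pos.mpr (hS s hs).1)
  intro N hN hlen hcop
  obtain ⟨s, hs, hg⟩ := hb (fun j => if h : (j : ℕ) < N.primeFactorsList.length then
    lin q P (c (N.primeFactorsList[(j : ℕ)])) else 0)
  refine ⟨s, hs, crt s N hN ?_⟩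
  intro l hl hlN e
  have hlD : ¬ l ∣ q * ∏ s ∈ S, s.natAbs := by
    intro h
    have := Nat.dvd_gcd hlN h
    rw [hcop] at this
    exact hl.one_lt.ne' (Nat.dvd_one.mp this)
  have hlq : l ≠ q := by
    rintro rfl
    exact hlD (dvd_mul_right _ _)
  have hls : ¬ (l : ℤ) ∣ s := by
    intro h
    exact hlD (((Int.natCast_dvd.mp h).trans (Finset.dvd_prod_of_mem (fun s : ℤ => s.natAbs) hs)).trans
      (dvd_mul_left _ _))
  have hmem : l ∈ N.primeFactorsList := (Nat.mem_primeFactorsList hN.ne').mpr ⟨hl, hlN⟩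
  obtain ⟨j, hj, hjl⟩ := List.mem_iff_getElem.mp hmem
  have h1 := hg ⟨j, lt_of_lt_of_le hj hlen⟩
  simp only [hj, dite_true, hjl] at h1
  rw [lin_vec] at h1
  obtain ⟨x, hx⟩ := hc l hl s (hS s hs).1 (hS s hs).2 hls h1
  exact prime_pow_lift hq hl hlq s hls x hx e

lemma nt1' {q : ℕ} (hq : q.Prime) (hodd : Odd q) (P : Finset ℕ) (hP : ∀ p ∈ P, p.Prime)
    (D : ℕ) (hD : 0 < D) : ∀ (n : ℕ) (g : Fin n → ((P → ZMod q) →ₗ[ZMod q] ZMod q)),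
    ∃ N : ℕ, 0 < N ∧ N.primeFactorsList.length ≤ n ∧ Nat.Coprime N D ∧
      ∀ s : ℤ, s ≠ 0 → s.natAbs.primeFactors ⊆ P → ∀ x : ℤ, (N : ℤ) ∣ x ^ q - s →
        ∀ j, g j (vec q P s) = 0 := by
  intro n
  induction n with
  | zero =>
    intro g
    exact ⟨1, one_pos, by simp, by simp, fun s _ _ x _ j => j.elim0⟩
  | succ n ih =>
    intro g
    obtain ⟨N, hN, hlen, hcop, h⟩ := ih (fun j => g j.succ)
    obtain ⟨c, hc⟩ := exists_lin q P (g 0)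
    obtain ⟨l, hl, hlD, hls⟩ := nt1 hq hodd P hP c D hD
    refine ⟨l * N, Nat.mul_pos hl.pos hN, ?_, ?_, ?_⟩
    · rw [(Nat.perm_primeFactorsList_mul hl.ne_zero hN.ne').length_eq, List.length_append,
        Nat.primeFactorsList_prime hl]
      simp
      omega
    · exact Nat.Coprime.mul_left ((Nat.Prime.coprime_iff_not_dvd hl).mpr hlD) hcop
    · intro s hs hsP x hx j
      push_cast at hx
      refine Fin.cases ?_ ?_ j
      · rw [hc, lin_vec]
        apply hls s hs hsP
        refine ⟨(x : ZMod l), ?_⟩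
        have := (ZMod.intCast_zmod_eq_zero_iff_dvd _ l).mpr ((dvd_mul_right _ _).trans hx)
        push_cast at this
        exact sub_eq_zero.mp this
      · intro i
        exact h s hs hsP x ((dvd_mul_left _ _).trans hx) i

lemma common_zero {q : ℕ} [Fact q.Prime] {V : Type*} [AddCommGroup V] [Module (ZMod q) V]
    [Module.Finite (ZMod q) V] (W : Submodule (ZMod q) V) (k : ℕ)
    (hW : Module.finrank (ZMod q) W = k + 1) (g : Fin k → (V →ₗ[ZMod q] ZMod q)) :
    ∃ w : W, w ≠ 0 ∧ ∀ j, g j w = 0 := by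
  have h := LinearMap.ker_ne_bot_of_finrank_lt
    (f := (LinearMap.pi fun j => (g j).comp W.subtype : W →ₗ[ZMod q] (Fin k → ZMod q)))
    (by rw [hW, Module.finrank_fin_fun]; omega)
  obtain ⟨w, hw, hw0⟩ := (Submodule.ne_bot_iff _).mp h
  refine ⟨w, hw0, fun j => ?_⟩
  exact congrFun (LinearMap.mem_ker.mp hw) j

end Blk

theorem stmt14 (q k : ℕ) (hq : q.Prime) (hodd : Odd q) (hk : 1 ≤ k)
    (S : Finset ℤ) (hSpow : ∀ s ∈ S, ¬ IsPerfectPow q s)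
    (hS : MemT q k ↑S) (hmin : ∀ T : Finset ℤ, T ⊂ S → ¬ MemT q k ↑T) :
    (∑ i ∈ Finset.range (k + 1), q ^ i) < S.card ↔
      (∑ i ∈ Finset.range (k + 1), q ^ i) + q ^ (k - 1) * ((q + 1) / 2) ≤ S.card := by
  classical
  have hfact : Fact q.Prime := ⟨hq⟩
  have hq2 : 2 ≤ q := hq.two_le
  constructor
  swap
  · intro h
    have h1 : 0 < q ^ (k - 1) * ((q + 1) / 2) :=
      Nat.mul_pos (pow_pos hq.pos _) (by omega)
    omega
  intro hgt
  by_contra hlt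
  push Not at hlt
  let P : Finset ℕ := S.biUnion fun s => s.natAbs.primeFactors
  have hP : ∀ p ∈ P, p.Prime := by
    intro p hp
    obtain ⟨s, _, h⟩ := Finset.mem_biUnion.mp hp
    exact Nat.prime_of_mem_primeFactors h
  have hSP : ∀ s ∈ S, s ≠ 0 ∧ s.natAbs.primeFactors ⊆ P := by
    intro s hs
    refine ⟨?_, Finset.subset_biUnion_of_mem (fun s : ℤ => s.natAbs.primeFactors) hs⟩
    rintro rfl
    exact hSpow 0 hs ⟨0, zero_pow hq.ne_zero⟩
  have hbl : ∀ g : Fin k → ((P → ZMod q) →ₗ[ZMod q] ZMod q),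
      ∃ i ∈ S, ∀ j, g j (Blk.vec q P i) = 0 := by
    intro g
    obtain ⟨D, hD, h⟩ := hS
    obtain ⟨N, hN, hlen, hcop, h2⟩ := Blk.nt1' hq hodd P hP D hD k g
    obtain ⟨s, hs, x, hx⟩ := h N hN hlen hcop
    have hs' : s ∈ S := hs
    exact ⟨s, hs', h2 s (hSP s hs').1 (hSP s hs').2 x hx⟩
  have hcard : 2 * q * S.card < 2 * q * (∑ i ∈ Finset.range (k + 1), q ^ i) + q ^ k * (q + 1) := by
    obtain ⟨m, hm⟩ := hodd
    obtain ⟨k', rfl⟩ : ∃ k', k = k' + 1 := ⟨k - 1, by omega⟩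
    have h1 : (q + 1) / 2 = m + 1 := by omega
    have h2 : q + 1 = 2 * (m + 1) := by omega
    rw [h1, Nat.add_sub_cancel] at hlt
    have h3 := Nat.mul_lt_mul_of_pos_left hlt (show 0 < 2 * q by omega)
    calc _ < _ := h3
      _ = _ := by rw [h2, pow_succ]; ring
  obtain ⟨W, hW, hWS⟩ := Blk.blocking hodd (Blk.vec q P) k S
    (fun s hs => Blk.vec_ne_zero hq hodd P s (hSP s hs).1 (hSP s hs).2 (hSpow s hs)) hbl hcard
  have hfin : Finite (ZMod q) := inferInstance
  have hex : ∀ pt : Projectivization (ZMod q) W, ∃ s ∈ S, ∃ c : ZMod q, c ≠ 0 ∧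
      Blk.vec q P s = c • (pt.rep : P → ZMod q) := by
    intro pt
    refine hWS _ pt.rep.2 ?_
    intro h
    exact pt.rep_nonzero (Subtype.ext h)
  choose f hfS cf hcf hf using hex
  have : Finite (Projectivization (ZMod q) W) := by
    have : Finite W := inferInstance
    infer_instance
  have := Fintype.ofFinite (Projectivization (ZMod q) W)
  let T : Finset ℤ := Finset.univ.image f
  have hTS : T ⊆ S := by
    intro s hs
    obtain ⟨pt, _, rfl⟩ := Finset.mem_image.mp hs
    exact hfS pt
  have hTc : T.card ≤ ∑ i ∈ Finset.range (k + 1), q ^ i := by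
    calc T.card ≤ Fintype.card (Projectivization (ZMod q) W) := Finset.card_image_le
      _ = ∑ i ∈ Finset.range (k + 1), q ^ i := by
        rw [← Nat.card_eq_fintype_card, Projectivization.card_of_finrank (ZMod q) W hW,
          Nat.card_zmod]
  have hTM : MemT q k (T : Set ℤ) := by
    refine Blk.nt2 hq hodd P hP T (fun s hs => hSP s (hTS hs)) ?_
    intro g
    obtain ⟨w, hw0, hw⟩ := Blk.common_zero W k hW g
    refine ⟨f (Projectivization.mk (ZMod q) w hw0),
      Finset.mem_image_of_mem _ (Finset.mem_univ _), fun j => ?_⟩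
    obtain ⟨a, ha⟩ := Projectivization.exists_smul_eq_mk_rep (ZMod q) w hw0
    rw [hf, ← ha, map_smul]
    have : g j ((a • w : W) : P → ZMod q) = 0 := by
      have h5 : ((a • w : W) : P → ZMod q) = (a : ZMod q) • (w : P → ZMod q) := rfl
      rw [h5, map_smul, hw j, smul_zero]
    rw [this, smul_zero]
  rcases hTS.eq_or_ssubset with h | h
  · rw [h] at hTc
    omega
  · exact hmin T h hTM
end

section
/- Let q be an odd prime, k ≥ 2, and n ≥ k + 2. Let 𝒮 ⊆ PG(F_q^n) be the union of: (i) the points ⟨(0, 1, −s, α_4, …, α_{k+2}, 0, …, 0)⟩, ⟨(−s, 0, 1, α_4, …, α_{k+2}, 0, …, 0)⟩ and ⟨(1, −s, 0, α_4, …, α_{k+2}, 0, …, 0)⟩ for all s ∈ Q_0 and all α_4, …, α_{k+2} ∈ F_q; and (ii) all points spanned by nonzero vectors of the subspace W = span(e_4, …, e_{k+2}), where e_i are the standard basis vectors of F_q^n. Then 𝒮 is a k-blocking set of PG(F_q^n), no proper subset of 𝒮 is a k-blocking set of PG(F_q^n), and |𝒮| = (q^{k+1} − 1)/(q − 1) +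 q^{k−1}·(q + 1)/2. -/
open Finset

/-- The vector `(a, b, c, α_4, …, α_{k+2}, 0, …, 0) ∈ F_q^n` (indices are `0`-based, so the
entries `α` occupy positions `3, …, k+1`). -/
def coneVec (q n k : ℕ) (a b c : ZMod q) (α : ℕ → ZMod q) : Fin n → ZMod q :=
  fun i => if (i : ℕ) = 0 then a else if (i : ℕ) = 1 then b else if (i : ℕ) = 2 then c
    else if (i : ℕ) ≤ k + 1 then α (i : ℕ) else 0

/-- The subspace `W = span(e_4, …, e_{k+2})` (standard basis vectors at the `0`-based
positions `3, …, k+1`). -/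
def coneW (q n k : ℕ) : Submodule (ZMod q) (Fin n → ZMod q) :=
  Submodule.span (ZMod q)
    {v | ∃ j : Fin n, 3 ≤ (j : ℕ) ∧ (j : ℕ) ≤ k + 1 ∧ v = Pi.single j (1 : ZMod q)}

/-- The cone with vertex `PG(W)` and base the projective triangle: the set of points
`⟨(0,1,-s,α_4,…,α_{k+2},0,…,0)⟩, ⟨(-s,0,1,α_4,…,α_{k+2},0,…,0)⟩, ⟨(1,-s,0,α_4,…,α_{k+2},0,…,0)⟩`
for `s ∈ Q_0` and `α_i ∈ F_q`, together with the points of `PG(W)`. -/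
def coneSet (q n k : ℕ) : Set (Submodule (ZMod q) (Fin n → ZMod q)) :=
  {P | ∃ s ∈ Q0 q, ∃ α : ℕ → ZMod q,
      P = projPoint (coneVec q n k 0 1 (-s) α) ∨
      P = projPoint (coneVec q n k (-s) 0 1 α) ∨
      P = projPoint (coneVec q n k 1 (-s) 0 α)} ∪
    {P | ∃ v ∈ coneW q n k, v ≠ 0 ∧ P = projPoint v}

lemma mem_Q0_iff {q : ℕ} [Fact q.Prime] (x : ZMod q) : x ∈ Q0 q ↔ IsSquare x := by
  constructor
  · rintro (⟨a, -, rfl⟩ | rfl)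
    · exact ⟨a, by ring⟩
    · exact ⟨0, by simp⟩
  · rintro ⟨a, rfl⟩
    by_cases ha : a = 0
    · right; simp [ha]
    · left; exact ⟨a, ha, by ring⟩

/-- Vectors on the projective triangle. -/
def TriVec (q : ℕ) (x y z : ZMod q) : Prop :=
  ∃ c : ZMod q, c ≠ 0 ∧ ∃ s : ZMod q, IsSquare s ∧
    ((x = 0 ∧ y = c ∧ z = c * -s) ∨ (x = c * -s ∧ y = 0 ∧ z = c) ∨ (x = c ∧ y = c * -s ∧ z = 0))

lemma mem_coneW_iff {q n k : ℕ} [Fact q.Prime] (v : Fin n → ZMod q) :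
    v ∈ coneW q n k ↔ ∀ i : Fin n, ((i : ℕ) < 3 ∨ k + 1 < (i : ℕ)) → v i = 0 := by
  constructor
  · intro h
    unfold coneW at h
    induction h using Submodule.span_induction with
    | mem x hx =>
      obtain ⟨j, h1, h2, rfl⟩ := hx
      intro i hi
      rw [Pi.single_apply, if_neg]
      rintro rfl
      omega
    | zero => simp
    | add x y _ _ hx hy => intro i hi; simp [hx i hi, hy i hi]
    | smul a x _ hx => intro i hi; simp [hx i hi]
  · intro h
    rw [pi_eq_sum_univ' v]
    refine Submodule.sum_mem _ fun i _ => ?_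
    by_cases hi : (i : ℕ) < 3 ∨ k + 1 < (i : ℕ)
    · rw [h i hi]; simp
    · refine Submodule.smul_mem _ _ (Submodule.subset_span ⟨i, by omega, by omega, ?_⟩)
      ext j
      simp [Pi.single_apply, eq_comm]

lemma projPoint_eq_iff {q n : ℕ} [Fact q.Prime] (v w : Fin n → ZMod q) :
    projPoint v = projPoint w ↔ ∃ c : ZMod q, c ≠ 0 ∧ v = c • w := by
  unfold projPoint
  rw [eq_comm, Submodule.span_singleton_eq_span_singleton]
  constructor
  · rintro ⟨z, hz⟩
    exact ⟨z, z.ne_zero, hz.symm⟩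
  · rintro ⟨c, hc, h⟩
    exact ⟨Units.mk0 c hc, h.symm⟩

lemma projPoint_mem_iff {q n k : ℕ} [Fact q.Prime] (hn : 3 ≤ n) (v : Fin n → ZMod q) (hv : v ≠ 0) :
    projPoint v ∈ coneSet q n k ↔ (∀ i : Fin n, 2 < (i : ℕ) → k + 1 < (i : ℕ) → v i = 0) ∧
      ((v ⟨0, by omega⟩ = 0 ∧ v ⟨1, by omega⟩ = 0 ∧ v ⟨2, by omega⟩ = 0) ∨
        TriVec q (v ⟨0, by omega⟩) (v ⟨1, by omega⟩) (v ⟨2, by omega⟩)) := by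
  constructor
  · rintro (⟨s, hs, α, h⟩ | ⟨w, hw, hw0, h⟩)
    · rw [mem_Q0_iff] at hs
      simp only [projPoint_eq_iff] at h
      rcases h with ⟨c, hc, rfl⟩ | ⟨c, hc, rfl⟩ | ⟨c, hc, rfl⟩
      all_goals
        refine ⟨?_, Or.inr ⟨c, hc, s, hs, ?_⟩⟩
        · intro i h2 hi
          have h0 : (i : ℕ) ≠ 0 := by omega
          have h1 : (i : ℕ) ≠ 1 := by omega
          have h2 : (i : ℕ) ≠ 2 := by omega
          have h3 : ¬ (i : ℕ) ≤ k + 1 := by omega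
          simp [coneVec, h0, h1, h2, h3]
        · simp [coneVec]
    · rw [projPoint_eq_iff] at h
      obtain ⟨c, hc, rfl⟩ := h
      rw [mem_coneW_iff] at hw
      refine ⟨fun i _ hi => by simp [hw i (Or.inr hi)], Or.inl ⟨?_, ?_, ?_⟩⟩
      all_goals simp only [Pi.smul_apply, smul_eq_mul, mul_eq_zero]; right; exact hw _ (by simp)
  · rintro ⟨h1, h2 | ⟨c, hc, s, hs, h⟩⟩
    · right
      refine ⟨v, ?_, hv, rfl⟩
      rw [mem_coneW_iff]
      rintro ⟨i, hi⟩ h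
      by_cases h3 : 2 < i
      · exact h1 _ h3 (show k + 1 < i by simp only at h; omega)
      · have : i = 0 ∨ i = 1 ∨ i = 2 := by omega
        rcases this with rfl | rfl | rfl
        exacts [h2.1, h2.2.1, h2.2.2]
    · left
      refine ⟨s, (mem_Q0_iff s).2 hs, fun i => if h : i < n then c⁻¹ * v ⟨i, h⟩ else 0, ?_⟩
      simp only [projPoint_eq_iff]
      rcases h with h | h | h
      · left
        refine ⟨c, hc, ?_⟩
        ext ⟨i, hi⟩
        rcases i with _ | _ | _ | i
        · simpa [coneVec] using h.1
        · simpa [coneVec] using h.2.1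
        · simpa [coneVec] using h.2.2
        · by_cases hik : i + 3 ≤ k + 1
          · simp [coneVec, hik, hi, hc]
          · simp only [Pi.smul_apply, coneVec]
            simp [hik, h1 ⟨i + 3, hi⟩ (by simp) (by simp; omega)]
      · right; left
        refine ⟨c, hc, ?_⟩
        ext ⟨i, hi⟩
        rcases i with _ | _ | _ | i
        · simpa [coneVec] using h.1
        · simpa [coneVec] using h.2.1
        · simpa [coneVec] using h.2.2
        · by_cases hik : i + 3 ≤ k + 1
          · simp [coneVec, hik, hi, hc]
          · simp only [Pi.smul_apply, coneVec]
            simp [hik, h1 ⟨i + 3, hi⟩ (by simp) (by simp; omega)]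
      · right; right
        refine ⟨c, hc, ?_⟩
        ext ⟨i, hi⟩
        rcases i with _ | _ | _ | i
        · simpa [coneVec] using h.1
        · simpa [coneVec] using h.2.1
        · simpa [coneVec] using h.2.2
        · by_cases hik : i + 3 ≤ k + 1
          · simp [coneVec, hik, hi, hc]
          · simp only [Pi.smul_apply, coneVec]
            simp [hik, h1 ⟨i + 3, hi⟩ (by simp) (by simp; omega)]

lemma isSquare_or {q : ℕ} [Fact q.Prime] (a b : ZMod q) (ha : ¬ IsSquare a) (hb : ¬ IsSquare b) :
    IsSquare (a * b) := by
  have ha0 : a ≠ 0 := by rintro rfl; simp at ha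
  have hb0 : b ≠ 0 := by rintro rfl; simp at hb
  have e1 := (quadraticChar_dichotomy ha0).resolve_left
    (fun h => ha ((quadraticChar_one_iff_isSquare ha0).1 h))
  have e2 := (quadraticChar_dichotomy hb0).resolve_left
    (fun h => hb ((quadraticChar_one_iff_isSquare hb0).1 h))
  exact (quadraticChar_one_iff_isSquare (mul_ne_zero ha0 hb0)).1 (by rw [map_mul, e1, e2]; norm_num)

/-- The projective triangle blocks all lines. -/
lemma triVec_blocks {q : ℕ} [Fact q.Prime] (a b c : ZMod q) :
    ∃ x y z, TriVec q x y z ∧ a * x + b * y + c * z = 0 := by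
  by_cases ha : a = 0
  · exact ⟨1, 0, 0, ⟨1, one_ne_zero, 0, by simp, by simp⟩, by simp [ha]⟩
  by_cases hb : b = 0
  · exact ⟨0, 1, 0, ⟨1, one_ne_zero, 0, by simp, by simp⟩, by simp [hb]⟩
  by_cases hc : c = 0
  · exact ⟨0, 0, 1, ⟨1, one_ne_zero, 0, by simp, by simp⟩, by simp [hc]⟩
  by_cases h1 : IsSquare (b / c)
  · exact ⟨0, 1, -(b / c), ⟨1, one_ne_zero, _, h1, by simp⟩, by field_simp; ring⟩
  by_cases h2 : IsSquare (c / a)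
  · exact ⟨-(c / a), 0, 1, ⟨1, one_ne_zero, _, h2, by simp⟩, by field_simp; ring⟩
  have h3 : IsSquare (a / b) := by
    have := isSquare_or _ _ h1 h2
    have e : a / b = (b / c * (c / a))⁻¹ := by field_simp
    rw [e]; exact this.inv
  exact ⟨1, -(a / b), 0, ⟨1, one_ne_zero, _, h3, by simp⟩, by field_simp; ring⟩

lemma nonsq_aux {q : ℕ} [Fact q.Prime] (d s t : ZMod q) (hd : ¬ IsSquare d) (hs : IsSquare s)
    (ht : IsSquare t) : d ≠ s * t ∧ d * s ≠ 1 := by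
  constructor
  · rintro rfl; exact hd (hs.mul ht)
  · intro h
    apply hd
    rw [eq_inv_of_mul_eq_one_left h]; exact hs.inv

lemma tangent1 {q : ℕ} [Fact q.Prime] (d s x y z : ZMod q) (hd : ¬ IsSquare d) (hs : IsSquare s)
    (h : TriVec q x y z) (h0 : d * x + s * y + z = 0) : x = 0 ∧ z = y * -s := by
  obtain ⟨c, hc, t, ht, ⟨rfl, rfl, rfl⟩ | ⟨rfl, rfl, rfl⟩ | ⟨rfl, rfl, rfl⟩⟩ := h
  · exact ⟨rfl, by linear_combination h0⟩
  · exact absurd (mul_left_cancel₀ hc (by linear_combination -h0)) (nonsq_aux d t t hd ht ht).2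
  · exact absurd (mul_left_cancel₀ hc (by linear_combination h0)) (nonsq_aux d s t hd hs ht).1

lemma triVec_cycle {q : ℕ} [Fact q.Prime] {x y z : ZMod q} (h : TriVec q x y z) :
    TriVec q y z x := by
  obtain ⟨c, hc, t, ht, h⟩ := h
  exact ⟨c, hc, t, ht, by tauto⟩

lemma blocks {q n k : ℕ} [Fact q.Prime] (hk : 2 ≤ k) (hn : k + 2 ≤ n) :
    IsBlockingSet q n k (coneSet q n k) := by
  intro W hW
  have h3n : 3 ≤ n := by omega
  -- the part of `W` supported on the first `k + 2` coordinates
  let L : W →ₗ[ZMod q] (Fin (n - k - 2) → ZMod q) :=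
    (LinearMap.funLeft (ZMod q) (ZMod q)
      (fun i : Fin (n - k - 2) => (⟨i + (k + 2), by omega⟩ : Fin n))).comp W.subtype
  have hL : 2 ≤ Module.finrank (ZMod q) (LinearMap.ker L) := by
    have h1 := L.finrank_range_add_finrank_ker
    have h2 := Submodule.finrank_le (LinearMap.range L)
    rw [Module.finrank_fin_fun] at h2
    omega
  have hLs : ∀ w : LinearMap.ker L, ∀ i : Fin n, 2 < (i : ℕ) → k + 1 < (i : ℕ) →
      ((w : W) : Fin n → ZMod q) i = 0 := by
    intro w i _ hi
    have := congrFun w.2 ⟨i - (k + 2), by omega⟩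
    simp only [L, LinearMap.comp_apply, LinearMap.funLeft_apply, Submodule.subtype_apply,
      Pi.zero_apply] at this
    rw [← this]
    exact congrArg ((w : W) : Fin n → ZMod q) (Fin.ext (by simp; omega))
  let π : LinearMap.ker L →ₗ[ZMod q] (Fin 3 → ZMod q) :=
    (LinearMap.funLeft (ZMod q) (ZMod q) (fun i : Fin 3 => (⟨i, by omega⟩ : Fin n))).comp
      (W.subtype.comp (LinearMap.ker L).subtype)
  have hπ : ∀ (w : LinearMap.ker L) (i : Fin 3),
      π w i = ((w : W) : Fin n → ZMod q) ⟨i, by omega⟩ := fun w i => rfl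
  -- it suffices to find a suitable nonzero element
  have key : ∀ w : LinearMap.ker L, w ≠ 0 →
      (π w = 0 ∨ TriVec q (π w 0) (π w 1) (π w 2)) →
      ∃ v ∈ W, v ≠ 0 ∧ projPoint v ∈ coneSet q n k := by
    intro w hw h
    have hw0 : ((w : W) : Fin n → ZMod q) ≠ 0 := by
      intro h0
      exact hw (Subtype.ext (Subtype.ext h0))
    refine ⟨_, (w : W).2, hw0, (projPoint_mem_iff h3n _ hw0).2 ⟨hLs w, ?_⟩⟩
    rcases h with h | h
    · left
      exact ⟨congrFun h 0, congrFun h 1, congrFun h 2⟩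
    · right
      exact h
  by_cases hinj : LinearMap.ker π = ⊥
  · have hr : 2 ≤ Module.finrank (ZMod q) (LinearMap.range π) := by
      rw [LinearMap.finrank_range_of_inj (LinearMap.ker_eq_bot.1 hinj)]
      exact hL
    have hf : ∃ f : (Fin 3 → ZMod q) →ₗ[ZMod q] ZMod q, LinearMap.ker f ≤ LinearMap.range π := by
      by_cases ht : LinearMap.range π = ⊤
      · exact ⟨0, by simp [ht]⟩
      · obtain ⟨f, hf0, hf⟩ := Submodule.exists_le_ker_of_lt_top _ (lt_top_iff_ne_top.2 ht)
        refine ⟨f, le_of_eq (Submodule.eq_of_le_of_finrank_le hf ?_).symm⟩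
        have h1 : LinearMap.ker f ≠ ⊤ := fun h => hf0 (LinearMap.ker_eq_top.1 h)
        have h2 := Submodule.finrank_lt h1
        rw [Module.finrank_fin_fun] at h2
        omega
    obtain ⟨f, hf⟩ := hf
    obtain ⟨x, y, z, hT, h0⟩ := triVec_blocks (f (Pi.single 0 1)) (f (Pi.single 1 1))
      (f (Pi.single 2 1))
    have hxyz : (![x, y, z] : Fin 3 → ZMod q) ∈ LinearMap.ker f := by
      have e : (![x, y, z] : Fin 3 → ZMod q) =
          x • Pi.single 0 1 + y • Pi.single 1 1 + z • Pi.single 2 1 := by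
        ext i; fin_cases i <;> simp
      rw [LinearMap.mem_ker, e]
      simp only [map_add, map_smul, smul_eq_mul]
      linear_combination h0
    obtain ⟨w, hw⟩ := hf hxyz
    refine key w ?_ (Or.inr (by rw [hw]; simpa using hT))
    rintro rfl
    rw [map_zero] at hw
    have e0 := congrFun hw 0
    have e1 := congrFun hw 1
    have e2 := congrFun hw 2
    simp at e0 e1 e2
    obtain ⟨c, hc, t, ht, h⟩ := hT
    subst e0 e1 e2
    grind
  · obtain ⟨w, hw, hw0⟩ := Submodule.exists_mem_ne_zero_of_ne_bot hinj
    exact key w hw0 (Or.inl hw)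

/-- Removing a point `P` with a tangent space. -/
lemma tangent_space {q n k : ℕ} [Fact q.Prime]
    (P : Submodule (ZMod q) (Fin n → ZMod q))
    (L : (Fin n → ZMod q) →ₗ[ZMod q] (Fin k → ZMod q))
    (hL : ∀ v, L v = 0 → v ≠ 0 → projPoint v ∈ coneSet q n k → projPoint v = P)
    (B : Set (Submodule (ZMod q) (Fin n → ZMod q))) (hB : B ⊆ coneSet q n k) (hP : P ∉ B) :
    ¬ IsBlockingSet q n k B := by
  intro hbl
  have h1 := L.finrank_range_add_finrank_ker
  have h2 := Submodule.finrank_le (LinearMap.range L)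
  rw [Module.finrank_fin_fun] at h1 h2
  have h3 : n - k ≤ Module.finrank (ZMod q) (LinearMap.ker L) := by omega
  obtain ⟨f, hf⟩ := exists_linearIndependent_of_le_finrank h3
  have hf' : LinearIndependent (ZMod q) (fun i => (f i : Fin n → ZMod q)) :=
    hf.map' (LinearMap.ker L).subtype (Submodule.ker_subtype _)
  obtain ⟨v, hv, hv0, hvB⟩ := hbl (Submodule.span (ZMod q)
    (Set.range (fun i => (f i : Fin n → ZMod q)))) (by rw [finrank_span_eq_card hf']; simp)
  have hle : Submodule.span (ZMod q) (Set.range (fun i => (f i : Fin n → ZMod q))) ≤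
      LinearMap.ker L := by
    rw [Submodule.span_le]
    rintro _ ⟨i, rfl⟩
    exact (f i).2
  have := hL v (hle hv) hv0 (hB hvB)
  exact hP (this ▸ hvB)

/-- Tangent space at a point outside the vertex. -/
lemma tangent_base {q n k : ℕ} [Fact q.Prime] (hk : 2 ≤ k) (hn : k + 2 ≤ n)
    (a b c : ZMod q) (α : ℕ → ZMod q) (j : Fin 3) (hj : (![a, b, c] : Fin 3 → ZMod q) j = 1)
    (f0 f1 f2 : ZMod q)
    (hf : ∀ x y z, TriVec q x y z → f0 * x + f1 * y + f2 * z = 0 →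
      (![x, y, z] : Fin 3 → ZMod q) = ((![x, y, z] : Fin 3 → ZMod q) j) • ![a, b, c])
    (B : Set (Submodule (ZMod q) (Fin n → ZMod q))) (hB : B ⊆ coneSet q n k)
    (hP : projPoint (coneVec q n k a b c α) ∉ B) :
    ¬ IsBlockingSet q n k B := by
  have h3n : 3 ≤ n := by omega
  let L : (Fin n → ZMod q) →ₗ[ZMod q] (Fin k → ZMod q) := LinearMap.pi fun i : Fin k =>
    if (i : ℕ) = 0 then f0 • LinearMap.proj (⟨0, by omega⟩ : Fin n)
        + f1 • LinearMap.proj (⟨1, by omega⟩ : Fin n) + f2 • LinearMap.proj (⟨2, by omega⟩ : Fin n)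
    else LinearMap.proj (⟨i + 2, by omega⟩ : Fin n)
      - α (i + 2) • LinearMap.proj (⟨j, by omega⟩ : Fin n)
  refine tangent_space _ L ?_ B hB hP
  intro v hv hv0 hvS
  rw [projPoint_mem_iff h3n v hv0] at hvS
  obtain ⟨hout, hT⟩ := hvS
  have hL0 : f0 * v ⟨0, by omega⟩ + f1 * v ⟨1, by omega⟩ + f2 * v ⟨2, by omega⟩ = 0 := by
    have := congrFun hv ⟨0, by omega⟩
    simpa [L] using this
  have hLi : ∀ i (h : i + 3 ≤ k + 1), v ⟨i + 3, by omega⟩ = α (i + 3) * v ⟨j, by omega⟩ := by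
    intro i h
    have := congrFun hv ⟨i + 1, by omega⟩
    simp [L] at this
    linear_combination this
  have hmain : (![v ⟨0, by omega⟩, v ⟨1, by omega⟩, v ⟨2, by omega⟩] : Fin 3 → ZMod q) =
      (v ⟨j, by omega⟩) • ![a, b, c] := by
    have ej : (![v ⟨0, by omega⟩, v ⟨1, by omega⟩, v ⟨2, by omega⟩] : Fin 3 → ZMod q) j =
        v ⟨j, by omega⟩ := by
      fin_cases j <;> rfl
    rcases hT with ⟨e0, e1, e2⟩ | hT
    · rw [← ej, e0, e1, e2]
      have : (![0, 0, 0] : Fin 3 → ZMod q) = 0 := by ext i; fin_cases i <;> rfl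
      rw [this]; simp
    · rw [← ej]; exact hf _ _ _ hT hL0
  have hvec : v = v ⟨j, by omega⟩ • coneVec q n k a b c α := by
    ext ⟨i, hi⟩
    rcases i with _ | _ | _ | i
    · simpa [coneVec] using congrFun hmain 0
    · simpa [coneVec] using congrFun hmain 1
    · simpa [coneVec] using congrFun hmain 2
    · by_cases hik : i + 3 ≤ k + 1
      · simp only [Pi.smul_apply, coneVec]
        simp [hik, hLi i hik, mul_comm]
      · simp only [Pi.smul_apply, coneVec]
        simp [hik, hout ⟨i + 3, hi⟩ (by simp) (by simp; omega)]
  rw [projPoint_eq_iff]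
  refine ⟨_, ?_, hvec⟩
  intro h0
  rw [h0, zero_smul] at hvec
  exact hv0 hvec

/-- Tangent space at a point of the vertex. -/
lemma tangent_vertex {q n k : ℕ} [Fact q.Prime] (hk : 2 ≤ k) (hn : k + 2 ≤ n)
    (w : Fin n → ZMod q) (hw : w ∈ coneW q n k) (hw0 : w ≠ 0)
    (B : Set (Submodule (ZMod q) (Fin n → ZMod q))) (hB : B ⊆ coneSet q n k)
    (hP : projPoint w ∉ B) :
    ¬ IsBlockingSet q n k B := by
  have h3n : 3 ≤ n := by omega
  rw [mem_coneW_iff] at hw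
  obtain ⟨m, hm⟩ := Function.ne_iff.1 hw0
  have hm' : w m ≠ 0 := hm
  have hm3 : 3 ≤ (m : ℕ) ∧ (m : ℕ) ≤ k + 1 := by
    by_contra h
    exact hm' (hw m (by omega))
  let L : (Fin n → ZMod q) →ₗ[ZMod q] (Fin k → ZMod q) := LinearMap.pi fun i : Fin k =>
    if (i : ℕ) = 0 then LinearMap.proj (R := ZMod q) (φ := fun _ => ZMod q) (⟨0, by omega⟩ : Fin n)
        - LinearMap.proj (R := ZMod q) (φ := fun _ => ZMod q) (⟨1, by omega⟩ : Fin n)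
    else if (i : ℕ) + 2 = m then LinearMap.proj (R := ZMod q) (φ := fun _ => ZMod q) (⟨1, by omega⟩ : Fin n)
        - LinearMap.proj (R := ZMod q) (φ := fun _ => ZMod q) (⟨2, by omega⟩ : Fin n)
    else LinearMap.proj (R := ZMod q) (φ := fun _ => ZMod q) (⟨i + 2, by omega⟩ : Fin n)
      - (w ⟨i + 2, by omega⟩ / w m) • LinearMap.proj (R := ZMod q) (φ := fun _ => ZMod q) m
  refine tangent_space _ L ?_ B hB hP
  intro v hv hv0 hvS
  rw [projPoint_mem_iff h3n v hv0] at hvS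
  obtain ⟨hout, hT⟩ := hvS
  have hL0 : v ⟨0, by omega⟩ = v ⟨1, by omega⟩ := by
    have := congrFun hv ⟨0, by omega⟩
    simp [L] at this
    linear_combination this
  have hL1 : v ⟨1, by omega⟩ = v ⟨2, by omega⟩ := by
    have := congrFun hv ⟨m - 2, by omega⟩
    have h1 : ¬ ((m : ℕ) - 2 = 0) := by omega
    have h2 : (m : ℕ) - 2 + 2 = m := by omega
    simp only [L, LinearMap.pi_apply, if_neg h1, if_pos h2] at this
    simp at this
    linear_combination this
  have hLi : ∀ i (h : i + 3 ≤ k + 1), v ⟨i + 3, by omega⟩ = v m / w m * w ⟨i + 3, by omega⟩ := by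
    intro i h
    by_cases him : i + 3 = m
    · have : (⟨i + 3, by omega⟩ : Fin n) = m := Fin.ext him
      rw [this]; field_simp
    · have := congrFun hv ⟨i + 1, by omega⟩
      have h1 : ¬ (i + 1 + 2 = (m : ℕ)) := by omega
      simp [L, h1] at this
      linear_combination this
  have hz : v ⟨0, by omega⟩ = 0 ∧ v ⟨1, by omega⟩ = 0 ∧ v ⟨2, by omega⟩ = 0 := by
    rcases hT with h | ⟨c, hc, t, ht, h⟩
    · exact h
    · exfalso
      rw [hL0, hL1] at h
      grind
  have hvec : v = (v m / w m) • w := by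
    ext ⟨i, hi⟩
    rcases i with _ | _ | _ | i
    · simp [hw ⟨0, hi⟩ (by simp), hz.1]
    · simp [hw ⟨1, hi⟩ (by simp), hz.2.1]
    · simp [hw ⟨2, hi⟩ (by simp), hz.2.2]
    · by_cases hik : i + 3 ≤ k + 1
      · exact hLi i hik
      · rw [Pi.smul_apply, hw ⟨i + 3, hi⟩ (Or.inr (show k + 1 < i + 3 by omega)),
          hout ⟨i + 3, hi⟩ (by simp) (show k + 1 < i + 3 by omega)]
        simp
  rw [projPoint_eq_iff]
  refine ⟨_, ?_, hvec⟩
  intro h0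
  rw [h0, zero_smul] at hvec
  exact hv0 hvec

lemma minimal {q n k : ℕ} [Fact q.Prime] (hodd : Odd q) (hk : 2 ≤ k) (hn : k + 2 ≤ n)
    (B : Set (Submodule (ZMod q) (Fin n → ZMod q))) (hB : B ⊂ coneSet q n k) :
    ¬ IsBlockingSet q n k B := by
  obtain ⟨d, hd⟩ := FiniteField.exists_nonsquare (F := ZMod q) (by
    rw [ZMod.ringChar_zmod_n]; rintro rfl; exact absurd hodd (by decide))
  obtain ⟨P, hPS, hPB⟩ := Set.exists_of_ssubset hB
  rcases hPS with ⟨s, hs, α, rfl | rfl | rfl⟩ | ⟨w, hw, hw0, rfl⟩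
  · rw [mem_Q0_iff] at hs
    refine tangent_base hk hn 0 1 (-s) α 1 rfl d s 1 ?_ B hB.1 hPB
    intro x y z hT h0
    obtain ⟨h1, h2⟩ := tangent1 d s x y z hd hs hT (by linear_combination h0)
    ext i; fin_cases i <;> simp [h1, h2]
  · rw [mem_Q0_iff] at hs
    refine tangent_base hk hn (-s) 0 1 α 2 rfl 1 d s ?_ B hB.1 hPB
    intro x y z hT h0
    obtain ⟨h1, h2⟩ := tangent1 d s y z x hd hs (triVec_cycle hT) (by linear_combination h0)
    ext i; fin_cases i <;> simp [h1, h2]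
  · rw [mem_Q0_iff] at hs
    refine tangent_base hk hn 1 (-s) 0 α 0 rfl s 1 d ?_ B hB.1 hPB
    intro x y z hT h0
    obtain ⟨h1, h2⟩ := tangent1 d s z x y hd hs (triVec_cycle (triVec_cycle hT))
      (by linear_combination h0)
    ext i; fin_cases i <;> simp [h1, h2]
  · exact tangent_vertex hk hn w hw hw0 B hB.1 hPB

lemma card_sq {q : ℕ} [Fact q.Prime] (hodd : Odd q) :
    Nat.card {s : ZMod q // IsSquare s} = (q + 1) / 2 := by
  classical
  have hF : ringChar (ZMod q) ≠ 2 := by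
    rw [ZMod.ringChar_zmod_n]; rintro rfl; exact absurd hodd (by decide)
  have h1 := quadraticChar_sum_zero (F := ZMod q) hF
  have h2 : ∀ a : ZMod q, quadraticChar (ZMod q) a =
      2 * (if IsSquare a then 1 else 0) - 1 - (if a = 0 then 1 else 0) := by
    intro a
    by_cases ha : a = 0
    · simp [ha]
    · by_cases hs : IsSquare a
      · rw [(quadraticChar_one_iff_isSquare ha).2 hs]; simp [ha, hs]
      · rw [(quadraticChar_dichotomy ha).resolve_left
          (fun h => hs ((quadraticChar_one_iff_isSquare ha).1 h))]
        simp [ha, hs]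
  rw [Finset.sum_congr rfl (fun a _ => h2 a), Finset.sum_sub_distrib, Finset.sum_sub_distrib,
    ← Finset.mul_sum, Finset.sum_boole] at h1
  simp at h1
  rw [Nat.card_eq_fintype_card, Fintype.card_subtype]
  omega

/-- The base vectors of the triangle. -/
def triBase (q : ℕ) (t : Fin 3) (s : ZMod q) : Fin 3 → ZMod q :=
  if t = 0 then ![0, 1, -s] else if t = 1 then ![-s, 0, 1] else ![1, -s, 0]

lemma triBase_inj {q : ℕ} [Fact q.Prime] (t t' : Fin 3) (s s' c : ZMod q) (hc : c ≠ 0)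
    (h : triBase q t s = c • triBase q t' s') : t = t' ∧ s = s' ∧ c = 1 := by
  have h0 := congrFun h 0
  have h1 := congrFun h 1
  have h2 := congrFun h 2
  fin_cases t <;> fin_cases t' <;> simp [triBase] at h0 h1 h2 ⊢ <;> grind

lemma triBase_ne {q : ℕ} [Fact q.Prime] (t : Fin 3) (s : ZMod q) : ∃ i, triBase q t s i = 1 := by
  fin_cases t
  · exact ⟨1, by simp [triBase]⟩
  · exact ⟨2, by simp [triBase]⟩
  · exact ⟨0, by simp [triBase]⟩

/-- Extension of a tuple to positions `3, …, k + 1`. -/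
def extTuple {q k : ℕ} (β : Fin (k - 1) → ZMod q) : ℕ → ZMod q :=
  fun i => if h : i - 3 < k - 1 then β ⟨i - 3, h⟩ else 0

/-- Vectors representing the cone points outside the vertex. -/
def baseVec (q n k : ℕ) (x : Fin 3 × {s : ZMod q // IsSquare s} × (Fin (k - 1) → ZMod q)) :
    Fin n → ZMod q :=
  coneVec q n k (triBase q x.1 x.2.1 0) (triBase q x.1 x.2.1 1) (triBase q x.1 x.2.1 2)
    (extTuple x.2.2)

lemma baseVec_apply {q n k : ℕ} (hn : 3 ≤ n)
    (x : Fin 3 × {s : ZMod q // IsSquare s} × (Fin (k - 1) → ZMod q)) (i : Fin 3) :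
    baseVec q n k x ⟨i, by omega⟩ = triBase q x.1 x.2.1 i := by
  fin_cases i <;> simp [baseVec, coneVec]

lemma baseVec_inj {q n k : ℕ} [Fact q.Prime] (hk : 2 ≤ k) (hn : k + 2 ≤ n) :
    Function.Injective (fun x => projPoint (baseVec q n k x)) := by
  rintro x y h
  simp only [projPoint_eq_iff] at h
  obtain ⟨c, hc, h⟩ := h
  have h3 : triBase q x.1 x.2.1 = c • triBase q y.1 y.2.1 := by
    ext i
    have := congrFun h ⟨i, by omega⟩
    rwa [Pi.smul_apply, baseVec_apply (by omega), baseVec_apply (by omega)] at this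
  obtain ⟨h1, h2, rfl⟩ := triBase_inj _ _ _ _ _ hc h3
  refine Prod.ext h1 (Prod.ext (Subtype.ext h2) ?_)
  ext i
  have := congrFun h ⟨i + 3, by omega⟩
  have hi : (i : ℕ) + 3 ≤ k + 1 := by omega
  simpa [baseVec, coneVec, extTuple, hi] using this

lemma coneVec_congr {q n k : ℕ} (a b c : ZMod q) (α : ℕ → ZMod q) :
    coneVec q n k a b c α =
      coneVec q n k a b c (extTuple (fun i : Fin (k - 1) => α (i + 3))) := by
  ext ⟨i, hi⟩
  rcases i with _ | _ | _ | i
  · simp [coneVec]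
  · simp [coneVec]
  · simp [coneVec]
  · by_cases hik : i + 3 ≤ k + 1
    · have : i < k - 1 := by omega
      simp [coneVec, hik, extTuple, this]
    · simp [coneVec, hik]

lemma range_base {q n k : ℕ} [Fact q.Prime] :
    {P | ∃ s ∈ Q0 q, ∃ α : ℕ → ZMod q,
      P = projPoint (coneVec q n k 0 1 (-s) α) ∨
      P = projPoint (coneVec q n k (-s) 0 1 α) ∨
      P = projPoint (coneVec q n k 1 (-s) 0 α)} =
    Set.range (fun x => projPoint (baseVec q n k x)) := by
  ext P
  constructor
  · rintro ⟨s, hs, α, h⟩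
    rw [mem_Q0_iff] at hs
    rw [coneVec_congr 0, coneVec_congr (-s), coneVec_congr 1] at h
    rcases h with rfl | rfl | rfl
    · exact ⟨(0, ⟨s, hs⟩, _), rfl⟩
    · exact ⟨(1, ⟨s, hs⟩, _), rfl⟩
    · exact ⟨(2, ⟨s, hs⟩, _), rfl⟩
  · rintro ⟨⟨t, ⟨s, hs⟩, β⟩, rfl⟩
    refine ⟨s, (mem_Q0_iff s).2 hs, extTuple β, ?_⟩
    fin_cases t
    · left; rfl
    · right; left; rfl
    · right; right; rfl

lemma finrank_coneW {q n k : ℕ} [Fact q.Prime] (hk : 2 ≤ k) (hn : k + 2 ≤ n) :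
    Module.finrank (ZMod q) (coneW q n k) = k - 1 := by
  let e : Fin (k - 1) → Fin n := fun i => ⟨i + 3, by omega⟩
  have he : Function.Injective e := by
    intro i j h
    simp [e] at h
    exact Fin.ext h
  have hli : LinearIndependent (ZMod q) (fun i => (Pi.single (e i) 1 : Fin n → ZMod q)) := by
    have := (Pi.basisFun (ZMod q) (Fin n)).linearIndependent.comp e he
    convert this using 1
    ext i
    simp
  have : coneW q n k = Submodule.span (ZMod q)
      (Set.range (fun i => (Pi.single (e i) 1 : Fin n → ZMod q))) := by
    unfold coneW
    congr 1
    ext v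
    constructor
    · rintro ⟨j, h1, h2, rfl⟩
      refine ⟨⟨j - 3, by omega⟩, ?_⟩
      have : e ⟨j - 3, by omega⟩ = j := Fin.ext (by simp [e]; omega)
      simp only [this]
    · rintro ⟨i, rfl⟩
      exact ⟨e i, by simp [e], by simp [e]; omega, rfl⟩
  rw [this, finrank_span_eq_card hli, Fintype.card_fin]

lemma ncard_vertex {q n k : ℕ} [Fact q.Prime] (hk : 2 ≤ k) (hn : k + 2 ≤ n) :
    Set.ncard {P | ∃ v ∈ coneW q n k, v ≠ 0 ∧ P = projPoint v} =
      ∑ i ∈ Finset.range (k - 1), q ^ i := by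
  let G : Projectivization (ZMod q) (coneW q n k) → Submodule (ZMod q) (Fin n → ZMod q) :=
    fun P => P.submodule.map (coneW q n k).subtype
  have hG : Function.Injective G := by
    intro P Q h
    exact Projectivization.submodule_injective
      (Submodule.map_injective_of_injective (Submodule.injective_subtype _) h)
  have hr : {P | ∃ v ∈ coneW q n k, v ≠ 0 ∧ P = projPoint v} = Set.range G := by
    ext P
    constructor
    · rintro ⟨v, hv, hv0, rfl⟩
      refine ⟨Projectivization.mk (ZMod q) ⟨v, hv⟩ (fun h => hv0 (congrArg Subtype.val h)), ?_⟩
      simp [G, Projectivization.submodule_mk, Submodule.map_span, projPoint]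
    · rintro ⟨P, rfl⟩
      refine ⟨P.rep, P.rep.2, fun h => P.rep_nonzero (Subtype.ext h), ?_⟩
      simp [G, Projectivization.submodule_eq, Submodule.map_span, projPoint]
  rw [hr, ← Set.image_univ, Set.ncard_image_of_injective _ hG, Set.ncard_univ,
    Projectivization.card_of_finrank _ _ (finrank_coneW hk hn)]
  simp

lemma ncard_base {q n k : ℕ} [Fact q.Prime] (hodd : Odd q) (hk : 2 ≤ k) (hn : k + 2 ≤ n) :
    Set.ncard (Set.range (fun x => projPoint (baseVec q n k x))) =
      3 * ((q + 1) / 2 * q ^ (k - 1)) := by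
  rw [← Set.image_univ, Set.ncard_image_of_injective _ (baseVec_inj hk hn), Set.ncard_univ,
    Nat.card_prod, Nat.card_prod, card_sq hodd]
  simp

lemma count {q n k : ℕ} [Fact q.Prime] (hodd : Odd q) (hk : 2 ≤ k) (hn : k + 2 ≤ n) :
    (coneSet q n k).ncard =
        (∑ i ∈ Finset.range (k + 1), q ^ i) + q ^ (k - 1) * ((q + 1) / 2) := by
  unfold coneSet
  rw [range_base, Set.ncard_union_eq ?_ (Set.toFinite _) (Set.toFinite _), ncard_base hodd hk hn,
    ncard_vertex hk hn]
  · obtain ⟨m, rfl⟩ : ∃ m, k = m + 1 := ⟨k - 1, by omega⟩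
    obtain ⟨r, rfl⟩ := hodd
    have : (2 * r + 1 + 1) / 2 = r + 1 := by omega
    rw [Finset.sum_range_succ, Finset.sum_range_succ, this]
    simp only [Nat.add_sub_cancel]
    ring
  · rw [Set.disjoint_left]
    rintro _ ⟨x, rfl⟩ ⟨v, hv, hv0, h⟩
    simp only [projPoint_eq_iff] at h
    obtain ⟨c, hc, h⟩ := h
    obtain ⟨i, hi⟩ := triBase_ne x.1 (x.2.1 : ZMod q)
    rw [← baseVec_apply (n := n) (by omega) x i, h] at hi
    rw [mem_coneW_iff] at hv
    have := hv ⟨i, by omega⟩ (Or.inl i.2)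
    simp [this] at hi

/-- **Proposition.** For `q` an odd prime, `k ≥ 2` and `n ≥ k + 2`, the cone over the projective
triangle is a minimal `k`-blocking set of `PG(F_q^n)` of size
`(q^{k+1}-1)/(q-1) + q^{k-1}(q+1)/2`. -/
theorem stmt16 (q n k : ℕ) (hq : q.Prime) (hodd : Odd q) (hk : 2 ≤ k) (hn : k + 2 ≤ n) :
    IsBlockingSet q n k (coneSet q n k) ∧
      (∀ B : Set (Submodule (ZMod q) (Fin n → ZMod q)),
        B ⊂ coneSet q n k → ¬ IsBlockingSet q n k B) ∧
      (coneSet q n k).ncard =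
        (∑ i ∈ Finset.range (k + 1), q ^ i) + q ^ (k - 1) * ((q + 1) / 2) := by
  haveI : Fact q.Prime := ⟨hq⟩
  exact ⟨blocks hk hn, fun B hB => minimal hodd hk hn B hB, count hodd hk hn⟩
end
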